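/- arXiv:1810.13360 — 3 statements merged into one kernel-verified Lean document; each statement's English description precedes it below -/
import Mathlib

section
/- Let P₀ ∈ ℤ[x] be a nonzero polynomial, and let k be the number of distinct monic irreducible factors of P₀ in ℚ[x]. For y > 2, let E(y) denote the average over the primes p with y ≤ p < 2y of the number of residues a ∈ 𝔽_p with P₀(a) ≡ 0 (mod p); that is, E(y) = (∑_{y ≤ p < 2y} #{a ∈ 𝔽_p : P₀(a) = 0 in 𝔽_p}) / #{p prime : y ≤ p < 2y}. Then E(y) → k as y → ∞. -/
open Polynomial Filter

/-- The number of residues `a ∈ 𝔽_p` with `P(a) = 0` in `𝔽_p`. -/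
noncomputable def rootCountMod (P : Polynomial ℤ) (p : ℕ) : ℕ :=
  Nat.card {a : ZMod p // aeval a P = 0}

/-- The primes `p` with `y ≤ p < 2y`. -/
noncomputable def primesIn (y : ℝ) : Finset ℕ :=
  (Finset.range (Nat.ceil (2 * y) + 1)).filter fun p => p.Prime ∧ y ≤ (p : ℝ) ∧ (p : ℝ) < 2 * y

/-- The average over primes `p ∈ [y, 2y)` of the number of roots of `P` in `𝔽_p`. -/
noncomputable def avgRootCount (P : Polynomial ℤ) (y : ℝ) : ℝ :=
  (∑ p ∈ primesIn y, (rootCountMod P p : ℝ)) / ((primesIn y).card : ℝ)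



namespace Tauberian
open MeasureTheory Set Topology

/-- The Fejér kernel, normalised as the Fourier transform of the triangle function. -/
noncomputable def fejer (v : ℝ) : ℝ := ∫ t in (0 : ℝ)..1, 2 * (1 - t) * Real.cos (t * v)

lemma fejer_mul_sq (v : ℝ) : fejer v * v ^ 2 = 2 * (1 - Real.cos v) := by
  rcases eq_or_ne v 0 with rfl | hv
  · simp
  have h : ∀ t ∈ uIcc (0 : ℝ) 1,
      HasDerivAt (fun t => 2 * ((1 - t) * Real.sin (t * v) / v - Real.cos (t * v) / v ^ 2))
        (2 * (1 - t) * Real.cos (t * v)) t := by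
    intro t _
    have h1 : HasDerivAt (fun t : ℝ => t * v) v t := by simpa using (hasDerivAt_id t).mul_const v
    have h2 : HasDerivAt (fun t : ℝ => 1 - t) (-1) t := by
      simpa using (hasDerivAt_id t).const_sub 1
    have := (((h2.mul h1.sin).div_const v).sub (h1.cos.div_const (v ^ 2))).const_mul 2
    refine this.congr_deriv ?_
    field_simp
    ring
  have hi : fejer v = _ := intervalIntegral.integral_eq_sub_of_hasDerivAt h
    (Continuous.intervalIntegrable (by fun_prop) _ _)
  rw [hi]
  field_simp
  simp
  ring

lemma continuous_fejer : Continuous fejer := by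
  unfold fejer
  exact intervalIntegral.continuous_parametric_intervalIntegral_of_continuous' (by fun_prop) 0 1

lemma fejer_zero : fejer 0 = 1 := by
  simp only [fejer, mul_zero, Real.cos_zero, mul_one, intervalIntegral.integral_const_mul]
  rw [intervalIntegral.integral_sub (by simp) (by simp), integral_id]
  norm_num

lemma fejer_nonneg (v : ℝ) : 0 ≤ fejer v := by
  rcases eq_or_ne v 0 with rfl | hv
  · simp [fejer_zero]
  · have h := fejer_mul_sq v
    have : 0 ≤ 2 * (1 - Real.cos v) := by linarith [Real.cos_le_one v]
    rw [← h] at this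
    exact nonneg_of_mul_nonneg_left this (by positivity)

lemma fejer_le (v : ℝ) : fejer v ≤ 6 * (1 + v ^ 2)⁻¹ := by
  have h1 : fejer v ≤ 2 := by
    have := intervalIntegral.norm_integral_le_of_norm_le_const (a := 0) (b := 1) (C := 2)
      (f := fun t : ℝ => 2 * (1 - t) * Real.cos (t * v)) ?_
    · exact (le_abs_self _).trans (by simpa [fejer] using this)
    · intro t ht
      rw [uIoc_of_le zero_le_one] at ht
      rw [Real.norm_eq_abs, abs_mul, abs_of_nonneg (by linarith [ht.2])]
      nlinarith [Real.abs_cos_le_one (t * v), abs_nonneg (Real.cos (t * v)), ht.1, ht.2]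
  have h2 := fejer_mul_sq v
  rw [← div_eq_mul_inv, le_div_iff₀ (by positivity)]
  nlinarith [Real.neg_one_le_cos v]

lemma integrable_fejer : Integrable fejer := by
  refine (integrable_inv_one_add_sq.const_mul 6).mono' continuous_fejer.aestronglyMeasurable ?_
  exact Eventually.of_forall fun v => by
    rw [Real.norm_of_nonneg (fejer_nonneg v)]; exact fejer_le v

lemma integral_fejer_pos : 0 < ∫ v, fejer v := by
  rw [integral_pos_iff_support_of_nonneg fejer_nonneg integrable_fejer]
  have : IsOpen (Function.support fejer) := continuous_fejer.isOpen_support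
  exact this.measure_pos _ ⟨0, by simp [fejer_zero]⟩

lemma fejer_eq_re (v : ℝ) :
    (fejer v : ℝ) = (∫ t in (0 : ℝ)..1, (2 * (1 - t) : ℂ) * Complex.exp (t * v * Complex.I)).re := by
  have h : IntervalIntegrable
      (fun t : ℝ => (2 * (1 - t) : ℂ) * Complex.exp (t * v * Complex.I)) volume 0 1 :=
    Continuous.intervalIntegrable (by fun_prop) _ _
  have := Complex.reCLM.intervalIntegral_comp_comm h
  simp only [Complex.reCLM_apply] at this
  rw [← this, fejer]
  refine intervalIntegral.integral_congr fun t _ => ?_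
  have e : (2 * (1 - t) : ℂ) = ((2 * (1 - t) : ℝ) : ℂ) := by push_cast; ring
  rw [e, Complex.re_ofReal_mul, ← Complex.ofReal_mul, Complex.exp_ofReal_mul_I_re]

section Limit
variable {f : ℝ → ℝ} {M : ℝ} {G : ℂ → ℂ}

lemma integrableOn_laplace (hf : Measurable f) (hM : ∀ u, |f u| ≤ M) {σ : ℝ} (hσ : 0 < σ) :
    IntegrableOn (fun u => f u * Real.exp (-σ * u)) (Ioi 0) := by
  have h1 : IntegrableOn (fun u => M * Real.exp (-σ * u)) (Ioi 0) :=
    (exp_neg_integrableOn_Ioi 0 hσ).const_mul M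
  refine h1.mono' (by fun_prop) (Eventually.of_forall fun u => ?_)
  rw [norm_mul, Real.norm_of_nonneg (Real.exp_nonneg _)]
  exact mul_le_mul_of_nonneg_right (hM u) (Real.exp_nonneg _)

lemma damped_identity (hf : Measurable f) (hM : ∀ u, |f u| ≤ M)
    (hG : ∀ z : ℂ, 0 < z.re → ∫ u in Ioi (0 : ℝ), (f u : ℂ) * Complex.exp (-z * u) = G z)
    {σ : ℝ} (hσ : 0 < σ) (l T : ℝ) :
    ∫ u in Ioi (0 : ℝ), f u * Real.exp (-σ * u) * fejer (l * (T - u)) =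
      (∫ t in (0 : ℝ)..1, (2 * (1 - t) : ℂ) * Complex.exp (t * (l * T) * Complex.I) *
        G (σ + t * l * Complex.I)).re := by
  set F : ℝ → ℝ → ℂ := fun u t => ((f u * Real.exp (-σ * u) : ℝ) : ℂ) *
    ((2 * (1 - t) : ℂ) * Complex.exp (t * (l * (T - u)) * Complex.I)) with hF
  have hintegrable : Integrable (Function.uncurry F)
      ((volume.restrict (Ioi 0)).prod (volume.restrict (Ioc 0 1))) := by
    have h1 : Integrable (fun p : ℝ × ℝ => ((f p.1 * Real.exp (-σ * p.1) : ℝ) : ℂ) * (1 : ℂ))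
        ((volume.restrict (Ioi 0)).prod (volume.restrict (Ioc 0 1))) :=
      Integrable.mul_prod (integrableOn_laplace hf hM hσ).ofReal (integrable_const (1 : ℂ))
    have h2 : ∀ᵐ p ∂((volume.restrict (Ioi (0 : ℝ))).prod (volume.restrict (Ioc (0 : ℝ) 1))),
        p.2 ∈ Ioc (0 : ℝ) 1 := by
      rw [Measure.prod_restrict]
      exact (ae_restrict_mem (measurableSet_Ioi.prod measurableSet_Ioc)).mono fun p hp => hp.2
    refine ((h1.norm).const_mul 2).mono' (by fun_prop) ?_
    filter_upwards [h2] with p hp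
    simp only [Function.uncurry, hF, norm_mul, mul_one]
    have e1 : ‖Complex.exp (p.2 * (l * (T - p.1)) * Complex.I)‖ = 1 := by
      have := Complex.norm_exp_ofReal_mul_I (p.2 * (l * (T - p.1)))
      push_cast at this; exact this
    have e2 : ‖(1 - p.2 : ℂ)‖ ≤ 1 := by
      have : (1 - p.2 : ℂ) = ((1 - p.2 : ℝ) : ℂ) := by push_cast; rfl
      rw [this, Complex.norm_real, Real.norm_of_nonneg (by linarith [hp.2])]
      linarith [hp.1]
    rw [e1]
    simp only [Complex.norm_ofNat, mul_one]
    nlinarith [norm_nonneg ((f p.1 * Real.exp (-σ * p.1) : ℝ) : ℂ)]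
  have hswap := integral_integral_swap hintegrable
  have hL : ∫ u in Ioi (0 : ℝ), f u * Real.exp (-σ * u) * fejer (l * (T - u)) =
      (∫ u in Ioi (0 : ℝ), ∫ t in Ioc (0 : ℝ) 1, F u t).re := by
    have := (Complex.reCLM.integral_comp_comm hintegrable.integral_prod_left)
    simp only [Complex.reCLM_apply] at this
    simp only [Function.uncurry_apply_pair] at this
    rw [← this]
    refine setIntegral_congr_fun measurableSet_Ioi fun u _ => ?_
    simp only [hF]
    rw [integral_const_mul, Complex.re_ofReal_mul, fejer_eq_re,
      intervalIntegral.integral_of_le zero_le_one]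
    push_cast
    rfl
  rw [hL, hswap, intervalIntegral.integral_of_le zero_le_one]
  congr 1
  refine setIntegral_congr_fun measurableSet_Ioc fun t _ => ?_
  rw [← hG _ (by simpa using hσ), ← integral_const_mul]
  refine setIntegral_congr_fun measurableSet_Ioi fun u _ => ?_
  simp only [hF]
  push_cast
  have : Complex.exp (t * (l * (T - u)) * Complex.I) * Complex.exp (-σ * u) =
    Complex.exp (t * (l * T) * Complex.I) * Complex.exp (-(σ + t * l * Complex.I) * u) := by
    rw [← Complex.exp_add, ← Complex.exp_add]; congr 1; ring
  linear_combination (f u : ℂ) * (2 * (1 - t)) * this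

lemma integrable_fejer_scaled {l : ℝ} (hl : 0 < l) (T : ℝ) :
    Integrable fun u => fejer (l * (T - u)) :=
  (integrable_fejer.comp_mul_left' hl.ne').comp_sub_left T

lemma boundary_identity (hf : Measurable f) (hM : ∀ u, |f u| ≤ M)
    (hG : ∀ z : ℂ, 0 < z.re → ∫ u in Ioi (0 : ℝ), (f u : ℂ) * Complex.exp (-z * u) = G z)
    (hGc : ContinuousOn G {z | 0 ≤ z.re}) {l : ℝ} (hl : 0 < l) (T : ℝ) :
    ∫ u in Ioi (0 : ℝ), f u * fejer (l * (T - u)) =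
      (∫ t in (0 : ℝ)..1, (2 * (1 - t) : ℂ) * Complex.exp (t * (l * T) * Complex.I) *
        G (t * l * Complex.I)).re := by
  have hl1 : Tendsto (fun σ : ℝ =>
      ∫ u in Ioi (0 : ℝ), f u * Real.exp (-σ * u) * fejer (l * (T - u))) (𝓝[>] 0)
      (𝓝 (∫ u in Ioi (0 : ℝ), f u * fejer (l * (T - u)))) := by
    refine tendsto_integral_filter_of_dominated_convergence (fun u => M * fejer (l * (T - u)))
      ?_ ?_ ((integrable_fejer_scaled hl T).const_mul M).integrableOn ?_
    · refine Eventually.of_forall fun σ => ?_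
      have := continuous_fejer.measurable
      fun_prop
    · filter_upwards [self_mem_nhdsWithin] with σ hσ
      refine (ae_restrict_mem measurableSet_Ioi).mono fun u hu => ?_
      rw [norm_mul, norm_mul, Real.norm_of_nonneg (fejer_nonneg _),
        Real.norm_of_nonneg (Real.exp_nonneg _)]
      refine mul_le_mul_of_nonneg_right ?_ (fejer_nonneg _)
      have h1 : Real.exp (-σ * u) ≤ 1 :=
        Real.exp_le_one_iff.2 (by nlinarith [mem_Ioi.1 hσ, mem_Ioi.1 hu])
      calc ‖f u‖ * Real.exp (-σ * u) ≤ ‖f u‖ * 1 := by gcongr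
        _ ≤ M := by simpa using hM u
    · refine Eventually.of_forall fun u => ?_
      have : Continuous fun σ : ℝ => f u * Real.exp (-σ * u) * fejer (l * (T - u)) := by fun_prop
      have := (this.tendsto 0).mono_left (nhdsWithin_le_nhds (s := Ioi 0))
      simpa using this
  have hl2 : Tendsto (fun σ : ℝ =>
      (∫ t in (0 : ℝ)..1, (2 * (1 - t) : ℂ) * Complex.exp (t * (l * T) * Complex.I) *
        G (σ + t * l * Complex.I)).re) (𝓝[>] 0)
      (𝓝 (∫ t in (0 : ℝ)..1, (2 * (1 - t) : ℂ) * Complex.exp (t * (l * T) * Complex.I) *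
        G (t * l * Complex.I)).re) := by
    refine (Complex.continuous_re.tendsto _).comp ?_
    have hcont : ContinuousOn (Function.uncurry fun (σ t : ℝ) =>
        (2 * (1 - t) : ℂ) * Complex.exp (t * (l * T) * Complex.I) *
        G (σ + t * l * Complex.I)) (Icc 0 1 ×ˢ Icc 0 1) := by
      refine ContinuousOn.mul (by fun_prop) (hGc.comp (by fun_prop) ?_)
      rintro ⟨σ, t⟩ ⟨h1, h2⟩
      simpa using h1.1
    obtain ⟨B, hB⟩ := (isCompact_Icc.prod isCompact_Icc).exists_bound_of_continuousOn hcont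
    refine intervalIntegral.tendsto_integral_filter_of_dominated_convergence (fun _ => B) ?_ ?_
      (by simp) ?_
    · filter_upwards [Ioc_mem_nhdsGT zero_lt_one] with σ hσ
      refine ContinuousOn.aestronglyMeasurable ?_ measurableSet_uIoc
      refine hcont.comp (f := fun t => (σ, t)) (by fun_prop) fun t ht => ?_
      rw [uIoc_of_le zero_le_one] at ht
      exact ⟨⟨hσ.1.le, hσ.2⟩, ⟨ht.1.le, ht.2⟩⟩
    · filter_upwards [Ioc_mem_nhdsGT zero_lt_one] with σ hσ
      refine Eventually.of_forall fun t ht => ?_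
      rw [uIoc_of_le zero_le_one] at ht
      exact hB (σ, t) ⟨⟨hσ.1.le, hσ.2⟩, ⟨ht.1.le, ht.2⟩⟩
    · refine Eventually.of_forall fun t ht => ?_
      rw [uIoc_of_le zero_le_one] at ht
      refine Tendsto.const_mul _ ?_
      have hG0 := hGc (t * l * Complex.I) (by simp)
      refine hG0.tendsto.comp (tendsto_nhdsWithin_iff.2 ⟨?_, ?_⟩)
      · have : Continuous fun σ : ℝ => (σ : ℂ) + t * l * Complex.I := by fun_prop
        have := (this.tendsto 0).mono_left (nhdsWithin_le_nhds (s := Ioi 0))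
        simpa using this
      · filter_upwards [self_mem_nhdsWithin] with σ hσ
        simpa using (mem_Ioi.1 hσ).le
  refine tendsto_nhds_unique hl1 (hl2.congr' ?_)
  filter_upwards [self_mem_nhdsWithin] with σ hσ
  exact (damped_identity hf hM hG hσ l T).symm

lemma tendsto_fejer_average (hf : Measurable f) (hM : ∀ u, |f u| ≤ M)
    (hG : ∀ z : ℂ, 0 < z.re → ∫ u in Ioi (0 : ℝ), (f u : ℂ) * Complex.exp (-z * u) = G z)
    (hGc : ContinuousOn G {z | 0 ≤ z.re}) {l : ℝ} (hl : 0 < l) :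
    Tendsto (fun T : ℝ => ∫ u in Ioi (0 : ℝ), f u * fejer (l * (T - u))) atTop (𝓝 0) := by
  simp_rw [boundary_identity hf hM hG hGc hl]
  change Tendsto _ atTop (𝓝 (0 : ℂ).re)
  refine (Complex.continuous_re.tendsto _).comp ?_
  have hRL := Real.tendsto_integral_exp_smul_cocompact
    (indicator (Ioc (0 : ℝ) 1) fun t : ℝ => (2 * (1 - t) : ℂ) * G (t * l * Complex.I))
  have hT : Tendsto (fun T : ℝ => -(l * T / (2 * Real.pi))) atTop (cocompact ℝ) := by
    refine (tendsto_neg_atTop_atBot.comp ?_).mono_right atBot_le_cocompact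
    exact (tendsto_id.const_mul_atTop hl).atTop_div_const (by positivity)
  refine (hRL.comp hT).congr fun T => ?_
  simp only [Function.comp]
  rw [intervalIntegral.integral_of_le zero_le_one, ← integral_indicator measurableSet_Ioc]
  congr 1
  ext t
  by_cases ht : t ∈ Ioc (0 : ℝ) 1
  · simp only [indicator_of_mem ht, Circle.smul_def, Real.fourierChar_apply, smul_eq_mul]
    have : 2 * Real.pi * -(t * -(l * T / (2 * Real.pi))) = t * (l * T) := by
      field_simp
    rw [this]
    push_cast
    ring
  · simp [indicator_of_notMem ht]

/-- A Tauberian theorem: a bounded function `g` on the half-line with `e ^ u * g u` monotone, such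
that the Laplace transform of `g - 1` extends continuously to the imaginary axis, tends to `1`. -/
theorem tendsto_one_of_laplace {g : ℝ → ℝ} (hg : Measurable g) (hg0 : ∀ u, 0 ≤ g u)
    (hgM : ∀ u, g u ≤ M) (hmono : ∀ u v, 0 ≤ u → u ≤ v → g u * Real.exp (-(v - u)) ≤ g v)
    (hG : ∀ z : ℂ, 0 < z.re →
      ∫ u in Ioi (0 : ℝ), ((g u - 1 : ℝ) : ℂ) * Complex.exp (-z * u) = G z)
    (hGc : ContinuousOn G {z | 0 ≤ z.re}) :
    Tendsto g atTop (𝓝 1) := by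
  set c := ∫ v, fejer v with hc
  have hc0 : 0 < c := integral_fejer_pos
  have hM0 : 0 ≤ M := (hg0 0).trans (hgM 0)
  set I : ℝ → ℝ := fun R => ∫ v in Icc (-R) R, fejer v with hI
  have hIlim : Tendsto I atTop (𝓝 c) := by
    have := intervalIntegral_tendsto_integral integrable_fejer tendsto_neg_atTop_atBot tendsto_id
    refine this.congr' ?_
    filter_upwards [eventually_ge_atTop 0] with R hR
    change _ = ∫ v in Icc (-R) R, fejer v
    rw [integral_Icc_eq_integral_Ioc, intervalIntegral.integral_of_le (by simp; linarith)]
    rfl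
  -- the scaled kernel
  have hfm : Measurable fejer := continuous_fejer.measurable
  have hscal : ∀ {l : ℝ}, 0 < l → ∀ T, ∫ u, fejer (l * (T - u)) = l⁻¹ * c := by
    intro l hl T
    rw [integral_sub_left_eq_self (fun u => fejer (l * u)) volume T,
      Measure.integral_comp_mul_left, abs_of_pos (inv_pos.2 hl), smul_eq_mul]
  have hwin : ∀ {h l : ℝ}, 0 < l → ∀ T,
      ∫ u in Icc (T - h) (T + h), fejer (l * (T - u)) = l⁻¹ * I (l * h) := by
    intro h l hl T
    have e1 : ∫ u in Icc (T - h) (T + h), fejer (l * (T - u)) =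
        ∫ u, indicator (Icc (-(l * h)) (l * h)) fejer (l * (T - u)) := by
      rw [← integral_indicator measurableSet_Icc]
      congr 1; ext u
      have : u ∈ Icc (T - h) (T + h) ↔ l * (T - u) ∈ Icc (-(l * h)) (l * h) := by
        rw [mem_Icc, mem_Icc]
        constructor
        · rintro ⟨h1, h2⟩
          constructor <;> nlinarith
        · rintro ⟨h1, h2⟩
          rw [← mul_neg] at h1
          have h1' := le_of_mul_le_mul_left h1 hl
          have h2' := le_of_mul_le_mul_left h2 hl
          constructor <;> linarith
      by_cases hu : u ∈ Icc (T - h) (T + h)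
      · rw [indicator_of_mem hu, indicator_of_mem (this.1 hu)]
      · rw [indicator_of_notMem hu, indicator_of_notMem (fun h' => hu (this.2 h'))]
    rw [e1, integral_sub_left_eq_self
        (fun u => indicator (Icc (-(l * h)) (l * h)) fejer (l * u)) volume T,
      Measure.integral_comp_mul_left, abs_of_pos (inv_pos.2 hl), smul_eq_mul,
      integral_indicator measurableSet_Icc]
  have hgint : ∀ {l : ℝ}, 0 < l → ∀ T, Integrable fun u => g u * fejer (l * (T - u)) := by
    intro l hl T
    refine ((integrable_fejer_scaled hl T).const_mul M).mono' (by fun_prop)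
      (Eventually.of_forall fun u => ?_)
    rw [norm_mul, Real.norm_of_nonneg (hg0 u), Real.norm_of_nonneg (fejer_nonneg _)]
    exact mul_le_mul_of_nonneg_right (hgM u) (fejer_nonneg _)
  have hA : ∀ {l : ℝ}, 0 < l → Tendsto (fun T : ℝ =>
      l * ∫ u in Ioi (0 : ℝ), g u * fejer (l * (T - u))) atTop (𝓝 c) := by
    intro l hl
    have h1 := tendsto_fejer_average (f := fun u => g u - 1) (M := M + 1) (by fun_prop)
      (fun u => abs_le.2 ⟨by linarith [hg0 u], by linarith [hgM u]⟩) hG hGc hl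
    have h2 : Tendsto (fun T : ℝ => ∫ u in Ioi (0 : ℝ), fejer (l * (T - u))) atTop
        (𝓝 (l⁻¹ * c)) := by
      have e : ∀ T, ∫ u in Ioi (0 : ℝ), fejer (l * (T - u)) = ∫ v in Iio T, fejer (l * v) := by
        intro T
        rw [← integral_indicator measurableSet_Ioi, ← integral_indicator measurableSet_Iio,
          ← integral_sub_left_eq_self (fun v => indicator (Iio T) (fun v => fejer (l * v)) v)
            volume T]
        congr 1; ext u
        by_cases hu : 0 < u
        · rw [indicator_of_mem (mem_Ioi.2 hu), indicator_of_mem (mem_Iio.2 (by linarith))]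
        · rw [indicator_of_notMem (by simpa using hu), indicator_of_notMem (by simpa using hu)]
      simp_rw [e]
      have hi : Integrable fun v => fejer (l * v) := integrable_fejer.comp_mul_left' hl.ne'
      have := (aecover_Iio (μ := volume) tendsto_id).integral_tendsto_of_countably_generated hi
      rwa [Measure.integral_comp_mul_left, abs_of_pos (inv_pos.2 hl), smul_eq_mul] at this
    have h3 := (h1.add h2).const_mul l
    rw [zero_add, mul_inv_cancel_left₀ hl.ne'] at h3
    refine h3.congr fun T => ?_
    rw [← integral_add]
    · congr 2; ext u; ring
    · have := (hgint hl T).sub (integrable_fejer_scaled hl T)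
      refine (this.congr (Eventually.of_forall fun u => ?_)).integrableOn
      simp only [Pi.sub_apply]; ring
    · exact (integrable_fejer_scaled hl T).integrableOn
  -- the two one-sided inequalities
  have hup : ∀ {h l : ℝ}, 0 < h → 0 < l → ∀ T, h < T →
      Real.exp (-(2 * h)) * g (T - h) * I (l * h) ≤
        l * ∫ u in Ioi (0 : ℝ), g u * fejer (l * (T - u)) := by
    intro h l hh hl T hT
    have e : Real.exp (-(2 * h)) * g (T - h) * I (l * h) =
        l * ∫ u in Icc (T - h) (T + h), (Real.exp (-(2 * h)) * g (T - h)) * fejer (l * (T - u)) := by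
      rw [integral_const_mul, hwin hl]
      field_simp
    rw [e]
    refine mul_le_mul_of_nonneg_left ?_ hl.le
    refine (setIntegral_mono_on (g := fun u => g u * fejer (l * (T - u)))
      ((integrable_fejer_scaled hl T).const_mul _).integrableOn (hgint hl T).integrableOn
      measurableSet_Icc fun u hu => ?_).trans ?_
    · refine mul_le_mul_of_nonneg_right ?_ (fejer_nonneg _)
      refine le_trans ?_ (hmono (T - h) u (by linarith) hu.1)
      rw [mul_comm]
      refine mul_le_mul_of_nonneg_left (Real.exp_le_exp.2 ?_) (hg0 _)
      linarith [hu.2]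
    · refine setIntegral_mono_set (hgint hl T).integrableOn
        (Eventually.of_forall fun u => mul_nonneg (hg0 u) (fejer_nonneg _))
        (LE.le.eventuallyLE fun u hu => ?_)
      exact mem_Ioi.2 (by linarith [hu.1])
  have hlow : ∀ {h l : ℝ}, 0 < h → 0 < l → ∀ T, h < T →
      l * ∫ u in Ioi (0 : ℝ), g u * fejer (l * (T - u)) ≤
        Real.exp (2 * h) * g (T + h) * I (l * h) + M * (c - I (l * h)) := by
    intro h l hh hl T hT
    have h0 : ∫ u in Ioi (0 : ℝ), g u * fejer (l * (T - u)) ≤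
        (∫ u in Icc (T - h) (T + h), g u * fejer (l * (T - u))) +
          ∫ u in (Icc (T - h) (T + h))ᶜ, g u * fejer (l * (T - u)) := by
      rw [integral_add_compl measurableSet_Icc (hgint hl T)]
      exact setIntegral_le_integral (hgint hl T)
        (Eventually.of_forall fun u => mul_nonneg (hg0 u) (fejer_nonneg _))
    have h1 : ∫ u in Icc (T - h) (T + h), g u * fejer (l * (T - u)) ≤
        Real.exp (2 * h) * g (T + h) * (l⁻¹ * I (l * h)) := by
      rw [← hwin hl T, ← integral_const_mul]
      refine setIntegral_mono_on (hgint hl T).integrableOn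
        ((integrable_fejer_scaled hl T).const_mul _).integrableOn
        measurableSet_Icc fun u hu => ?_
      refine mul_le_mul_of_nonneg_right ?_ (fejer_nonneg _)
      have h2 := hmono u (T + h) (by linarith [hu.1]) hu.2
      have h3 : Real.exp (-(2 * h)) ≤ Real.exp (-(T + h - u)) :=
        Real.exp_le_exp.2 (by linarith [hu.1])
      have h4 := (mul_le_mul_of_nonneg_left h3 (hg0 u)).trans h2
      rw [Real.exp_neg, ← div_eq_mul_inv, div_le_iff₀ (Real.exp_pos _)] at h4
      linarith
    have h2 : ∫ u in (Icc (T - h) (T + h))ᶜ, g u * fejer (l * (T - u)) ≤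
        M * (l⁻¹ * c - l⁻¹ * I (l * h)) := by
      rw [← hwin hl T, ← hscal hl T,
        ← integral_add_compl (s := Icc (T - h) (T + h)) measurableSet_Icc
          (integrable_fejer_scaled hl T), add_sub_cancel_left, ← integral_const_mul]
      refine setIntegral_mono_on (hgint hl T).integrableOn
        ((integrable_fejer_scaled hl T).const_mul _).integrableOn
        measurableSet_Icc.compl fun u _ => ?_
      exact mul_le_mul_of_nonneg_right (hgM u) (fejer_nonneg _)
    refine (mul_le_mul_of_nonneg_left (h0.trans (add_le_add h1 h2)) hl.le).trans (le_of_eq ?_)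
    field_simp
  have hIle : ∀ R, I R ≤ c := fun R =>
    setIntegral_le_integral integrable_fejer (Eventually.of_forall fejer_nonneg)
  have hexp : ∀ s : ℝ, Tendsto (fun R : ℝ => Real.exp (s * R⁻¹)) atTop (𝓝 1) := by
    intro s
    have := (Real.continuous_exp.tendsto (s * 0)).comp (tendsto_inv_atTop_zero.const_mul s)
    simpa [Function.comp_def] using this
  rw [tendsto_order]
  constructor
  · intro b hb
    have hlim : Tendsto (fun R : ℝ => Real.exp (-2 * R⁻¹) * (c - M * (c - I R)) / c) atTop
        (𝓝 1) := by
      have := (((hexp (-2)).mul ((((hIlim.const_sub c).const_mul M).const_sub c))).div_const c)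
      simpa [hc0.ne'] using this
    obtain ⟨R, hbR, hR⟩ := ((hlim.eventually (lt_mem_nhds hb)).and (eventually_gt_atTop 0)).exists
    have hRR : R ^ 2 * R⁻¹ = R := by field_simp
    have hcc : max b 0 * Real.exp (2 * R⁻¹) * c + M * (c - I R) < c ∨ b < 0 := by
      rcases lt_or_ge b 0 with h | h
      · exact Or.inr h
      left
      rw [max_eq_left h]
      rw [lt_div_iff₀ hc0, neg_mul, Real.exp_neg] at hbR
      rw [inv_mul_eq_div, lt_div_iff₀ (Real.exp_pos _)] at hbR
      linarith
    rcases hcc with hcc | hb0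
    · have hev := (hA (l := R ^ 2) (by positivity)).eventually (lt_mem_nhds hcc)
      have hev' := (tendsto_atTop_add_const_right atTop (-R⁻¹) tendsto_id).eventually
        (hev.and (eventually_gt_atTop (R⁻¹)))
      filter_upwards [hev'] with T hT
      obtain ⟨hT1, hT2⟩ := hT
      have h5 := hT1.trans_le (hlow (h := R⁻¹) (l := R ^ 2) (by positivity) (by positivity) _ hT2)
      rw [hRR] at h5
      simp only [id, neg_add_cancel_right] at h5
      have h6 := mul_le_mul_of_nonneg_left (hIle R)
        (mul_nonneg (Real.exp_pos (2 * R⁻¹)).le (hg0 T))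
      have h7 : max b 0 * (Real.exp (2 * R⁻¹) * c) < g T * (Real.exp (2 * R⁻¹) * c) := by linarith
      exact (le_max_left _ _).trans_lt (lt_of_mul_lt_mul_right h7 (by positivity))
    · exact Eventually.of_forall fun u => hb0.trans_le (hg0 u)
  · intro a ha
    have hlim : Tendsto (fun R : ℝ => a * (Real.exp (-2 * R⁻¹) * I R)) atTop (𝓝 (a * c)) := by
      have := ((hexp (-2)).mul hIlim).const_mul a
      simpa using this
    obtain ⟨R, ⟨haR, hIR⟩, hR⟩ := (((hlim.eventually
      (lt_mem_nhds (by nlinarith : c < a * c))).and (hIlim.eventually (lt_mem_nhds hc0))).and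
      (eventually_gt_atTop 0)).exists
    have hRR : R ^ 2 * R⁻¹ = R := by field_simp
    have hev := (hA (l := R ^ 2) (by positivity)).eventually (gt_mem_nhds haR)
    have hev' := (tendsto_atTop_add_const_right atTop (R⁻¹) tendsto_id).eventually
        (hev.and (eventually_gt_atTop (R⁻¹)))
    filter_upwards [hev'] with T hT
    obtain ⟨hT1, hT2⟩ := hT
    have h5 := (hup (h := R⁻¹) (l := R ^ 2) (by positivity) (by positivity) _ hT2).trans_lt hT1
    rw [hRR] at h5
    simp only [id, add_sub_cancel_right, ← neg_mul] at h5
    have h7 : g T * (Real.exp (-2 * R⁻¹) * I R) < a * (Real.exp (-2 * R⁻¹) * I R) := by linarith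
    exact lt_of_mul_lt_mul_right h7 (by positivity)

end Limit
end Tauberian

namespace PrimeDensity
open MeasureTheory Set Topology Asymptotics Complex

lemma exists_tendsto_logDeriv {Z : ℂ → ℂ} {z : ℂ} (hZ : AnalyticAt ℂ Z z)
    (hne : analyticOrderAt Z z ≠ ⊤) :
    ∃ m : ℕ, (m = 0 → Z z ≠ 0) ∧
      Tendsto (fun σ : ℝ => (σ : ℂ) * (deriv Z (z + σ) / Z (z + σ))) (𝓝[>] 0) (𝓝 (m : ℂ)) ∧
      ∀ᶠ σ : ℝ in 𝓝[>] 0, Z (z + σ) ≠ 0 := by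
  obtain ⟨g, hg, hg0, hgZ⟩ := hZ.analyticOrderAt_ne_top.1 hne
  set m := analyticOrderNatAt Z z
  have hline : Tendsto (fun σ : ℝ => z + (σ : ℂ)) (𝓝[>] 0) (𝓝 z) := by
    have : Continuous fun σ : ℝ => z + (σ : ℂ) := by fun_prop
    simpa using (this.tendsto 0).mono_left (nhdsWithin_le_nhds (s := Ioi 0))
  have hgne : ∀ᶠ w in 𝓝 z, g w ≠ 0 := hg.continuousAt.eventually_ne hg0
  refine ⟨m, fun hm => ?_, ?_, ?_⟩
  · have := hgZ.self_of_nhds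
    rw [hm] at this
    simpa [this] using hg0
  · have hlim : Tendsto (fun w => (m : ℂ) + (w - z) * (deriv g w / g w)) (𝓝 z) (𝓝 m) := by
      have h1 : ContinuousAt (fun w => (m : ℂ) + (w - z) * (deriv g w / g w)) z :=
        continuousAt_const.add ((continuousAt_id.sub continuousAt_const).mul
          (hg.deriv.continuousAt.div hg.continuousAt hg0))
      simpa using h1.tendsto
    refine (hlim.comp hline).congr' ?_
    filter_upwards [hline.eventually ((eventually_eventually_nhds.2 hgZ).and (hgne.and hg.eventually_analyticAt)),
      self_mem_nhdsWithin] with σ hσ hσ0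
    obtain ⟨h1, h2, h3⟩ := hσ
    have hσ0' : (σ : ℂ) ≠ 0 := by exact_mod_cast (ne_of_gt hσ0)
    rw [EventuallyEq.deriv_eq h1, h1.self_of_nhds]
    have hd : HasDerivAt (fun w => (w - z) ^ m • g w)
        ((m * (z + σ - z) ^ (m - 1) * 1) * g (z + σ) + (z + σ - z) ^ m * deriv g (z + σ))
        (z + σ) := by
      exact (((hasDerivAt_id _).sub_const z).pow m).mul h3.differentiableAt.hasDerivAt
    rw [hd.deriv]
    simp only [Function.comp, add_sub_cancel_left, smul_eq_mul]
    rcases Nat.eq_zero_or_pos m with hm | hm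
    · rw [hm]; simp
    · obtain ⟨k, hk⟩ := Nat.exists_eq_succ_of_ne_zero hm.ne'
      rw [hk]
      simp only [Nat.succ_eq_add_one, Nat.add_sub_cancel]
      field_simp
      ring
  · filter_upwards [hline.eventually (hgZ.and hgne), self_mem_nhdsWithin] with σ hσ hσ0
    have hσ0' : (σ : ℂ) ≠ 0 := by exact_mod_cast (ne_of_gt hσ0)
    rw [hσ.1, add_sub_cancel_left]
    exact smul_ne_zero (pow_ne_zero _ hσ0') hσ.2

lemma mertens_ineq {b : ℕ → ℝ} (hb : ∀ n, 0 ≤ b n)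
    (hS : ∀ s : ℂ, 1 < s.re → LSeriesSummable (fun n => (b n : ℂ)) s) {σ : ℝ} (hσ : 1 < σ) (t : ℝ) :
    0 ≤ 3 * (LSeries (fun n => (b n : ℂ)) σ).re + 4 * (LSeries (fun n => (b n : ℂ)) (σ + t * I)).re
      + (LSeries (fun n => (b n : ℂ)) (σ + 2 * t * I)).re := by
  have h0 := (hS σ (by simpa)).hasSum
  have h1 := (hS (σ + t * I) (by simpa)).hasSum
  have h2 := (hS (σ + 2 * t * I) (by simpa)).hasSum
  have := (((Complex.hasSum_re h0).mul_left 3).add ((Complex.hasSum_re h1).mul_left 4)).add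
    (Complex.hasSum_re h2)
  refine this.nonneg fun n => ?_
  rcases eq_or_ne n 0 with rfl | hn
  · simp
  have hn0 : (n : ℂ) ≠ 0 := by exact_mod_cast hn
  have hn' : (0 : ℝ) < n := by exact_mod_cast Nat.pos_of_ne_zero hn
  rw [LSeries.term_of_ne_zero hn, LSeries.term_of_ne_zero hn, LSeries.term_of_ne_zero hn]
  set A : ℝ := (n : ℝ) ^ σ
  have hA : (n : ℂ) ^ (σ : ℂ) = (A : ℂ) := by
    rw [Complex.ofReal_cpow hn'.le, Complex.ofReal_natCast]
  have hA0 : 0 < A := Real.rpow_pos_of_pos hn' _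
  set w : ℂ := (n : ℂ) ^ (t * I)
  have hw : ‖w‖ = 1 := by
    rw [Complex.norm_natCast_cpow_of_pos (Nat.pos_of_ne_zero hn)]
    simp
  have e1 : (n : ℂ) ^ (σ + t * I) = A * w := by rw [Complex.cpow_add _ _ hn0, hA]
  have e2 : (n : ℂ) ^ (σ + 2 * t * I) = A * (w * w) := by
    rw [Complex.cpow_add _ _ hn0, hA, ← Complex.cpow_add _ _ hn0]
    congr 2
    ring
  have hwi : w⁻¹ = (starRingEnd ℂ) w := Complex.inv_eq_conj hw
  have f1 : (b n : ℂ) / (A * w) = ((b n / A : ℝ) : ℂ) * (starRingEnd ℂ) w := by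
    rw [← hwi]; push_cast; rw [div_mul_eq_div_div, div_eq_mul_inv _ w]
  have f2 : (b n : ℂ) / (A * (w * w)) =
      ((b n / A : ℝ) : ℂ) * ((starRingEnd ℂ) w * (starRingEnd ℂ) w) := by
    rw [← hwi, ← mul_inv]; push_cast; rw [div_mul_eq_div_div, div_eq_mul_inv _ (w * w)]
  have f0 : (b n : ℂ) / A = ((b n / A : ℝ) : ℂ) := by push_cast; rfl
  rw [hA, e1, e2, f0, f1, f2, Complex.re_ofReal_mul, Complex.re_ofReal_mul, Complex.ofReal_re,
    Complex.mul_re, Complex.conj_re, Complex.conj_im]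
  have hn1 : w.re * w.re + w.im * w.im = 1 := by
    have := Complex.normSq_apply w
    rw [Complex.normSq_eq_norm_sq, hw] at this
    linarith
  have hbA : 0 ≤ b n / A := div_nonneg (hb n) hA0.le
  have : 3 * (b n / A) + 4 * (b n / A * w.re) + b n / A * (w.re * w.re - -w.im * -w.im) =
      b n / A * (2 * (1 + w.re) ^ 2) := by
    linear_combination (-(b n / A)) * hn1
  rw [this]
  positivity

section Dirichlet

variable {a b : ℕ → ℝ} {ρ δ C : ℝ}

/-- The remainder of the partial sums of `a`, cut off to `(1, ∞)`. -/
noncomputable def sumRemainder (a : ℕ → ℝ) (ρ : ℝ) : ℝ → ℂ :=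
  indicator (Ioi 1) fun t => (∑ k ∈ Finset.Icc 1 ⌊t⌋₊, (a k : ℂ)) - ρ * t

/-- The analytic continuation of `(s - 1) * LSeries a s`. -/
noncomputable def polefree (a : ℕ → ℝ) (ρ : ℝ) (s : ℂ) : ℂ :=
  ρ * s + (s - 1) * s * mellin (sumRemainder a ρ) (-s)

lemma norm_sumRemainder_le (hρ : 0 ≤ ρ) (hδ1 : δ ≤ 1) (hC : 0 ≤ C)
    (hA : ∀ n : ℕ, |∑ k ∈ Finset.Icc 1 n, a k - ρ * n| ≤ C * (n : ℝ) ^ (1 - δ)) {t : ℝ}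
    (ht : 0 < t) : ‖sumRemainder a ρ t‖ ≤ (C + ρ) * t ^ (1 - δ) := by
  by_cases h1 : 1 < t
  · rw [sumRemainder, indicator_of_mem (mem_Ioi.2 h1)]
    have e : ((∑ k ∈ Finset.Icc 1 ⌊t⌋₊, (a k : ℂ)) - ρ * t) =
      (((∑ k ∈ Finset.Icc 1 ⌊t⌋₊, a k) - ρ * t : ℝ) : ℂ) := by push_cast; rfl
    rw [e, Complex.norm_real, Real.norm_eq_abs]
    have h2 := hA ⌊t⌋₊
    have h3 : (⌊t⌋₊ : ℝ) ≤ t := Nat.floor_le ht.le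
    have h4 : t < ⌊t⌋₊ + 1 := Nat.lt_floor_add_one t
    have h5 : ((⌊t⌋₊ : ℝ)) ^ (1 - δ) ≤ t ^ (1 - δ) :=
      Real.rpow_le_rpow (by positivity) h3 (by linarith)
    have h6 : 1 ≤ t ^ (1 - δ) := Real.one_le_rpow h1.le (by linarith)
    have h7 := mul_le_mul_of_nonneg_left h5 hC
    have h8 := mul_le_mul_of_nonneg_left h6 hρ
    rw [abs_le] at h2 ⊢
    constructor <;> nlinarith
  · rw [sumRemainder, indicator_of_notMem (by simpa using h1), norm_zero]
    positivity

lemma measurable_sumRemainder (a : ℕ → ℝ) (ρ : ℝ) : Measurable (sumRemainder a ρ) := by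
  refine Measurable.indicator ?_ measurableSet_Ioi
  refine Measurable.sub ?_ (by fun_prop)
  exact (measurable_from_top (f := fun n : ℕ => ∑ k ∈ Finset.Icc 1 n, (a k : ℂ))).comp
    Nat.measurable_floor

lemma sumRemainder_facts (hρ : 0 ≤ ρ) (hδ1 : δ ≤ 1) (hC : 0 ≤ C)
    (hA : ∀ n : ℕ, |∑ k ∈ Finset.Icc 1 n, a k - ρ * n| ≤ C * (n : ℝ) ^ (1 - δ)) :
    LocallyIntegrableOn (sumRemainder a ρ) (Ioi 0) ∧
      (sumRemainder a ρ =O[atTop] fun t : ℝ => t ^ (-(δ - 1))) ∧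
      ∀ c : ℝ, sumRemainder a ρ =O[𝓝[>] 0] fun t : ℝ => t ^ (-c) := by
  refine ⟨?_, ?_, fun c => ?_⟩
  · have hc : ContinuousOn (fun t : ℝ => (C + ρ) * t ^ (1 - δ)) (Ioi 0) :=
      continuousOn_const.mul (continuousOn_id.rpow_const fun t ht => Or.inl (ne_of_gt ht))
    refine (hc.locallyIntegrableOn measurableSet_Ioi).mono
      (measurable_sumRemainder a ρ).aestronglyMeasurable (Eventually.of_forall fun t => ?_)
    rcases lt_or_ge 0 t with ht | ht
    · exact (norm_sumRemainder_le hρ hδ1 hC hA ht).trans (Real.le_norm_self _)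
    · rw [sumRemainder, indicator_of_notMem (by simpa using ht.trans zero_le_one), norm_zero]
      positivity
  · refine IsBigO.of_bound (C + ρ) ?_
    filter_upwards [eventually_gt_atTop 0] with t ht
    rw [neg_sub, Real.norm_of_nonneg (by positivity : (0 : ℝ) ≤ t ^ (1 - δ))]
    exact norm_sumRemainder_le hρ hδ1 hC hA ht
  · refine IsBigO.of_bound 0 ?_
    filter_upwards [Ioo_mem_nhdsGT zero_lt_one] with t ht
    rw [sumRemainder, indicator_of_notMem (by simpa using ht.2.le)]
    simp

lemma differentiableAt_polefree (hρ : 0 ≤ ρ) (hδ1 : δ ≤ 1) (hC : 0 ≤ C)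
    (hA : ∀ n : ℕ, |∑ k ∈ Finset.Icc 1 n, a k - ρ * n| ≤ C * (n : ℝ) ^ (1 - δ)) {s : ℂ}
    (hs : 1 - δ < s.re) : DifferentiableAt ℂ (polefree a ρ) s := by
  obtain ⟨h1, h2, h3⟩ := sumRemainder_facts hρ hδ1 hC hA
  have := mellin_differentiableAt_of_isBigO_rpow (s := -s) h1 h2
    (by simp; linarith) (h3 (-s.re - 1)) (by simp)
  have h4 : DifferentiableAt ℂ (fun s => mellin (sumRemainder a ρ) (-s)) s :=
    this.comp s differentiableAt_id.neg
  unfold polefree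
  fun_prop

lemma polefree_one : polefree a ρ 1 = ρ := by simp [polefree]

lemma isBigO_sum (hA : ∀ n : ℕ, ∑ k ∈ Finset.Icc 1 n, a k ≤ C * n) (ha : ∀ n, 0 ≤ a n) :
    (fun n : ℕ => ∑ k ∈ Finset.Icc 1 n, a k) =O[atTop] fun n => (n : ℝ) ^ (1 : ℝ) := by
  refine IsBigO.of_bound C (Eventually.of_forall fun n => ?_)
  rw [Real.rpow_one, Real.norm_of_nonneg (Finset.sum_nonneg fun i _ => ha i), Real.norm_natCast]
  exact hA n

lemma polefree_eq (ha : ∀ n, 0 ≤ a n) (hρ : 0 ≤ ρ) (hδ : 0 < δ) (hδ1 : δ ≤ 1) (hC : 0 ≤ C)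
    (hA : ∀ n : ℕ, |∑ k ∈ Finset.Icc 1 n, a k - ρ * n| ≤ C * (n : ℝ) ^ (1 - δ))
    (hA' : ∀ n : ℕ, ∑ k ∈ Finset.Icc 1 n, a k ≤ (C + ρ) * n) {s : ℂ}
    (hs : 1 < s.re) : polefree a ρ s = (s - 1) * LSeries (fun n => (a n : ℂ)) s := by
  have hs1 : s - 1 ≠ 0 := by
    intro h
    have : s = 1 := sub_eq_zero.1 h
    simp [this] at hs
  obtain ⟨h1, h2, h3⟩ := sumRemainder_facts hρ hδ1 hC hA
  have hconv := mellinConvergent_of_isBigO_rpow (s := -s) h1 h2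
    (by simp; linarith) (h3 (-s.re - 1)) (by simp)
  have hcp := integral_Ioi_cpow_of_lt (a := -s) (by simpa using hs) zero_lt_one
  have hcpi := integrableOn_Ioi_cpow_of_lt (a := -s) (by simpa using hs) zero_lt_one
  rw [LSeries_eq_mul_integral_of_nonneg a zero_le_one hs (isBigO_sum hA' ha) ha]
  have key : ∫ t in Ioi (1 : ℝ), (∑ k ∈ Finset.Icc 1 ⌊t⌋₊, (a k : ℂ)) * t ^ (-(s + 1)) =
      mellin (sumRemainder a ρ) (-s) + ρ * (1 / (s - 1)) := by
    have e1 : mellin (sumRemainder a ρ) (-s) =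
        ∫ t in Ioi (1 : ℝ), (t : ℂ) ^ (-s - 1) • sumRemainder a ρ t := by
      rw [mellin, ← integral_indicator measurableSet_Ioi, ← integral_indicator measurableSet_Ioi]
      congr 1
      ext t
      by_cases ht : t ∈ Ioi (1 : ℝ)
      · rw [indicator_of_mem ht, indicator_of_mem (mem_Ioi.2 (zero_lt_one.trans ht))]
      · rw [indicator_of_notMem ht]
        by_cases ht0 : t ∈ Ioi (0 : ℝ)
        · rw [indicator_of_mem ht0, sumRemainder, indicator_of_notMem ht, smul_zero]
        · rw [indicator_of_notMem ht0]
    have e2 : (ρ : ℂ) * (1 / (s - 1)) = ∫ t in Ioi (1 : ℝ), ρ * (t : ℂ) ^ (-s) := by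
      rw [integral_const_mul, hcp]
      rw [show -s + 1 = -(s - 1) by ring, Complex.ofReal_one, Complex.one_cpow, neg_div_neg_eq]
    rw [e1, e2, ← integral_add]
    · refine setIntegral_congr_fun measurableSet_Ioi fun t ht => ?_
      have ht0 : (t : ℂ) ≠ 0 := by exact_mod_cast (zero_lt_one.trans ht).ne'
      have e3 : (t : ℂ) ^ (-s) = t ^ (-(s + 1)) * t := by
        
        rw [show -s = -(s + 1) + 1 by ring, Complex.cpow_add _ _ ht0, Complex.cpow_one]
      simp only [sumRemainder, indicator_of_mem ht, smul_eq_mul, e3]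
      rw [show -s - 1 = -(s + 1) by ring]
      ring
    · exact hconv.mono_set (Ioi_subset_Ioi zero_le_one)
    · exact hcpi.const_mul _
  rw [key, polefree]
  field_simp
  ring

lemma abscissa_le_one (hA' : ∀ n : ℕ, ∑ k ∈ Finset.Icc 1 n, a k ≤ C * n) (ha : ∀ n, 0 ≤ a n) :
    LSeries.abscissaOfAbsConv (fun n => (a n : ℂ)) ≤ 1 := by
  refine LSeries.abscissaOfAbsConv_le_of_forall_lt_LSeriesSummable (x := 1) fun y hy => ?_
  exact LSeriesSummable_of_sum_norm_bigO_and_nonneg (isBigO_sum hA' ha) ha zero_le_one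
    (by simpa using hy)

lemma log_deriv_identity (ha : ∀ n, 0 ≤ a n) (hb : ∀ n, 0 ≤ b n) {C' : ℝ}
    (hab : ∀ n : ℕ, ∑ p ∈ n.divisorsAntidiagonal, b p.1 * a p.2 = a n * Real.log n)
    (hB : ∀ n : ℕ, ∑ k ∈ Finset.Icc 1 n, b k ≤ C' * n)
    (hρ : 0 ≤ ρ) (hδ : 0 < δ) (hδ1 : δ ≤ 1) (hC : 0 ≤ C)
    (hA : ∀ n : ℕ, |∑ k ∈ Finset.Icc 1 n, a k - ρ * n| ≤ C * (n : ℝ) ^ (1 - δ))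
    (hA' : ∀ n : ℕ, ∑ k ∈ Finset.Icc 1 n, a k ≤ (C + ρ) * n) {s : ℂ} (hs : 1 < s.re) :
    LSeries (fun n => (b n : ℂ)) s * polefree a ρ s * (s - 1) =
      polefree a ρ s - (s - 1) * deriv (polefree a ρ) s := by
  have h1a : LSeries.abscissaOfAbsConv (fun n => (a n : ℂ)) < s.re :=
    (abscissa_le_one hA' ha).trans_lt (by exact_mod_cast hs)
  have h1b : LSeries.abscissaOfAbsConv (fun n => (b n : ℂ)) < s.re :=
    (abscissa_le_one hB hb).trans_lt (by exact_mod_cast hs)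
  have hev : polefree a ρ =ᶠ[𝓝 s] fun s => (s - 1) * LSeries (fun n => (a n : ℂ)) s := by
    filter_upwards [(isOpen_lt continuous_const Complex.continuous_re).mem_nhds hs] with w hw
    exact polefree_eq ha hρ hδ hδ1 hC hA hA' hw
  have hd : HasDerivAt (fun s => (s - 1) * LSeries (fun n => (a n : ℂ)) s)
      (1 * LSeries (fun n => (a n : ℂ)) s +
        (s - 1) * -LSeries (LSeries.logMul fun n => (a n : ℂ)) s) s :=
    ((hasDerivAt_id s).sub_const 1).mul (LSeries_hasDerivAt h1a)
  have hconv : LSeries (LSeries.logMul fun n => (a n : ℂ)) s =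
      LSeries (fun n => (b n : ℂ)) s * LSeries (fun n => (a n : ℂ)) s := by
    rw [← LSeries_convolution h1b h1a]
    refine LSeries_congr (fun {n} _ => ?_) s
    rw [LSeries.convolution_def, LSeries.logMul]
    have := congrArg (fun x : ℝ => (x : ℂ)) (hab n)
    push_cast at this
    exact (mul_comm _ _).trans (this.symm)
  rw [hev.deriv_eq, hd.deriv, hconv, hev.self_of_nhds]
  ring

lemma polefree_ne_zero (ha : ∀ n, 0 ≤ a n) (hb : ∀ n, 0 ≤ b n) {C' : ℝ}
    (hab : ∀ n : ℕ, ∑ p ∈ n.divisorsAntidiagonal, b p.1 * a p.2 = a n * Real.log n)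
    (hB : ∀ n : ℕ, ∑ k ∈ Finset.Icc 1 n, b k ≤ C' * n)
    (hρ : 0 < ρ) (hδ : 0 < δ) (hδ1 : δ ≤ 1) (hC : 0 ≤ C)
    (hA : ∀ n : ℕ, |∑ k ∈ Finset.Icc 1 n, a k - ρ * n| ≤ C * (n : ℝ) ^ (1 - δ))
    (hA' : ∀ n : ℕ, ∑ k ∈ Finset.Icc 1 n, a k ≤ (C + ρ) * n) {z : ℂ} (hz : 1 ≤ z.re) :
    polefree a ρ z ≠ 0 := by
  set F := LSeries (fun n => (b n : ℂ)) with hF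
  set U : Set ℂ := {s | 1 - δ < s.re} with hU
  have hUo : IsOpen U := isOpen_lt continuous_const Complex.continuous_re
  have hUc : IsPreconnected U := (convex_halfSpace_re_gt (1 - δ)).isPreconnected
  have hdiff : DifferentiableOn ℂ (polefree a ρ) U := fun s hs =>
    (differentiableAt_polefree hρ.le hδ1 hC hA hs).differentiableWithinAt
  have hanal : AnalyticOnNhd ℂ (polefree a ρ) U := hdiff.analyticOnNhd hUo
  have h1U : (1 : ℂ) ∈ U := by simp [hU, hδ]
  have hord1 : analyticOrderAt (polefree a ρ) 1 ≠ ⊤ := by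
    rw [analyticOrderAt_eq_zero.2 (Or.inr _)]
    · simp
    · rw [polefree_one]; exact_mod_cast hρ.ne'
  have hUz : ∀ z : ℂ, 1 ≤ z.re → z ∈ U := fun z hz => by
    change 1 - δ < z.re; linarith
  have main : ∀ z : ℂ, 1 ≤ z.re → ∃ m : ℕ, (m = 0 → polefree a ρ z ≠ 0) ∧
      Tendsto (fun σ : ℝ => (σ : ℂ) * F (z + σ)) (𝓝[>] 0)
        (𝓝 ((if z = 1 then 1 else 0) - m)) := by
    intro z hz
    obtain ⟨m, hm0, hm, hne⟩ := exists_tendsto_logDeriv (hanal z (hUz z hz))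
      (AnalyticOnNhd.analyticOrderAt_ne_top_of_isPreconnected hanal hUc h1U (hUz z hz) hord1)
    refine ⟨m, hm0, ?_⟩
    have hpole : Tendsto (fun σ : ℝ => (σ : ℂ) * (1 / (z + σ - 1))) (𝓝[>] 0)
        (𝓝 (if z = 1 then 1 else 0)) := by
      by_cases hz1 : z = 1
      · rw [if_pos hz1, hz1]
        refine tendsto_const_nhds.congr' ?_
        filter_upwards [self_mem_nhdsWithin] with σ hσ
        have hσ0' : (σ : ℂ) ≠ 0 := by exact_mod_cast (ne_of_gt hσ)
        rw [add_sub_cancel_left, mul_one_div_cancel hσ0']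
      · rw [if_neg hz1]
        have hz1' : z + ((0 : ℝ) : ℂ) - 1 ≠ 0 := by
          rw [Complex.ofReal_zero, add_zero]; exact sub_ne_zero.2 hz1
        have : ContinuousAt (fun σ : ℝ => (σ : ℂ) * (1 / (z + σ - 1))) 0 := by
          refine Complex.continuous_ofReal.continuousAt.mul
            (continuousAt_const.div (by fun_prop) hz1')
        simpa using this.tendsto.mono_left (nhdsWithin_le_nhds (s := Ioi 0))
    refine (hpole.sub hm).congr' ?_
    filter_upwards [self_mem_nhdsWithin, hne] with σ hσ hσZ
    have hre : 1 < (z + σ).re := by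
      have : (0 : ℝ) < σ := hσ
      simp; linarith
    have hid := log_deriv_identity ha hb hab hB hρ.le hδ hδ1 hC hA hA' hre
    have hs1 : z + σ - 1 ≠ 0 := by
      intro h
      rw [sub_eq_zero.1 h] at hre
      simp at hre
    rw [← mul_sub]
    congr 1
    rw [div_sub_div _ _ hs1 hσZ, div_eq_iff (mul_ne_zero hs1 hσZ), one_mul, ← hid]
    ring
  by_cases hz1 : z = 1
  · rw [hz1, polefree_one]; exact_mod_cast hρ.ne'
  obtain ⟨m, hm0, hm⟩ := main z hz
  refine hm0 ?_
  rw [if_neg hz1] at hm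
  rcases hz.lt_or_eq with hz2 | hz2
  · rw [zero_sub] at hm
    have hcont : ContinuousAt F z := by
      refine ((LSeries_differentiableOn _).differentiableAt
        ((isOpen_lt ?_ ?_).mem_nhds ?_)).continuousAt
      · exact continuous_const
      · exact continuous_coe_real_ereal.comp Complex.continuous_re
      · exact (abscissa_le_one hB hb).trans_lt (by exact_mod_cast hz2)
    have h2 : Tendsto (fun σ : ℝ => (σ : ℂ) * F (z + σ)) (𝓝[>] 0) (𝓝 (0 * F z)) := by
      have hl : Tendsto (fun σ : ℝ => (σ : ℂ)) (𝓝[>] 0) (𝓝 0) := by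
        simpa using (Complex.continuous_ofReal.tendsto 0).mono_left
          (nhdsWithin_le_nhds (s := Ioi 0))
      refine hl.mul (hcont.tendsto.comp ?_)
      simpa using hl.const_add z
    have := tendsto_nhds_unique hm h2
    simpa using this
  · obtain ⟨t, rfl⟩ : ∃ t : ℝ, z = 1 + t * I := ⟨z.im, by
      apply Complex.ext <;> simp [← hz2]⟩
    have ht : t ≠ 0 := by rintro rfl; simp at hz1
    have hne : ∀ t : ℝ, t ≠ 0 → (1 : ℂ) + t * I ≠ 1 := by
      intro t ht h
      have := congrArg Complex.im h
      simp at this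
      exact ht this
    obtain ⟨m₁, -, hm₁⟩ := main (1 + (2 * t : ℝ) * I) (by simp)
    obtain ⟨m₂, -, hm₂⟩ := main 1 (by simp)
    rw [if_neg (hne _ (by simpa using ht))] at hm₁
    rw [if_pos rfl] at hm₂
    have hre := fun {f : ℝ → ℂ} {l : ℂ} (h : Tendsto f (𝓝[>] 0) (𝓝 l)) =>
      (Complex.continuous_re.tendsto l).comp h
    have hlim := (((hre hm₂).const_mul 3).add ((hre hm).const_mul 4)).add (hre hm₁)
    have hnn := ge_of_tendsto hlim (b := 0) (by
      filter_upwards [self_mem_nhdsWithin] with σ hσ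
      have hσ0 : (0 : ℝ) < σ := hσ
      have hS : ∀ s : ℂ, 1 < s.re → LSeriesSummable (fun n => (b n : ℂ)) s := fun s hs =>
        LSeriesSummable_of_abscissaOfAbsConv_lt_re
          ((abscissa_le_one hB hb).trans_lt (by exact_mod_cast hs))
      have := mul_nonneg hσ0.le (mertens_ineq hb hS (σ := 1 + σ) (by linarith) t)
      simp only [Function.comp, Complex.re_ofReal_mul]
      have e1 : (1 : ℂ) + σ = ((1 + σ : ℝ) : ℂ) := by push_cast; rfl
      have e2 : (1 : ℂ) + t * I + σ = ((1 + σ : ℝ) : ℂ) + t * I := by push_cast; ring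
      have e3 : (1 : ℂ) + (2 * t : ℝ) * I + σ = ((1 + σ : ℝ) : ℂ) + 2 * t * I := by
        push_cast; ring
      rw [e1, e2, e3]
      linarith)
    simp at hnn
    have h4 : (4 : ℝ) * m ≤ 3 := by
      have h5 : (0 : ℝ) ≤ m₁ := by positivity
      have h6 : (0 : ℝ) ≤ m₂ := by positivity
      linarith
    have h4' : 4 * m ≤ 3 := by exact_mod_cast h4
    omega

lemma sum_floor_measurable (b : ℕ → ℝ) :
    Measurable fun t : ℝ => ∑ k ∈ Finset.Icc 1 ⌊t⌋₊, b k :=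
  (measurable_from_top (f := fun n : ℕ => ∑ k ∈ Finset.Icc 1 n, b k)).comp Nat.measurable_floor

/-- If `b` is the von Mangoldt function of a nonnegative sequence `a` whose partial sums are
`ρ n` up to a power-saving error, then the partial sums of `b` are asymptotic to `x`. -/
theorem tendsto_sum_div (ha : ∀ n, 0 ≤ a n) (hb : ∀ n, 0 ≤ b n) {C' : ℝ}
    (hab : ∀ n : ℕ, ∑ p ∈ n.divisorsAntidiagonal, b p.1 * a p.2 = a n * Real.log n)
    (hB : ∀ n : ℕ, ∑ k ∈ Finset.Icc 1 n, b k ≤ C' * n)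
    (hρ : 0 < ρ) (hδ : 0 < δ) (hδ1 : δ ≤ 1) (hC : 0 ≤ C)
    (hA : ∀ n : ℕ, |∑ k ∈ Finset.Icc 1 n, a k - ρ * n| ≤ C * (n : ℝ) ^ (1 - δ)) :
    Tendsto (fun x : ℝ => (∑ k ∈ Finset.Icc 1 ⌊x⌋₊, b k) / x) atTop (𝓝 1) := by
  have hA' : ∀ n : ℕ, ∑ k ∈ Finset.Icc 1 n, a k ≤ (C + ρ) * n := by
    intro n
    rcases Nat.eq_zero_or_pos n with rfl | hn
    · simp
    have h1 : (1 : ℝ) ≤ n := by exact_mod_cast hn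
    have h2 : (n : ℝ) ^ (1 - δ) ≤ n := by
      simpa using Real.rpow_le_rpow_of_exponent_le h1 (by linarith : 1 - δ ≤ 1)
    have h3 := (abs_le.1 (hA n)).2
    nlinarith
  set F := LSeries (fun n => (b n : ℂ)) with hF
  set Z := polefree a ρ with hZ
  have hZne : ∀ z : ℂ, 1 ≤ z.re → Z z ≠ 0 := fun z hz =>
    polefree_ne_zero ha hb hab hB hρ hδ hδ1 hC hA hA' hz
  have hZd : DifferentiableOn ℂ Z {s | 1 - δ < s.re} := fun s hs =>
    (differentiableAt_polefree hρ.le hδ1 hC hA hs).differentiableWithinAt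
  have hZd' : DifferentiableOn ℂ (deriv Z) {s | 1 - δ < s.re} :=
    hZd.deriv (isOpen_lt continuous_const Complex.continuous_re)
  have hC'0 : 0 ≤ C' := by
    have := hB 1
    simp at this
    exact (hb 1).trans this
  set B : ℝ → ℝ := fun t => ∑ k ∈ Finset.Icc 1 ⌊t⌋₊, b k with hBdef
  have hB0 : ∀ t, 0 ≤ B t := fun t => Finset.sum_nonneg fun k _ => hb k
  have hBmono : Monotone B := fun s t hst =>
    Finset.sum_le_sum_of_subset_of_nonneg (Finset.Icc_subset_Icc_right (Nat.floor_mono hst))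
      fun k _ _ => hb k
  have hBle : ∀ t, 0 < t → B t ≤ C' * t := fun t ht =>
    (hB _).trans (mul_le_mul_of_nonneg_left (Nat.floor_le ht.le) hC'0)
  have hgM : ∀ u, B (Real.exp u) * Real.exp (-u) ≤ C' := fun u => by
    have := mul_le_mul_of_nonneg_right (hBle _ (Real.exp_pos u)) (Real.exp_pos (-u)).le
    rwa [mul_assoc, ← Real.exp_add, add_neg_cancel, Real.exp_zero, mul_one] at this
  have hlim : Tendsto (fun u => B (Real.exp u) * Real.exp (-u)) atTop (𝓝 1) := by
    have hgm : Measurable fun u => B (Real.exp u) * Real.exp (-u) :=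
      ((sum_floor_measurable b).comp Real.measurable_exp).mul (by fun_prop)
    refine Tauberian.tendsto_one_of_laplace (M := C')
      (G := fun z => -(deriv Z (1 + z) / Z (1 + z)) / (1 + z) - 1 / (1 + z)) hgm
      (fun u => mul_nonneg (hB0 _) (Real.exp_pos _).le) hgM ?_ ?_ ?_
    · intro u v _ huv
      rw [mul_assoc, ← Real.exp_add, show -u + -(v - u) = -v by ring]
      exact mul_le_mul_of_nonneg_right (hBmono (Real.exp_le_exp.2 huv)) (Real.exp_pos _).le
    · intro z hz
      have hz0 : z ≠ 0 := by rintro rfl; simp at hz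
      have h1z : 1 < (1 + z).re := by simpa using hz
      have h1z0 : 1 + z ≠ 0 := by intro h; rw [h] at h1z; simp at h1z; linarith
      have hFi := LSeries_eq_mul_integral_of_nonneg b zero_le_one h1z (isBigO_sum hB hb) hb
      have hsub := integral_comp_exp_Ioi
        (fun t : ℝ => (∑ k ∈ Finset.Icc 1 ⌊t⌋₊, (b k : ℂ)) * (t : ℂ) ^ (-(1 + z + 1))) 0
      rw [Real.exp_zero] at hsub
      rw [← hsub] at hFi
      have hid := log_deriv_identity ha hb hab hB hρ.le hδ hδ1 hC hA hA' h1z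
      rw [← hF, ← hZ, add_sub_cancel_left] at hid
      have hexpi : IntegrableOn (fun u : ℝ => Complex.exp (-z * u)) (Ioi 0) :=
        integrableOn_exp_mul_complex_Ioi (by simpa using hz) 0
      have hexp : ∫ u in Ioi (0 : ℝ), Complex.exp (-z * u) = 1 / z := by
        rw [integral_exp_mul_complex_Ioi (by simpa using hz)]
        simp
      have e : ∀ u : ℝ, ((B (Real.exp u) * Real.exp (-u) - 1 : ℝ) : ℂ) * Complex.exp (-z * u) =
          (Real.exp u • ((∑ k ∈ Finset.Icc 1 ⌊Real.exp u⌋₊, (b k : ℂ)) *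
            ((Real.exp u : ℝ) : ℂ) ^ (-(1 + z + 1)))) - Complex.exp (-z * u) := by
        intro u
        have hpow : ((Real.exp u : ℝ) : ℂ) ^ (-(1 + z + 1)) =
            Complex.exp (u * (-(1 + z + 1))) := by
          rw [Complex.cpow_def_of_ne_zero (by exact_mod_cast (Real.exp_pos u).ne'),
            ← Complex.ofReal_log (Real.exp_pos u).le, Real.log_exp]
        rw [hpow, Complex.real_smul]
        have hs : Complex.exp u * Complex.exp (u * (-(1 + z + 1))) =
            Complex.exp (-u) * Complex.exp (-z * u) := by
          rw [← Complex.exp_add, ← Complex.exp_add]; congr 1; ring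
        simp only [hBdef]
        push_cast
        linear_combination (-(∑ k ∈ Finset.Icc 1 ⌊Real.exp u⌋₊, (b k : ℂ))) * hs
      simp_rw [e]
      rw [integral_sub _ hexpi, hexp]
      · have hI : ∫ u in Ioi (0 : ℝ), (Real.exp u • ((∑ k ∈ Finset.Icc 1 ⌊Real.exp u⌋₊, (b k : ℂ)) *
            ((Real.exp u : ℝ) : ℂ) ^ (-(1 + z + 1)))) = F (1 + z) / (1 + z) := by
          rw [hF, hFi, mul_div_cancel_left₀ _ h1z0]
        rw [hI]
        have hZ1 := hZne (1 + z) h1z.le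
        have hF1 : F (1 + z) = 1 / z - deriv Z (1 + z) / Z (1 + z) := by
          field_simp
          linear_combination hid
        rw [hF1]
        field_simp
        ring
      · have h1 : IntegrableOn (fun u : ℝ => ((B (Real.exp u) * Real.exp (-u) : ℝ) : ℂ) *
            Complex.exp (-z * u)) (Ioi 0) := by
          refine hexpi.bdd_mul (c := C')
            (Complex.measurable_ofReal.comp hgm).aestronglyMeasurable (Eventually.of_forall fun u => ?_)
          rw [Complex.norm_real, Real.norm_of_nonneg (mul_nonneg (hB0 _) (Real.exp_pos _).le)]
          exact hgM u
        refine h1.congr (Eventually.of_forall fun u => ?_)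
        have := e u
        simp only [Complex.ofReal_sub, sub_mul, Complex.ofReal_one, one_mul, sub_left_inj] at this
        exact this
    · have hmaps : MapsTo (fun z : ℂ => 1 + z) {z | 0 ≤ z.re} {s | 1 - δ < s.re} := by
        intro z hz
        have : 0 ≤ z.re := hz
        simp; linarith
      have hne : ∀ z ∈ {z : ℂ | 0 ≤ z.re}, 1 + z ≠ 0 := by
        intro z hz h
        have h0 : 0 ≤ z.re := hz
        have := congrArg Complex.re h
        simp at this; linarith
      have h1 : ContinuousOn (fun z : ℂ => 1 + z) {z | 0 ≤ z.re} := by fun_prop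
      refine ContinuousOn.sub (ContinuousOn.div (ContinuousOn.neg (ContinuousOn.div
        (hZd'.continuousOn.comp h1 hmaps) (hZd.continuousOn.comp h1 hmaps) fun z hz => ?_))
        h1 hne) (continuousOn_const.div h1 hne)
      refine hZne _ ?_
      have : 0 ≤ z.re := hz
      simpa using this
  refine (hlim.comp Real.tendsto_log_atTop).congr' ?_
  filter_upwards [eventually_gt_atTop 0] with x hx
  simp only [Function.comp, Real.exp_neg, Real.exp_log hx]
  rfl

end Dirichlet
end PrimeDensity

namespace LatticeCount

open MeasureTheory Module Submodule Metric Set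
open scoped Pointwise

theorem inter_frontier_nonempty_of_isPreconnected {α : Type*} [TopologicalSpace α] {c s : Set α}
    (hc : IsPreconnected c) (h₁ : (c ∩ s).Nonempty) (h₂ : (c ∩ sᶜ).Nonempty) :
    (c ∩ frontier s).Nonempty := by
  by_contra hne
  rw [not_nonempty_iff_eq_empty] at hne
  have hmem : ∀ x ∈ c, x ∉ frontier s := fun x hx hf =>
    (eq_empty_iff_forall_notMem.mp hne) x ⟨hx, hf⟩
  have hcov : c ⊆ interior s ∪ interior sᶜ := by
    intro x hx
    have := hmem x hx
    rw [frontier_eq_closure_inter_closure] at this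
    by_contra h
    rw [mem_union, not_or] at h
    apply this
    rw [closure_eq_compl_interior_compl, closure_eq_compl_interior_compl, compl_compl]
    exact ⟨h.2, h.1⟩
  obtain ⟨x, hxc, hxs⟩ := h₁
  obtain ⟨y, hyc, hys⟩ := h₂
  obtain ⟨z, -, hz₁, hz₂⟩ := hc _ _ isOpen_interior isOpen_interior hcov
    ⟨x, hxc, (hcov hxc).resolve_right fun h => interior_subset h hxs⟩
    ⟨y, hyc, (hcov hyc).resolve_left fun h => hys (interior_subset h)⟩
  exact interior_subset hz₂ (interior_subset hz₁)

variable {E ι : Type*} [NormedAddCommGroup E] [NormedSpace ℝ E] [FiniteDimensional ℝ E]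
  [Fintype ι] (b : Basis ι ℝ E)

omit [FiniteDimensional ℝ E] in
theorem convex_fundamentalDomain : Convex ℝ (ZSpan.fundamentalDomain b) := by
  have : ZSpan.fundamentalDomain b = b.equivFun ⁻¹' (univ.pi fun _ => Ico (0 : ℝ) 1) := by
    ext x
    simp [ZSpan.mem_fundamentalDomain]
  rw [this]
  exact (convex_pi fun _ _ => convex_Ico 0 1).linear_preimage b.equivFun.toLinearMap

omit [FiniteDimensional ℝ E] [Fintype ι] in
theorem zero_mem_fundamentalDomain : (0 : E) ∈ ZSpan.fundamentalDomain b := by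
  simp [ZSpan.mem_fundamentalDomain]

omit [FiniteDimensional ℝ E] in
theorem sub_mem_fundamentalDomain_iff {x : E} {l : span ℤ (range b)} :
    x - l ∈ ZSpan.fundamentalDomain b ↔ ZSpan.floor b x = l := by
  rw [← ZSpan.fract_eq_self, sub_eq_add_neg, ZSpan.fract_add_ZSpan _ _ (neg_mem l.2),
    ZSpan.fract_apply, ← sub_eq_add_neg, sub_right_inj, Subtype.ext_iff]

theorem exists_card_inter_closedBall_le (R : ℝ) :
    ∃ M : ℕ, ∀ c : E, (closedBall c R ∩ (span ℤ (range b) : Set E)).Finite ∧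
      (closedBall c R ∩ (span ℤ (range b) : Set E)).ncard ≤ M := by
  obtain ⟨D, hD⟩ := (ZSpan.fundamentalDomain_isBounded b).subset_closedBall 0
  have hfin : ∀ (c : E) (R : ℝ), (closedBall c R ∩ (span ℤ (range b) : Set E)).Finite :=
    fun c R => ZSpan.setFinite_inter b isBounded_closedBall
  refine ⟨(closedBall (0 : E) (R + D) ∩ (span ℤ (range b) : Set E)).ncard, fun c => ⟨hfin c R, ?_⟩⟩
  refine ncard_le_ncard_of_injOn (fun x => x - ZSpan.floor b c) ?_ ?_ (hfin _ _)
  · rintro x ⟨hx, hxL⟩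
    refine ⟨?_, sub_mem hxL (ZSpan.floor b c).2⟩
    have h1 : ‖ZSpan.fract b c‖ ≤ D := by
      simpa using hD (ZSpan.fract_mem_fundamentalDomain b c)
    rw [mem_closedBall, dist_eq_norm] at hx
    rw [mem_closedBall, dist_zero_right]
    have : x - (ZSpan.floor b c : E) = (x - c) + ZSpan.fract b c := by
      rw [ZSpan.fract_apply]; abel
    rw [this]
    exact (norm_add_le _ _).trans (add_le_add hx h1)
  · intro x _ y _ h
    simpa using h

variable [MeasurableSpace E] [BorelSpace E] (μ : Measure E) [μ.IsAddHaarMeasure]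

theorem abs_ncard_mul_sub_measure_le {S : Set E} (hS : Bornology.IsBounded S)
    (hSm : MeasurableSet S) {D : ℝ} (hD : ZSpan.fundamentalDomain b ⊆ closedBall 0 D)
    {T : Set E} (hT : T.Finite)
    (hfT : ∀ l ∈ (span ℤ (range b) : Set E), (closedBall l D ∩ frontier S).Nonempty → l ∈ T) :
    |((S ∩ (span ℤ (range b) : Set E)).ncard : ℝ) * μ.real (ZSpan.fundamentalDomain b) -
      μ.real S| ≤ T.ncard * μ.real (ZSpan.fundamentalDomain b) := by
  classical
  set V := ZSpan.fundamentalDomain b with hV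
  have hVm : MeasurableSet V := ZSpan.fundamentalDomain_measurableSet b
  have hVt : μ V ≠ ⊤ := (ZSpan.fundamentalDomain_isBounded b).measure_lt_top.ne
  have hS' : Bornology.IsBounded ((fun x => (ZSpan.floor b x : E)) '' S) := by
    obtain ⟨B, hB⟩ := hS.subset_closedBall 0
    refine (isBounded_closedBall (x := (0 : E)) (r := B + D)).subset ?_
    rintro _ ⟨x, hx, rfl⟩
    have h1 : ‖ZSpan.fract b x‖ ≤ D := by
      simpa using hD (ZSpan.fract_mem_fundamentalDomain b x)
    have h2 : ‖x‖ ≤ B := by simpa using hB hx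
    have h3 : (ZSpan.floor b x : E) = x - ZSpan.fract b x := by
      rw [ZSpan.fract_apply]; abel
    simp only [mem_closedBall, dist_zero_right]
    rw [h3]
    exact (norm_sub_le _ _).trans (add_le_add h2 h1)
  have hF := ZSpan.setFinite_inter b hS'
  set F : Finset E := hF.toFinset with hFdef
  have hFmem : ∀ l, l ∈ F ↔ (∃ x ∈ S, (ZSpan.floor b x : E) = l) := by
    intro l
    simp only [hFdef, Set.Finite.mem_toFinset, mem_inter_iff, mem_image, SetLike.mem_coe]
    constructor
    · exact fun h => h.1
    · rintro ⟨x, hx, rfl⟩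
      exact ⟨⟨x, hx, rfl⟩, (ZSpan.floor b x).2⟩
  have hFL : ∀ l ∈ F, l ∈ (span ℤ (range b) : Set E) := fun l hl => by
    obtain ⟨x, -, rfl⟩ := (hFmem l).mp hl
    exact (ZSpan.floor b x).2
  let cell : E → Set E := fun l => (fun x => x - l) ⁻¹' V
  have hcellm : ∀ l, MeasurableSet (cell l) := fun l => hVm.preimage (measurable_sub_const l)
  have hcellμ : ∀ l, μ (cell l) = μ V := fun l => by
    simp only [cell, sub_eq_add_neg]
    exact measure_preimage_add_right μ (-l) V
  have hcellμr : ∀ l, μ.real (cell l) = μ.real V := fun l => by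
    rw [measureReal_def, measureReal_def, hcellμ]
  have hcell : ∀ l (hl : l ∈ (span ℤ (range b) : Set E)) x,
      x ∈ cell l ↔ (ZSpan.floor b x : E) = l := fun l hl x => by
    have := sub_mem_fundamentalDomain_iff b (x := x) (l := ⟨l, hl⟩)
    rw [Subtype.ext_iff] at this
    exact this
  have hSU : S = ⋃ l ∈ F, (cell l ∩ S) := by
    ext x
    simp only [mem_iUnion, mem_inter_iff, exists_prop]
    constructor
    · intro hx
      exact ⟨ZSpan.floor b x, (hFmem _).2 ⟨x, hx, rfl⟩,
        (hcell _ (ZSpan.floor b x).2 x).2 rfl, hx⟩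
    · rintro ⟨l, -, -, h⟩
      exact h
  have hμS : μ.real S = ∑ l ∈ F, μ.real (cell l ∩ S) := by
    conv_lhs => rw [hSU]
    refine measureReal_biUnion_finset ?_ (fun l _ => (hcellm l).inter hSm) fun l _ => ?_
    · intro l hl l' hl' hne
      refine Set.disjoint_left.mpr fun x hx hx' => hne ?_
      rw [← (hcell l (hFL l hl) x).1 hx.1, ← (hcell l' (hFL l' hl') x).1 hx'.1]
    · exact ((measure_mono inter_subset_left).trans_lt
        ((hcellμ l).trans_lt hVt.lt_top)).ne
  have hcount : ((S ∩ (span ℤ (range b) : Set E)).ncard : ℝ) =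
      ∑ l ∈ F, if l ∈ S then (1 : ℝ) else 0 := by
    have : S ∩ (span ℤ (range b) : Set E) = (F.filter (· ∈ S) : Finset E) := by
      ext x
      simp only [mem_inter_iff, Finset.coe_filter, mem_ofPred_eq]
      constructor
      · rintro ⟨h1, h2⟩
        exact ⟨(hFmem x).2 ⟨x, h1, ZSpan.floor_eq_self_of_mem b x h2⟩, h1⟩
      · rintro ⟨h1, h2⟩
        exact ⟨h2, hFL x h1⟩
    rw [this, ncard_coe_finset, Finset.sum_boole]
  have hcr : ∀ l, μ.real (cell l ∩ S) ≤ μ.real V := fun l => by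
    rw [← hcellμr l]
    exact measureReal_mono inter_subset_left (by rw [hcellμ l]; exact hVt)
  have hterm : ∀ l ∈ F, |(if l ∈ S then (1 : ℝ) else 0) * μ.real V - μ.real (cell l ∩ S)| ≤
      (if l ∈ T then (1 : ℝ) else 0) * μ.real V := by
    intro l hl
    have h0 : (0 : ℝ) ≤ μ.real (cell l ∩ S) := measureReal_nonneg
    by_cases hlT : l ∈ T
    · rw [if_pos hlT, one_mul, abs_le]
      have := hcr l
      split_ifs <;> constructor <;> linarith
    · have hlcell : l ∈ cell l := by
        simp only [cell, mem_preimage, sub_self]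
        exact zero_mem_fundamentalDomain b
      have hconn : IsPreconnected (cell l) := by
        have : cell l = (fun x => x + l) '' V := by
          ext x
          simp only [cell, mem_preimage, mem_image]
          exact ⟨fun h => ⟨_, h, by simp⟩, by rintro ⟨y, hy, rfl⟩; simpa using hy⟩
        rw [this]
        exact (convex_fundamentalDomain b).isPreconnected.image _ (by fun_prop)
      have hno : ¬ (cell l ∩ frontier S).Nonempty := by
        rintro ⟨x, hx, hxf⟩
        refine hlT (hfT l (hFL l hl) ⟨x, ?_, hxf⟩)
        have := hD hx
        rwa [mem_closedBall, dist_zero_right, ← dist_eq_norm] at this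
      rw [if_neg hlT, zero_mul]
      by_cases hlS : l ∈ S
      · have hsub : cell l ⊆ S := by
          intro x hx
          by_contra hxS
          exact hno (inter_frontier_nonempty_of_isPreconnected hconn ⟨l, hlcell, hlS⟩ ⟨x, hx, hxS⟩)
        rw [if_pos hlS, inter_eq_left.mpr hsub, hcellμr l]
        simp
      · have hemp : cell l ∩ S = ∅ := by
          rw [eq_empty_iff_forall_notMem]
          rintro x ⟨hx, hxS⟩
          exact hno (inter_frontier_nonempty_of_isPreconnected hconn ⟨x, hx, hxS⟩ ⟨l, hlcell, hlS⟩)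
        rw [if_neg hlS, hemp]
        simp
  rw [hcount, hμS, Finset.sum_mul, ← Finset.sum_sub_distrib]
  refine (Finset.abs_sum_le_sum_abs _ _).trans ((Finset.sum_le_sum hterm).trans ?_)
  rw [← Finset.sum_mul, Finset.sum_boole]
  refine mul_le_mul_of_nonneg_right ?_ measureReal_nonneg
  rw [← ncard_coe_finset]
  exact_mod_cast ncard_le_ncard (fun x hx => (Finset.mem_filter.mp hx).2) hT

omit [MeasurableSpace E] [BorelSpace E] in
theorem exists_finite_ncard_le_of_subset_biUnion (R D : ℝ) : ∃ M : ℕ, ∀ (f : Set E) (G : Finset E),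
    (f ⊆ ⋃ c ∈ G, closedBall c R) →
    {l | l ∈ (span ℤ (range b) : Set E) ∧ (closedBall l D ∩ f).Nonempty}.Finite ∧
    {l | l ∈ (span ℤ (range b) : Set E) ∧ (closedBall l D ∩ f).Nonempty}.ncard ≤ G.card * M := by
  classical
  obtain ⟨M, hM⟩ := exists_card_inter_closedBall_le b (D + R)
  refine ⟨M, fun f G hG => ?_⟩
  have hsub : {l | l ∈ (span ℤ (range b) : Set E) ∧ (closedBall l D ∩ f).Nonempty} ⊆
      ↑(G.biUnion fun c => (hM c).1.toFinset) := by
    rintro l ⟨hl, x, hxl, hxf⟩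
    obtain ⟨c, hc, hxc⟩ := mem_iUnion₂.mp (hG hxf)
    simp only [Finset.coe_biUnion, Set.Finite.coe_toFinset, mem_iUnion]
    refine ⟨c, hc, ?_, hl⟩
    rw [mem_closedBall] at *
    calc dist l c ≤ dist l x + dist x c := dist_triangle _ _ _
      _ ≤ D + R := add_le_add (by rwa [dist_comm]) hxc
  refine ⟨(Finset.finite_toSet _).subset hsub, (ncard_le_ncard hsub (Finset.finite_toSet _)).trans ?_⟩
  rw [ncard_coe_finset]
  refine Finset.card_biUnion_le_card_mul _ _ _ fun c _ => ?_
  rw [← ncard_eq_toFinset_card _ (hM c).1]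
  exact (hM c).2

/-- Points of the grid `{0, …, N}^κ` lying on a facet of the cube. -/
def facetGrid (κ : Type*) [Fintype κ] [DecidableEq κ] (N : ℕ) : Finset (κ → ℕ) :=
  Finset.univ.biUnion fun i => ({0, N} : Finset ℕ).biUnion fun e =>
    Fintype.piFinset (Function.update (fun _ => Finset.range (N + 1)) i {e})

theorem card_facetGrid_le (κ : Type*) [Fintype κ] [DecidableEq κ] (N : ℕ) :
    (facetGrid κ N).card ≤ Fintype.card κ * (2 * (N + 1) ^ (Fintype.card κ - 1)) := by
  refine (Finset.card_biUnion_le_card_mul _ _ (2 * (N + 1) ^ (Fintype.card κ - 1))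
    fun i _ => ?_).trans_eq (by rw [Finset.card_univ])
  refine (Finset.card_biUnion_le_card_mul _ _ ((N + 1) ^ (Fintype.card κ - 1))
    fun e _ => ?_).trans (Nat.mul_le_mul_right _ Finset.card_le_two)
  rw [Fintype.card_piFinset]
  have : (fun j => (Function.update (fun _ => Finset.range (N + 1)) i {e} j).card) =
      Function.update (fun _ => N + 1) i 1 := by
    ext j
    by_cases h : j = i
    · subst h; simp
    · simp [Function.update_of_ne h]
  rw [this, Finset.prod_update_of_mem (Finset.mem_univ i), one_mul, Finset.prod_const,
    ← Finset.erase_eq, Finset.card_erase_of_mem (Finset.mem_univ i), Finset.card_univ]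

theorem exists_mem_facetGrid {κ : Type*} [Fintype κ] [DecidableEq κ] {N : ℕ} (hN : 0 < N)
    {v : κ → ℝ} (hv : v ∈ Icc (0 : κ → ℝ) 1) (hf : ∃ i, v i = 0 ∨ v i = 1) :
    ∃ g ∈ facetGrid κ N, (fun i => (g i : ℝ) / N) ∈ Icc (0 : κ → ℝ) 1 ∧
      dist v (fun i => (g i : ℝ) / N) ≤ 1 / N := by
  have hN' : (0 : ℝ) < N := by exact_mod_cast hN
  have h0 : ∀ i, 0 ≤ v i := fun i => hv.1 i
  have h1 : ∀ i, v i ≤ 1 := fun i => hv.2 i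
  have hle : ∀ i, ⌊N * v i⌋₊ ≤ N := fun i =>
    Nat.floor_le_of_le (by nlinarith [h1 i])
  refine ⟨fun i => ⌊N * v i⌋₊, ?_, ⟨fun i => ?_, fun i => ?_⟩, ?_⟩
  · obtain ⟨i, hi⟩ := hf
    simp only [facetGrid, Finset.mem_biUnion, Finset.mem_univ, true_and]
    refine ⟨i, ⌊N * v i⌋₊, ?_, ?_⟩
    · rcases hi with hi | hi <;> simp [hi]
    · rw [Fintype.mem_piFinset]
      intro j
      by_cases h : j = i
      · subst h; simp
      · rw [Function.update_of_ne h, Finset.mem_range]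
        exact Nat.lt_succ_of_le (hle j)
  · simp only [Pi.zero_apply]; positivity
  · simp only [Pi.one_apply]
    rw [div_le_one hN']
    exact_mod_cast hle i
  · refine (dist_pi_le_iff (by positivity)).mpr fun i => ?_
    have e : v i - (⌊N * v i⌋₊ : ℝ) / N = (N * v i - ⌊N * v i⌋₊) / N := by field_simp
    have p1 := Nat.floor_le (mul_nonneg hN'.le (h0 i))
    have p2 := (Nat.lt_floor_add_one ((N : ℝ) * v i)).le
    rw [Real.dist_eq, e, abs_of_nonneg (div_nonneg (by linarith) hN'.le)]
    gcongr
    linarith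

theorem exists_abs_ncard_smul_inter_sub_le {X : Set E} (hX : Bornology.IsBounded X)
    (hXm : MeasurableSet X) {η κ : Type*} [Fintype η] [Fintype κ]
    (Φ : η → (κ → ℝ) → E) (K : NNReal) (hΦ : ∀ k, LipschitzOnWith K (Φ k) (Icc 0 1))
    (hfr : frontier X ⊆ ⋃ k, Φ k '' {v | v ∈ Icc 0 1 ∧ ∃ i, v i = 0 ∨ v i = 1}) :
    ∃ C : ℝ, 0 ≤ C ∧ ∀ s : ℝ, 1 ≤ s →
      |((s • X ∩ (span ℤ (range b) : Set E)).ncard : ℝ) -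
        s ^ finrank ℝ E * (μ.real X / μ.real (ZSpan.fundamentalDomain b))| ≤
      C * s ^ (Fintype.card κ - 1) := by
  classical
  obtain ⟨D, hD⟩ := (ZSpan.fundamentalDomain_isBounded b).subset_closedBall 0
  obtain ⟨M, hM⟩ := exists_finite_ncard_le_of_subset_biUnion b K D
  set V := ZSpan.fundamentalDomain b
  have hVpos : 0 < μ.real V := by
    rw [measureReal_def]
    exact ENNReal.toReal_pos (ZSpan.measure_fundamentalDomain_ne_zero b)
      (ZSpan.fundamentalDomain_isBounded b).measure_lt_top.ne
  set d := Fintype.card κ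
  refine ⟨(Fintype.card η * (d * (2 * 3 ^ (d - 1))) * M : ℕ), by positivity, fun s hs => ?_⟩
  have hs0 : s ≠ 0 := by positivity
  set N := ⌈s⌉₊
  have hNs : s ≤ N := Nat.le_ceil s
  have hN : 0 < N := by
    have : (0 : ℝ) < N := by linarith
    exact_mod_cast this
  have hN3 : ((N + 1 : ℕ) : ℝ) ≤ 3 * s := by
    have := Nat.ceil_lt_add_one (show (0 : ℝ) ≤ s by linarith)
    push_cast
    linarith
  have hfrs : frontier (s • X) = s • frontier X := by
    rw [frontier, frontier, closure_smul₀, interior_smul₀ hs0, smul_set_sdiff₀ hs0]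
  let G : Finset E := ((Finset.univ : Finset η) ×ˢ facetGrid κ N).image
    fun p => s • Φ p.1 (fun i => (p.2 i : ℝ) / N)
  have hcov : frontier (s • X) ⊆ ⋃ c ∈ G, closedBall c K := by
    rw [hfrs]
    rintro _ ⟨x, hx, rfl⟩
    obtain ⟨k, v, ⟨hv, hvf⟩, rfl⟩ := mem_iUnion.mp (hfr hx)
    obtain ⟨g, hg, hg1, hgd⟩ := exists_mem_facetGrid hN hv hvf
    refine mem_iUnion₂.mpr ⟨s • Φ k (fun i => (g i : ℝ) / N), ?_, ?_⟩
    · exact Finset.mem_image.mpr ⟨(k, g), by simp [hg], rfl⟩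
    · have h1 := (hΦ k).dist_le_mul v hv _ hg1
      rw [mem_closedBall]
      simp only
      rw [dist_smul₀, Real.norm_eq_abs, abs_of_nonneg (by linarith)]
      have hN' : (0 : ℝ) < N := by exact_mod_cast hN
      calc s * dist (Φ k v) (Φ k (fun i => (g i : ℝ) / N)) ≤ N * (K * (1 / N)) := by
            gcongr
            exact h1.trans (by gcongr)
        _ = K := by field_simp
  obtain ⟨hTfin, hTcard⟩ := hM _ G hcov
  have key := abs_ncard_mul_sub_measure_le b μ (S := s • X) (hX.smul₀ s)
    (hXm.const_smul₀ s) hD hTfin fun l hl h => ⟨hl, h⟩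
  have hμ : μ.real (s • X) = s ^ finrank ℝ E * μ.real X := by
    rw [measureReal_def, Measure.addHaar_smul, ENNReal.toReal_mul, measureReal_def,
      ENNReal.toReal_ofReal (abs_nonneg _), abs_of_nonneg (by positivity)]
  rw [hμ] at key
  have hGcard : (G.card : ℝ) ≤ Fintype.card η * (d * (2 * (3 * s) ^ (d - 1))) := by
    have h1 : G.card ≤ Fintype.card η * (d * (2 * (N + 1) ^ (d - 1))) := by
      refine Finset.card_image_le.trans ?_
      rw [Finset.card_product, Finset.card_univ]
      exact Nat.mul_le_mul_left _ (card_facetGrid_le κ N)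
    calc (G.card : ℝ) ≤ ((Fintype.card η * (d * (2 * (N + 1) ^ (d - 1))) : ℕ) : ℝ) := by
          exact_mod_cast h1
      _ = Fintype.card η * (d * (2 * ((N + 1 : ℕ) : ℝ) ^ (d - 1))) := by push_cast; ring
      _ ≤ _ := by gcongr
  refine le_of_mul_le_mul_right ?_ hVpos
  calc _ = |((s • X ∩ (span ℤ (range b) : Set E)).ncard : ℝ) * μ.real V -
        s ^ finrank ℝ E * μ.real X| := by
        rw [← abs_of_pos hVpos, ← abs_mul, abs_of_pos hVpos]
        congr 1
        field_simp
    _ ≤ _ := key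
    _ ≤ _ := by
        refine mul_le_mul_of_nonneg_right ?_ hVpos.le
        calc _ ≤ ((G.card * M : ℕ) : ℝ) := by exact_mod_cast hTcard
          _ = (G.card : ℝ) * M := by push_cast; ring
          _ ≤ (Fintype.card η * (d * (2 * (3 * s) ^ (d - 1)))) * M := by gcongr
          _ = _ := by push_cast; ring

end LatticeCount

namespace IdealCount

open MeasureTheory Module Set NumberField NumberField.InfinitePlace NumberField.mixedEmbedding
  NumberField.mixedEmbedding.fundamentalCone NumberField.Units.dirichletUnitTheorem
open scoped Pointwise nonZeroDivisors

variable (K : Type*) [Field K] [NumberField K]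

section boundary

open scoped Classical

/-- The vector of absolute values at all places attached to a point of the cube. -/
noncomputable def cubeNorm (v : InfinitePlace K ⊕ {w : InfinitePlace K // IsComplex w} → ℝ) :
    realSpace K :=
  v (Sum.inl w₀) • expMapBasis fun w => if w = w₀ then 0 else v (Sum.inl w)

/-- Parametrization of the closure of `normLeOne K` by a cube, for a choice of signs at the real
places. -/
noncomputable def cubeParam (ε : {w : InfinitePlace K // IsReal w} → Bool)
    (v : InfinitePlace K ⊕ {w : InfinitePlace K // IsComplex w} → ℝ) : mixedSpace K :=
  (fun w => (if ε w then 1 else -1) * cubeNorm K v w,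
   fun w => (cubeNorm K v w : ℂ) *
    Complex.exp (((2 * v (Sum.inr w) - 1) * Real.pi : ℝ) * Complex.I))

variable {K}

theorem contDiff_expMapBasis :
    ContDiff ℝ 1 (expMapBasis : realSpace K → realSpace K) := by
  have h : (expMapBasis : realSpace K → realSpace K) =
      fun x w => Real.exp ((w.mult : ℝ)⁻¹ * (completeBasis K).equivFunL.symm x w) := by
    ext x w
    rw [expMapBasis_apply, expMap_apply]
    rfl
  rw [h, contDiff_pi]
  intro w
  refine Real.contDiff_exp.comp (contDiff_const.mul ?_)
  exact contDiff_pi.mp ((completeBasis K).equivFunL.symm.contDiff (n := 1)) w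

theorem contDiff_cubeNorm : ContDiff ℝ 1 (cubeNorm K) := by
  unfold cubeNorm
  refine (contDiff_apply ℝ ℝ _).smul (contDiff_expMapBasis.comp (contDiff_pi.mpr fun w => ?_))
  split_ifs
  · exact contDiff_const
  · exact contDiff_apply ℝ ℝ _

theorem contDiff_cubeParam (ε : {w : InfinitePlace K // IsReal w} → Bool) :
    ContDiff ℝ 1 (cubeParam K ε) := by
  unfold cubeParam
  have hN : ∀ w, ContDiff ℝ 1 fun v => cubeNorm K v w := fun w => contDiff_pi.mp contDiff_cubeNorm w
  refine ContDiff.prodMk (contDiff_pi.mpr fun w => contDiff_const.mul (hN _))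
    (contDiff_pi.mpr fun w => ?_)
  refine (Complex.ofRealCLM.contDiff.comp (hN _)).mul ?_
  refine ContDiff.cexp (ContDiff.mul (Complex.ofRealCLM.contDiff.comp ?_) contDiff_const)
  exact ((contDiff_const.mul (contDiff_apply ℝ ℝ _)).sub contDiff_const).mul contDiff_const

theorem exists_lipschitzOnWith_cubeParam :
    ∃ C : NNReal, ∀ ε, LipschitzOnWith C (cubeParam K ε) (Icc 0 1) := by
  have h : ∀ ε, ∃ C : NNReal, LipschitzOnWith C (cubeParam K ε) (Icc 0 1) := fun ε =>
    (contDiff_cubeParam ε).contDiffOn.exists_lipschitzOnWith one_ne_zero (convex_Icc _ _)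
      isCompact_Icc
  choose C hC using h
  exact ⟨∑ ε, C ε, fun ε => (hC ε).weaken
    (Finset.single_le_sum (f := C) (fun _ _ => zero_le) (Finset.mem_univ ε))⟩

theorem frontier_normLeOne_subset :
    frontier (normLeOne K) ⊆ ⋃ ε, cubeParam K ε '' {v | v ∈ Icc 0 1 ∧ ∃ i, v i = 0 ∨ v i = 1} := by
  intro x hx
  obtain ⟨u, hu, _, ⟨y, hy, rfl⟩, hxy⟩ := closure_normLeOne_subset K hx.1
  have hnot : normAtAllPlaces x ∉ expMapBasis '' interior (paramSet K) := fun h =>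
    hx.2 (subset_interior_normLeOne K h)
  have hy' : ∀ w, y w ∈ (if w = w₀ then {0} else Icc 0 1 : Set ℝ) := fun w => hy w (mem_univ _)
  have hy0 : y w₀ = 0 := by simpa using hy' w₀
  have hy1 : ∀ w, w ≠ w₀ → y w ∈ Icc (0 : ℝ) 1 := fun w hw => by simpa [hw] using hy' w
  let v : InfinitePlace K ⊕ {w : InfinitePlace K // IsComplex w} → ℝ :=
    Sum.elim (fun w => if w = w₀ then u else y w)
      (fun w => (Complex.arg (x.2 w) / Real.pi + 1) / 2)
  have hvn : cubeNorm K v = normAtAllPlaces x := by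
    rw [← hxy]
    simp only [cubeNorm, v, Sum.elim_inl, if_true]
    congr 2
    ext w
    by_cases hw : w = w₀
    · subst hw; simp [hy0]
    · simp [hw]
  have hvI : ∀ i, v i ∈ Icc (0 : ℝ) 1 := by
    rintro (w | w)
    · simp only [v, Sum.elim_inl]
      split_ifs with hw
      · exact hu
      · exact hy1 w hw
    · simp only [v, Sum.elim_inr]
      have hpi := Real.pi_pos
      have h1 : -1 ≤ Complex.arg (x.2 w) / Real.pi := by
        rw [le_div_iff₀ hpi]; linarith [Complex.neg_pi_lt_arg (x.2 w)]
      have h2 : Complex.arg (x.2 w) / Real.pi ≤ 1 := by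
        rw [div_le_iff₀ hpi]; linarith [Complex.arg_le_pi (x.2 w)]
      constructor <;> linarith
  refine mem_iUnion.mpr ⟨fun w => decide (0 ≤ x.1 w), v,
    ⟨⟨fun i => (hvI i).1, fun i => (hvI i).2⟩, ?_⟩, ?_⟩
  · by_contra! hne
    apply hnot
    have hu0 : 0 < u := lt_of_le_of_ne hu.1 (by simpa [v] using (hne (Sum.inl w₀)).1.symm)
    have hu1 : u < 1 := lt_of_le_of_ne hu.2 (by simpa [v] using (hne (Sum.inl w₀)).2)
    refine ⟨fun w => if w = w₀ then Real.log u else y w, ?_, ?_⟩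
    · rw [interior_paramSet, mem_univ_pi]
      intro w
      split_ifs with hw
      · exact Real.log_neg hu0 hu1
      · have := hne (Sum.inl w)
        simp only [v, Sum.elim_inl, if_neg hw] at this
        exact ⟨lt_of_le_of_ne (hy1 w hw).1 this.1.symm, lt_of_le_of_ne (hy1 w hw).2 this.2⟩
    · rw [expMapBasis_apply'', if_pos rfl, Real.exp_log hu0, ← hxy]
      simp only
      congr 2
      ext w
      by_cases hw : w = w₀
      · subst hw; simp [hy0]
      · simp [hw]
  · unfold cubeParam
    rw [hvn]
    refine Prod.ext (funext fun w => ?_) (funext fun w => ?_)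
    · simp only [normAtPlace_apply_of_isReal w.2, Real.norm_eq_abs,
        decide_eq_true_eq]
      split_ifs with h
      · rw [abs_of_nonneg h, one_mul]
      · rw [abs_of_neg (not_le.mp h)]; ring
    · simp only [normAtPlace_apply_of_isComplex w.2, v, Sum.elim_inr]
      conv_rhs => rw [← Complex.norm_mul_exp_arg_mul_I (x.2 w)]
      congr 4
      field_simp
      ring

theorem card_cube : Fintype.card (InfinitePlace K ⊕ {w : InfinitePlace K // IsComplex w}) =
    finrank ℚ K := by
  rw [Fintype.card_sum, card_eq_nrRealPlaces_add_nrComplexPlaces,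
    ← card_add_two_mul_card_eq_rank, nrComplexPlaces]
  ring

end boundary

theorem card_class_eq {C : ClassGroup (𝓞 K)} {J : (Ideal (𝓞 K))⁰}
    (hJ : ClassGroup.mk0 J = C⁻¹) (s : ℝ) :
    Nat.card {I : (Ideal (𝓞 K))⁰ // Ideal.absNorm (I : Ideal (𝓞 K)) ≤ s ∧ ClassGroup.mk0 I = C}
      = Nat.card {I : (Ideal (𝓞 K))⁰ // (J : Ideal (𝓞 K)) ∣ I ∧
        Submodule.IsPrincipal (I : Ideal (𝓞 K)) ∧
        Ideal.absNorm (I : Ideal (𝓞 K)) ≤ s * Ideal.absNorm (J : Ideal (𝓞 K))} := by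
  simp_rw [← nonZeroDivisors_dvd_iff_dvd_coe]
  refine Nat.card_congr ?_
  refine ((Equiv.dvd J).subtypeEquiv fun I ↦ ?_).trans
    (Equiv.subtypeSubtypeEquivSubtypeInter (fun I : (Ideal (𝓞 K))⁰ ↦ J ∣ I) _)
  rw [← ClassGroup.mk0_eq_one_iff (SetLike.coe_mem _)]
  simp_rw [Equiv.dvd_apply, Submonoid.coe_mul, ← Submonoid.mul_def, map_mul, hJ,
    inv_mul_eq_one, Nat.cast_mul, mul_comm s, eq_comm, and_comm, and_congr_left_iff]
  exact fun _ ↦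
    (mul_le_mul_iff_of_pos_left (Nat.cast_pos.mpr (Ideal.absNorm_pos_of_nonZeroDivisors J))).symm

theorem card_idealSet_norm_le_eq (J : (Ideal (𝓞 K))⁰) {s : ℝ} (hs : 0 < s) :
    Nat.card {a : idealSet K J // mixedEmbedding.norm (a : mixedSpace K) ≤ s ^ finrank ℚ K} =
      (s • normLeOne K ∩
        (mixedEmbedding.idealLattice K (FractionalIdeal.mk0 K J) : Set (mixedSpace K))).ncard := by
  rw [← Nat.card_coe_set_eq]
  refine Nat.card_congr ((Equiv.subtypeSubtypeEquivSubtypeInter (· ∈ idealSet K J)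
    (mixedEmbedding.norm · ≤ s ^ finrank ℚ K)).trans (Equiv.subtypeEquivProp ?_))
  ext x
  have h1 : x ∈ s • normLeOne K ↔
      x ∈ fundamentalCone K ∧ mixedEmbedding.norm x ≤ s ^ finrank ℚ K := by
    rw [mem_smul_set_iff_inv_smul_mem₀ hs.ne', mem_normLeOne, smul_mem_iff_mem (inv_ne_zero hs.ne'),
      mixedEmbedding.norm_smul, abs_of_pos (inv_pos.mpr hs), inv_pow,
      inv_mul_le_iff₀ (by positivity), mul_one]
  change (x ∈ idealSet K J ∧ _) ↔ x ∈ s • normLeOne K ∧ _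
  rw [h1, idealSet, mem_inter_iff]
  tauto

theorem exists_abs_card_class_sub_le (C : ClassGroup (𝓞 K)) :
    ∃ c A : ℝ, 0 ≤ A ∧ ∀ x : ℝ, 1 ≤ x →
      |(Nat.card {I : (Ideal (𝓞 K))⁰ //
        Ideal.absNorm (I : Ideal (𝓞 K)) ≤ x ∧ ClassGroup.mk0 I = C} : ℝ) - c * x| ≤
      A * x ^ (1 - 1 / (finrank ℚ K : ℝ)) := by
  classical
  obtain ⟨J, hJ⟩ := ClassGroup.mk0_surjective C⁻¹
  have hN : 0 < Ideal.absNorm (J : Ideal (𝓞 K)) := Ideal.absNorm_pos_of_nonZeroDivisors J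
  set N : ℝ := ((Ideal.absNorm (J : Ideal (𝓞 K)) : ℕ) : ℝ) with hNdef
  have hN1 : 1 ≤ N := by rw [hNdef]; exact_mod_cast hN
  set n := finrank ℚ K with hn
  have hnpos : 0 < n := finrank_pos
  have hn0 : (n : ℝ) ≠ 0 := by positivity
  obtain ⟨L, hL⟩ := exists_lipschitzOnWith_cubeParam (K := K)
  obtain ⟨B, hB0, hB⟩ := LatticeCount.exists_abs_ncard_smul_inter_sub_le
    (mixedEmbedding.fractionalIdealLatticeBasis K (FractionalIdeal.mk0 K J))
    (volume : Measure (mixedSpace K)) (isBounded_normLeOne K) (measurableSet_normLeOne K)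
    (cubeParam K) L hL frontier_normLeOne_subset
  rw [mixedEmbedding.span_idealLatticeBasis, card_cube, mixedEmbedding.finrank] at hB
  set V := (volume : Measure (mixedSpace K)).real (normLeOne K) / (volume : Measure (mixedSpace K)).real
    (ZSpan.fundamentalDomain (mixedEmbedding.fractionalIdealLatticeBasis K
      (FractionalIdeal.mk0 K J)))
  have ht : (0 : ℝ) < Units.torsionOrder K := by
    exact_mod_cast Nat.pos_of_ne_zero (Units.torsionOrder_ne_zero K)
  set t : ℝ := ((Units.torsionOrder K : ℕ) : ℝ) with htdef
  refine ⟨N * V / t, B * N ^ (1 - 1 / (n : ℝ)) / t, by positivity, fun x hx => ?_⟩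
  have hxN : 1 ≤ x * N := one_le_mul_of_one_le_of_one_le hx hN1
  set s := (x * N) ^ (1 / (n : ℝ)) with hs
  have hs1 : 1 ≤ s := Real.one_le_rpow hxN (by positivity)
  have hsn : s ^ n = x * N := by
    rw [hs, ← Real.rpow_natCast, ← Real.rpow_mul (by positivity), one_div_mul_cancel hn0,
      Real.rpow_one]
  have hsn1 : s ^ (n - 1) = x ^ (1 - 1 / (n : ℝ)) * N ^ (1 - 1 / (n : ℝ)) := by
    rw [hs, ← Real.rpow_natCast, ← Real.rpow_mul (by positivity),
      ← Real.mul_rpow (by positivity) (by positivity), Nat.cast_sub hnpos]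
    congr 1
    field_simp
    simp
  have hcard := card_isPrincipal_dvd_norm_le (K := K) J (x * N)
  rw [← hsn, card_idealSet_norm_le_eq K J (by linarith), hsn, hNdef, ← card_class_eq K hJ] at hcard
  have hcard' : (Nat.card {I : (Ideal (𝓞 K))⁰ //
        Ideal.absNorm (I : Ideal (𝓞 K)) ≤ x ∧ ClassGroup.mk0 I = C} : ℝ) =
      ((s • normLeOne K ∩ (mixedEmbedding.idealLattice K (FractionalIdeal.mk0 K J) :
        Set (mixedSpace K))).ncard : ℝ) / t := by
    rw [eq_div_iff ht.ne', htdef, ← hcard]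
    push_cast
    rfl
  have key := hB s hs1
  rw [hsn, hsn1] at key
  rw [hcard', ← abs_of_pos ht, show ∀ P : ℝ, P / |t| - N * V / |t| * x = (P - x * N * V) / |t| by
    intro P; ring, abs_div, abs_abs, abs_of_pos ht, div_le_iff₀ ht]
  refine key.trans_eq ?_
  field_simp

theorem card_norm_le_eq_sum (x : ℝ) (hx : 0 ≤ x) :
    Nat.card {I : (Ideal (𝓞 K))⁰ // Ideal.absNorm (I : Ideal (𝓞 K)) ≤ x} =
      ∑ C : ClassGroup (𝓞 K), Nat.card {I : (Ideal (𝓞 K))⁰ //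
        Ideal.absNorm (I : Ideal (𝓞 K)) ≤ x ∧ ClassGroup.mk0 I = C} := by
  classical
  have : Fintype {I : (Ideal (𝓞 K))⁰ // Ideal.absNorm (I : Ideal (𝓞 K)) ≤ x} := by
    simp_rw [← Nat.le_floor_iff hx]
    exact @Fintype.ofFinite _ (Ideal.finite_setOfPred_absNorm_le₀ ⌊x⌋₊)
  let e := fun C : ClassGroup (𝓞 K) ↦ Equiv.subtypeSubtypeEquivSubtypeInter
    (fun I : (Ideal (𝓞 K))⁰ ↦ (Ideal.absNorm I.1 : ℝ) ≤ x) (fun I ↦ ClassGroup.mk0 I = C)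
  simp_rw [← Nat.card_congr (e _), Nat.card_eq_fintype_card, Fintype.subtype_card]
  rw [Fintype.card, Finset.card_eq_sum_card_fiberwise (f := fun I ↦ ClassGroup.mk0 I.1)
    (t := Finset.univ) (fun _ _ ↦ Finset.mem_univ _)]

theorem exists_abs_card_norm_le_sub_le :
    ∃ ρ A : ℝ, 0 < ρ ∧ 0 ≤ A ∧ ∀ x : ℝ, 1 ≤ x →
      |(Nat.card {I : (Ideal (𝓞 K))⁰ // Ideal.absNorm (I : Ideal (𝓞 K)) ≤ x} : ℝ) - ρ * x| ≤
      A * x ^ (1 - 1 / (finrank ℚ K : ℝ)) := by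
  choose c A hA0 hA using exists_abs_card_class_sub_le K
  have main : ∀ x : ℝ, 1 ≤ x →
      |(Nat.card {I : (Ideal (𝓞 K))⁰ // Ideal.absNorm (I : Ideal (𝓞 K)) ≤ x} : ℝ) -
        (∑ C, c C) * x| ≤ (∑ C, A C) * x ^ (1 - 1 / (finrank ℚ K : ℝ)) := by
    intro x hx
    rw [card_norm_le_eq_sum K x (by linarith), Nat.cast_sum, Finset.sum_mul, Finset.sum_mul,
      ← Finset.sum_sub_distrib]
    exact (Finset.abs_sum_le_sum_abs _ _).trans (Finset.sum_le_sum fun C _ => hA C x hx)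
  refine ⟨_, _, ?_, Finset.sum_nonneg fun C _ => hA0 C, main⟩
  have hlim := NumberField.Ideal.tendsto_norm_le_div_atTop₀ K
  have hnpos : (0 : ℝ) < finrank ℚ K := by exact_mod_cast (finrank_pos : 0 < finrank ℚ K)
  have hlim2 : Tendsto (fun x : ℝ =>
      (Nat.card {I : (Ideal (𝓞 K))⁰ // Ideal.absNorm (I : Ideal (𝓞 K)) ≤ x} : ℝ) / x) atTop
      (nhds (∑ C, c C)) := by
    rw [tendsto_iff_norm_sub_tendsto_zero]
    have h0 : Tendsto (fun x : ℝ => (∑ C, A C) * x ^ (-(1 / (finrank ℚ K : ℝ)))) atTop (nhds 0) := by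
      simpa using (tendsto_rpow_neg_atTop (y := 1 / (finrank ℚ K : ℝ)) (by positivity)).const_mul
        (∑ C, A C)
    refine squeeze_zero' (Eventually.of_forall fun _ => norm_nonneg _) ?_ h0
    filter_upwards [eventually_ge_atTop 1] with x hx
    have hx0 : 0 < x := by linarith
    have := main x hx
    rw [Real.norm_eq_abs, div_sub' hx0.ne', abs_div, abs_of_pos hx0, div_le_iff₀ hx0, mul_assoc,
      mul_comm x (∑ C, c C)]
    refine this.trans_eq ?_
    rw [← Real.rpow_add_one hx0.ne']
    ring_nf
  rw [tendsto_nhds_unique hlim2 hlim]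
  have h1 := Units.regulator_pos K
  have h2 : (0 : ℝ) < Units.torsionOrder K := by
    exact_mod_cast Nat.pos_of_ne_zero (Units.torsionOrder_ne_zero K)
  have h3 : (0 : ℝ) < classNumber K := by exact_mod_cast Nat.pos_of_ne_zero (classNumber_ne_zero K)
  have h4 : (0 : ℝ) < |(discr K : ℝ)| := abs_pos.mpr (by exact_mod_cast discr_ne_zero K)
  have h5 := Real.pi_pos
  positivity

end IdealCount

namespace IdealMangoldt

open Module NumberField Ideal UniqueFactorizationMonoid

variable (K : Type*) [Field K] [NumberField K]

/-- The ideals of norm `n`. -/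
noncomputable def idealsOfNorm (n : ℕ) : Finset (Ideal (𝓞 K)) :=
  (finite_setOfPred_absNorm_eq n).toFinset

open scoped Classical in
/-- Pairs `(P, k)` with `P` a nonzero prime ideal, `k ≥ 1`, both bounded in terms of `n`. -/
noncomputable def primePairs (n : ℕ) : Finset (Ideal (𝓞 K) × ℕ) :=
  ((finite_setOfPred_absNorm_le n).toFinset.filter Prime) ×ˢ Finset.Icc 1 n

/-- The pairs `(P, k)` with `P` a nonzero prime ideal, `k ≥ 1` and `N(P) ^ k = n`. -/
noncomputable def primePowersOfNorm (n : ℕ) : Finset (Ideal (𝓞 K) × ℕ) :=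
  (primePairs K n).filter fun q => absNorm q.1 ^ q.2 = n

/-- The von Mangoldt function attached to the Dedekind zeta function of `K`. -/
noncomputable def mangoldt (n : ℕ) : ℝ :=
  ∑ q ∈ primePowersOfNorm K n, Real.log (absNorm q.1)

variable {K}

theorem mem_idealsOfNorm {n : ℕ} {I : Ideal (𝓞 K)} : I ∈ idealsOfNorm K n ↔ absNorm I = n := by
  simp [idealsOfNorm]

theorem two_le_absNorm {P : Ideal (𝓞 K)} (hP : Prime P) : 2 ≤ absNorm P := by
  have h0 : absNorm P ≠ 0 := by
    rw [Ne, absNorm_eq_zero_iff]; exact hP.ne_zero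
  have h1 : absNorm P ≠ 1 := by
    rw [Ne, absNorm_eq_one_iff]
    rintro rfl
    exact hP.not_isUnit (by rw [Ideal.isUnit_iff])
  omega

theorem mem_primePairs {n : ℕ} {q : Ideal (𝓞 K) × ℕ} :
    q ∈ primePairs K n ↔ (absNorm q.1 ≤ n ∧ Prime q.1) ∧ 1 ≤ q.2 ∧ q.2 ≤ n := by
  simp [primePairs]

theorem mem_primePairs_of_pow_le {n : ℕ} {q : Ideal (𝓞 K) × ℕ} (hq : Prime q.1) (hk : 1 ≤ q.2)
    (h : absNorm q.1 ^ q.2 ≤ n) : q ∈ primePairs K n := by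
  have h2 := two_le_absNorm hq
  refine mem_primePairs.mpr ⟨⟨?_, hq⟩, hk, ?_⟩
  · exact (Nat.le_self_pow (by omega) _).trans h
  · exact (Nat.lt_pow_self (by omega)).le.trans h

theorem mem_primePowersOfNorm {n : ℕ} {q : Ideal (𝓞 K) × ℕ} :
    q ∈ primePowersOfNorm K n ↔ Prime q.1 ∧ 1 ≤ q.2 ∧ absNorm q.1 ^ q.2 = n := by
  rw [primePowersOfNorm, Finset.mem_filter]
  constructor
  · rintro ⟨h1, h2⟩
    exact ⟨(mem_primePairs.mp h1).1.2, (mem_primePairs.mp h1).2.1, h2⟩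
  · rintro ⟨h1, h2, h3⟩
    exact ⟨mem_primePairs_of_pow_le h1 h2 h3.le, h3⟩

theorem mangoldt_nonneg (n : ℕ) : 0 ≤ mangoldt K n :=
  Finset.sum_nonneg fun _ _ => Real.log_natCast_nonneg _

open scoped Classical in
theorem log_absNorm_eq {n : ℕ} (hn : n ≠ 0) {M : Ideal (𝓞 K)} (hM : absNorm M = n) :
    Real.log n = ∑ q ∈ primePairs K n with q.1 ^ q.2 ∣ M, Real.log (absNorm q.1) := by
  have hM0 : M ≠ 0 := by
    rintro rfl
    simp at hM
    exact hn hM.symm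
  have hle : ∀ P k, Prime P → P ^ k ∣ M → absNorm P ^ k ≤ n := by
    intro P k hP h
    have := map_dvd absNorm h
    rw [map_pow, hM] at this
    exact Nat.le_of_dvd (Nat.pos_of_ne_zero hn) this
  have hcount : ∀ P k, Prime P → (P ^ k ∣ M ↔ k ≤ (normalizedFactors M).count P) := by
    intro P k hP
    rw [pow_dvd_iff_le_emultiplicity, emultiplicity_eq_count_normalizedFactors hP.irreducible hM0,
      normalize_eq, Nat.cast_le]
  have hprod : (n : ℝ) = ∏ P ∈ (normalizedFactors M).toFinset,
      (absNorm P : ℝ) ^ (normalizedFactors M).count P := by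
    have h1 := Ideal.prod_normalizedFactors_eq_self hM0
    rw [Finset.prod_multiset_count] at h1
    have h2 := congrArg absNorm h1
    rw [map_prod, hM] at h2
    rw [← h2]
    push_cast
    simp
  rw [hprod, Real.log_prod]
  swap
  · intro P hP
    have := two_le_absNorm (prime_of_normalized_factor P (Multiset.mem_toFinset.mp hP))
    positivity
  have hset : (primePairs K n).filter (fun q => q.1 ^ q.2 ∣ M) =
      ((normalizedFactors M).toFinset.sigma fun P =>
        Finset.Icc 1 ((normalizedFactors M).count P)).image (fun x => (x.1, x.2)) := by
    ext ⟨P, k⟩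
    simp only [Finset.mem_filter, Finset.mem_image, Finset.mem_sigma, Multiset.mem_toFinset,
      Finset.mem_Icc, Prod.mk.injEq, Sigma.exists]
    constructor
    · rintro ⟨h1, h2⟩
      obtain ⟨⟨-, hP⟩, hk, -⟩ := mem_primePairs.mp h1
      have h3 := (hcount P k hP).mp h2
      exact ⟨P, k, ⟨Multiset.count_pos.mp (lt_of_lt_of_le hk h3), hk, h3⟩, rfl, rfl⟩
    · rintro ⟨P', k', ⟨h1, h2, h3⟩, rfl, rfl⟩
      have hP := prime_of_normalized_factor P' h1
      have h4 := (hcount P' k' hP).mpr h3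
      exact ⟨mem_primePairs_of_pow_le hP h2 (hle _ _ hP h4), h4⟩
  rw [hset, Finset.sum_image, Finset.sum_sigma]
  · refine Finset.sum_congr rfl fun P _ => ?_
    simp [Real.log_pow]
  · rintro ⟨a, b⟩ - ⟨c, d⟩ - h
    simpa using h

theorem card_filter_dvd {n m : ℕ} (hn : n ≠ 0) {I : Ideal (𝓞 K)} (h : absNorm I * m = n) :
    open scoped Classical in
    ((idealsOfNorm K n).filter (I ∣ ·)).card = (idealsOfNorm K m).card := by
  classical
  have hI0 : absNorm I ≠ 0 := by rintro h0; rw [h0, zero_mul] at h; exact hn h.symm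
  have hI : I ≠ 0 := by rintro rfl; simp at hI0
  symm
  refine Finset.card_bij (fun J _ => I * J) ?_ ?_ ?_
  · intro J hJ
    rw [mem_idealsOfNorm] at hJ
    rw [Finset.mem_filter, mem_idealsOfNorm, map_mul, hJ]
    exact ⟨h, dvd_mul_right _ _⟩
  · intro J _ J' _ h
    exact mul_left_cancel₀ hI h
  · intro M hM
    rw [Finset.mem_filter, mem_idealsOfNorm] at hM
    obtain ⟨hM, J, rfl⟩ := hM
    refine ⟨J, ?_, rfl⟩
    rw [map_mul, ← h] at hM
    rw [mem_idealsOfNorm]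
    exact mul_left_cancel₀ hI0 hM

theorem sum_mangoldt_mul_card (n : ℕ) :
    ∑ p ∈ n.divisorsAntidiagonal, mangoldt K p.1 * (idealsOfNorm K p.2).card =
      (idealsOfNorm K n).card * Real.log n := by
  classical
  rcases eq_or_ne n 0 with rfl | hn
  · simp
  have hR : ((idealsOfNorm K n).card : ℝ) * Real.log n =
      ∑ q ∈ primePairs K n, Real.log (absNorm q.1) *
        ((idealsOfNorm K n).filter (q.1 ^ q.2 ∣ ·)).card := by
    rw [← nsmul_eq_mul, ← Finset.sum_const, Finset.sum_congr rfl
      fun M hM => log_absNorm_eq hn (mem_idealsOfNorm.mp hM)]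
    simp_rw [Finset.sum_filter]
    rw [Finset.sum_comm]
    refine Finset.sum_congr rfl fun q _ => ?_
    rw [← Finset.sum_filter, Finset.sum_const, nsmul_eq_mul, mul_comm]
  have hL : ∀ p ∈ n.divisorsAntidiagonal, mangoldt K p.1 * (idealsOfNorm K p.2).card =
      ∑ q ∈ primePairs K n, if absNorm q.1 ^ q.2 = p.1 then
        Real.log (absNorm q.1) * ((idealsOfNorm K n).filter (q.1 ^ q.2 ∣ ·)).card else 0 := by
    intro p hp
    obtain ⟨hp, -⟩ := Nat.mem_divisorsAntidiagonal.mp hp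
    rw [← Finset.sum_filter, mangoldt, Finset.sum_mul]
    have : (primePairs K n).filter (fun q => absNorm q.1 ^ q.2 = p.1) =
        primePowersOfNorm K p.1 := by
      ext q
      rw [Finset.mem_filter, mem_primePowersOfNorm]
      constructor
      · rintro ⟨h1, h2⟩
        exact ⟨(mem_primePairs.mp h1).1.2, (mem_primePairs.mp h1).2.1, h2⟩
      · rintro ⟨h1, h2, h3⟩
        refine ⟨mem_primePairs_of_pow_le h1 h2 ?_, h3⟩
        rw [h3]
        exact Nat.le_of_dvd (Nat.pos_of_ne_zero hn) ⟨_, hp.symm⟩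
    rw [this]
    refine Finset.sum_congr rfl fun q hq => ?_
    rw [card_filter_dvd hn (I := q.1 ^ q.2) (m := p.2)]
    rw [map_pow, (mem_primePowersOfNorm.mp hq).2.2, hp]
  rw [hR, Finset.sum_congr rfl hL, Finset.sum_comm]
  refine Finset.sum_congr rfl fun q _ => ?_
  by_cases hd : absNorm q.1 ^ q.2 ∣ n
  · obtain ⟨m, hm⟩ := hd
    rw [Finset.sum_eq_single (absNorm q.1 ^ q.2, m)]
    · simp
    · rintro ⟨u, v⟩ huv hne
      obtain ⟨huv, -⟩ := Nat.mem_divisorsAntidiagonal.mp huv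
      rw [if_neg]
      intro h
      simp only at h huv
      apply hne
      rw [h]
      congr
      have hu : u ≠ 0 := by rintro rfl; simp at huv; exact hn huv.symm
      rw [h, ← huv] at hm
      exact mul_left_cancel₀ hu hm
    · intro h
      exact absurd (Nat.mem_divisorsAntidiagonal.mpr ⟨hm.symm, hn⟩) h
  · have hz : ((idealsOfNorm K n).filter (q.1 ^ q.2 ∣ ·)) = ∅ := by
      refine Finset.filter_eq_empty_iff.mpr fun M hM hdv => hd ?_
      have := map_dvd absNorm hdv
      rwa [map_pow, mem_idealsOfNorm.mp hM] at this
    rw [hz]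
    simp

theorem natCast_mem_of_absNorm_pow_eq {P : Ideal (𝓞 K)} (hP : Prime P) {p k m : ℕ}
    (h : absNorm P ^ k = p ^ m) (hk : k ≠ 0) : (p : 𝓞 K) ∈ P := by
  have hPp : P.IsPrime := (prime_iff_isPrime hP.ne_zero).mp hP
  have h1 : ((absNorm P : ℕ) : 𝓞 K) ∈ P := absNorm_mem P
  have h2 : ((p ^ m : ℕ) : 𝓞 K) ∈ P := by
    rw [← h]
    push_cast
    exact P.pow_mem_of_mem h1 k (Nat.pos_of_ne_zero hk)
  push_cast at h2
  exact hPp.mem_of_pow_mem _ h2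

theorem mangoldt_le (n : ℕ) :
    mangoldt K n ≤ (finrank ℚ K : ℝ) ^ 2 * ArithmeticFunction.vonMangoldt n := by
  classical
  rcases (primePowersOfNorm K n).eq_empty_or_nonempty with he | ⟨⟨P₀, k₀⟩, hq₀⟩
  · rw [mangoldt, he, Finset.sum_empty]
    exact mul_nonneg (by positivity) ArithmeticFunction.vonMangoldt_nonneg
  obtain ⟨hP₀, hk₀, hn₀⟩ := mem_primePowersOfNorm.mp hq₀
  simp only at hP₀ hk₀ hn₀
  have : P₀.IsPrime := (prime_iff_isPrime hP₀.ne_zero).mp hP₀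
  have : P₀.IsMaximal := this.isMaximal hP₀.ne_zero
  have hfin : Finite (𝓞 K ⧸ P₀) := Ideal.finiteQuotientOfFreeOfNeBot P₀ hP₀.ne_zero
  obtain ⟨p, f, hp, hf, hpf⟩ : ∃ p f : ℕ, p.Prime ∧ 0 < f ∧ p ^ f = absNorm P₀ := by
    let _ := Ideal.Quotient.field P₀
    have _ := Fintype.ofFinite (𝓞 K ⧸ P₀)
    have h := FiniteField.isPrimePow_card (𝓞 K ⧸ P₀)
    rw [isPrimePow_nat_iff, ← Nat.card_eq_fintype_card] at h
    exact h
  have hn : n = p ^ (f * k₀) := by rw [pow_mul, hpf, hn₀]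
  have hΛ : ArithmeticFunction.vonMangoldt n = Real.log p := by
    rw [hn, ArithmeticFunction.vonMangoldt_apply_pow (Nat.mul_ne_zero hf.ne' (by omega)),
      ArithmeticFunction.vonMangoldt_apply_prime hp]
  have hmem : ∀ q ∈ primePowersOfNorm K n, (p : 𝓞 K) ∈ q.1 := by
    intro q hq
    obtain ⟨h1, h2, h3⟩ := mem_primePowersOfNorm.mp hq
    exact natCast_mem_of_absNorm_pow_eq h1 (h3.trans hn) (by omega)
  have hlog : ∀ q ∈ primePowersOfNorm K n,
      Real.log (absNorm q.1) ≤ finrank ℚ K * Real.log p := by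
    intro q hq
    obtain ⟨h1, h2, h3⟩ := mem_primePowersOfNorm.mp hq
    have hdvd : absNorm q.1 ∣ p ^ finrank ℚ K := by
      have : q.1 ∣ span {(p : 𝓞 K)} := by
        rw [dvd_span_singleton]; exact hmem q hq
      have := map_dvd absNorm this
      rwa [absNorm_span_natCast, RingOfIntegers.rank] at this
    rw [← Real.log_pow]
    have h2' := two_le_absNorm h1
    refine Real.log_le_log (by positivity) ?_
    exact_mod_cast Nat.le_of_dvd (pow_pos hp.pos _) hdvd
  have hcard : (primePowersOfNorm K n).card ≤ finrank ℚ K := by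
    have hmax : (span {(p : ℤ)}).IsMaximal :=
      PrincipalIdealRing.isMaximal_of_irreducible (Nat.prime_iff_prime_int.mp hp).irreducible
    have hne : span {(p : ℤ)} ≠ ⊥ := by
      simp [hp.ne_zero]
    refine le_trans ?_ (card_primesOverFinset_le_finrank (𝓞 K) ℚ K hne)
    refine Finset.card_le_card_of_injOn Prod.fst ?_ ?_
    · intro q hq
      obtain ⟨h1, h2, h3⟩ := mem_primePowersOfNorm.mp hq
      rw [Finset.mem_coe, IsDedekindDomain.mem_primesOverFinset_iff hne]
      have hPp : q.1.IsPrime := (prime_iff_isPrime h1.ne_zero).mp h1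
      refine ⟨hPp, ⟨?_⟩⟩
      refine hmax.eq_of_le (IsPrime.under ℤ q.1).ne_top ?_
      rw [span_singleton_le_iff_mem, Ideal.mem_comap]
      simpa using hmem q hq
    · rintro ⟨P, k⟩ hq ⟨P', k'⟩ hq' h
      obtain ⟨h1, h2, h3⟩ := mem_primePowersOfNorm.mp hq
      obtain ⟨-, -, h3'⟩ := mem_primePowersOfNorm.mp hq'
      simp only at h h1 h3 h3'
      subst h
      rw [← h3] at h3'
      rw [Nat.pow_right_injective (two_le_absNorm h1) h3']
  have hlogp : 0 ≤ Real.log p := Real.log_natCast_nonneg p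
  calc mangoldt K n ≤ (primePowersOfNorm K n).card • (finrank ℚ K * Real.log p) :=
        Finset.sum_le_card_nsmul _ _ _ hlog
    _ = (primePowersOfNorm K n).card * (finrank ℚ K * Real.log p) := nsmul_eq_mul _ _
    _ ≤ finrank ℚ K * (finrank ℚ K * Real.log p) := by gcongr
    _ = _ := by rw [hΛ]; ring

end IdealMangoldt

namespace IdealMangoldt

open Module NumberField Ideal Topology

variable (K : Type*) [Field K] [NumberField K]

theorem sum_card_idealsOfNorm (n : ℕ) :
    ∑ k ∈ Finset.Icc 1 n, (idealsOfNorm K k).card =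
      Nat.card {I : nonZeroDivisors (Ideal (𝓞 K)) //
        (absNorm (I : Ideal (𝓞 K)) : ℝ) ≤ (n : ℝ)} := by
  classical
  rw [← Finset.card_biUnion]
  · rw [← Fintype.card_coe, ← Nat.card_eq_fintype_card]
    have hmem : ∀ I : Ideal (𝓞 K), I ∈ (Finset.Icc 1 n).biUnion (idealsOfNorm K) ↔
        1 ≤ absNorm I ∧ absNorm I ≤ n := by
      intro I
      simp [mem_idealsOfNorm]
    refine Nat.card_eq_of_bijective (fun I => ⟨⟨I.1, ?_⟩, ?_⟩) ⟨?_, ?_⟩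
    · refine mem_nonZeroDivisors_of_ne_zero fun h0 => ?_
      have := ((hmem _).mp I.2).1
      simp [h0] at this
    · exact_mod_cast ((hmem _).mp I.2).2
    · intro I J h
      exact Subtype.ext (congrArg (fun x => x.1.1) h)
    · rintro ⟨⟨I, h0⟩, h⟩
      refine ⟨⟨I, (hmem I).mpr ⟨?_, by exact_mod_cast h⟩⟩, rfl⟩
      rw [Nat.one_le_iff_ne_zero, Ne, absNorm_eq_zero_iff]
      exact nonZeroDivisors.ne_zero h0
  · intro i _ j _ hij
    refine Finset.disjoint_left.mpr fun I hI hJ => hij ?_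
    rw [← mem_idealsOfNorm.mp hI, mem_idealsOfNorm.mp hJ]

theorem tendsto_sum_mangoldt_div :
    Tendsto (fun x : ℝ => (∑ n ∈ Finset.Icc 1 ⌊x⌋₊, mangoldt K n) / x) atTop (𝓝 1) := by
  obtain ⟨ρ, A, hρ, hA, h⟩ := IdealCount.exists_abs_card_norm_le_sub_le K
  have hd : 1 ≤ finrank ℚ K := finrank_pos
  have hd' : (1 : ℝ) ≤ finrank ℚ K := by exact_mod_cast hd
  refine PrimeDensity.tendsto_sum_div (a := fun n => ((idealsOfNorm K n).card : ℝ)) (ρ := ρ)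
    (δ := 1 / (finrank ℚ K : ℝ)) (C := A) (C' := (finrank ℚ K : ℝ) ^ 2 * (Real.log 4 + 4))
    (fun n => Nat.cast_nonneg _) mangoldt_nonneg sum_mangoldt_mul_card ?_ hρ (by positivity)
    ((div_le_one (by positivity)).mpr hd') hA ?_
  · intro n
    calc ∑ k ∈ Finset.Icc 1 n, mangoldt K k
        ≤ ∑ k ∈ Finset.Icc 1 n, (finrank ℚ K : ℝ) ^ 2 * ArithmeticFunction.vonMangoldt k :=
          Finset.sum_le_sum fun k _ => mangoldt_le k
      _ = (finrank ℚ K : ℝ) ^ 2 * Chebyshev.psi n := by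
          rw [← Finset.mul_sum, Chebyshev.psi, Nat.floor_natCast]
          rfl
      _ ≤ _ := by
          rw [mul_assoc]
          gcongr
          exact Chebyshev.psi_le_const_mul_self n.cast_nonneg
  · intro n
    rcases Nat.eq_zero_or_pos n with rfl | hn
    · simp
      positivity
    have := h n (by exact_mod_cast hn)
    rw [← sum_card_idealsOfNorm] at this
    push_cast at this
    exact this

/-- The number of prime ideals of norm `p`. -/
noncomputable def primeCount (p : ℕ) : ℕ :=
  Nat.card {P : Ideal (𝓞 K) // P.IsPrime ∧ absNorm P = p}

variable {K} in
theorem mangoldt_prime {p : ℕ} (hp : p.Prime) :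
    mangoldt K p = primeCount K p * Real.log p := by
  have hne : ∀ P : Ideal (𝓞 K), absNorm P = p → P ≠ 0 := by
    rintro P h rfl
    simp at h
    exact hp.ne_zero h.symm
  have hone : ∀ q ∈ primePowersOfNorm K p, q.2 = 1 ∧ absNorm q.1 = p := by
    intro q hq
    obtain ⟨-, -, h⟩ := mem_primePowersOfNorm.mp hq
    have h1 := (Nat.Prime.eq_one_of_pow (h ▸ hp :))
    exact ⟨h1, by rwa [h1, pow_one] at h⟩
  have hcard : primeCount K p = (primePowersOfNorm K p).card := by
    rw [primeCount, ← Fintype.card_coe, ← Nat.card_eq_fintype_card]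
    symm
    refine Nat.card_eq_of_bijective (fun q => ⟨q.1.1, ?_, (hone _ q.2).2⟩) ⟨?_, ?_⟩
    · have h := (mem_primePowersOfNorm.mp q.2).1
      exact (prime_iff_isPrime h.ne_zero).mp h
    · rintro ⟨q, hq⟩ ⟨q', hq'⟩ h
      simp only [Subtype.mk.injEq] at h ⊢
      exact Prod.ext h ((hone q hq).1.trans (hone q' hq').1.symm)
    · rintro ⟨P, hP, h⟩
      refine ⟨⟨(P, 1), mem_primePowersOfNorm.mpr ⟨?_, le_rfl, ?_⟩⟩, rfl⟩
      · exact (prime_iff_isPrime (hne P h)).mpr hP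
      · rw [pow_one, h]
  rw [mangoldt, Finset.sum_congr rfl fun q hq => by rw [(hone q hq).2], Finset.sum_const, hcard,
    nsmul_eq_mul]

theorem tendsto_sum_primeCount_div :
    Tendsto (fun x : ℝ => (∑ p ∈ (Finset.Icc 1 ⌊x⌋₊).filter Nat.Prime,
      primeCount K p * Real.log p) / x) atTop (𝓝 1) := by
  obtain ⟨C, hC⟩ := Chebyshev.psi_sub_theta_le_mul_sqrt
  have h1 : Tendsto (fun x : ℝ => (∑ n ∈ (Finset.Icc 1 ⌊x⌋₊).filter (¬ Nat.Prime ·),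
      mangoldt K n) / x) atTop (𝓝 0) := by
    have hlim : Tendsto (fun x : ℝ => (finrank ℚ K : ℝ) ^ 2 * C * (√x)⁻¹) atTop (𝓝 0) := by
      simpa using (tendsto_inv_atTop_zero.comp Real.tendsto_sqrt_atTop).const_mul
        ((finrank ℚ K : ℝ) ^ 2 * C)
    refine tendsto_of_tendsto_of_tendsto_of_le_of_le' tendsto_const_nhds hlim ?_ ?_
    · filter_upwards [eventually_ge_atTop 1] with x hx
      exact div_nonneg (Finset.sum_nonneg fun _ _ => mangoldt_nonneg _) (by linarith)
    · filter_upwards [eventually_ge_atTop 1] with x hx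
      have hψ : ∑ n ∈ (Finset.Icc 1 ⌊x⌋₊).filter (¬ Nat.Prime ·),
          ArithmeticFunction.vonMangoldt n = Chebyshev.psi x - Chebyshev.theta x := by
        rw [Chebyshev.psi, Chebyshev.theta, eq_sub_iff_add_eq, add_comm]
        have : ∑ p ∈ Finset.Ioc 0 ⌊x⌋₊ with p.Prime, Real.log p =
            ∑ p ∈ Finset.Icc 1 ⌊x⌋₊ with p.Prime, ArithmeticFunction.vonMangoldt p :=
          Finset.sum_congr rfl fun p hp => (ArithmeticFunction.vonMangoldt_apply_prime
            (Finset.mem_filter.mp hp).2).symm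
        rw [this]
        exact Finset.sum_filter_add_sum_filter_not _ _ _
      have hle : ∑ n ∈ (Finset.Icc 1 ⌊x⌋₊).filter (¬ Nat.Prime ·), mangoldt K n ≤
          (finrank ℚ K : ℝ) ^ 2 * (C * √x) := by
        refine (Finset.sum_le_sum fun n _ => mangoldt_le n).trans ?_
        rw [← Finset.mul_sum, hψ]
        gcongr
        exact hC x
      have hx0 : 0 < x := by linarith
      rw [div_le_iff₀ hx0]
      refine hle.trans (le_of_eq ?_)
      have hs : √x ≠ 0 := (Real.sqrt_pos.mpr hx0).ne'
      nth_rw 3 [← Real.mul_self_sqrt hx0.le]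
      field_simp
  have h2 := (tendsto_sum_mangoldt_div K).sub h1
  rw [sub_zero] at h2
  refine h2.congr fun x => ?_
  rw [← sub_div, ← Finset.sum_filter_add_sum_filter_not (Finset.Icc 1 ⌊x⌋₊) Nat.Prime,
    add_sub_cancel_right]
  congr 1
  exact Finset.sum_congr rfl fun p hp => mangoldt_prime (Finset.mem_filter.mp hp).2

end IdealMangoldt

namespace RootCount

open Module NumberField Ideal RingOfIntegers

section

variable {K : Type*} [Field K] [NumberField K]

theorem under_eq_span_of_absNorm_eq {P : Ideal (𝓞 K)} (hP : P.IsPrime) {p : ℕ} (hp : p.Prime)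
    (h : absNorm P = p) : P ∈ primesOver (span {(p : ℤ)}) (𝓞 K) := by
  have hmax : (span {(p : ℤ)}).IsMaximal :=
    PrincipalIdealRing.isMaximal_of_irreducible (Nat.prime_iff_prime_int.mp hp).irreducible
  refine ⟨hP, ⟨hmax.eq_of_le (IsPrime.under ℤ P).ne_top ?_⟩⟩
  rw [span_singleton_le_iff_mem, Ideal.mem_comap]
  simpa [h] using absNorm_mem P

theorem absNorm_eq_prime_iff {P : Ideal (𝓞 K)} {p : ℕ} (hp : p.Prime)
    (h : P ∈ primesOver (span {(p : ℤ)}) (𝓞 K)) : absNorm P = p ↔ P.inertiaDeg ℤ = 1 := by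
  have := h.1
  have := h.2
  rw [← absNorm_pow_inertiaDeg (span {(p : ℤ)}) P, absNorm_span_natCast]
  simp only [finrank_self, pow_one]
  exact Nat.pow_eq_self_iff hp.one_lt

omit [NumberField K] in
theorem X_sub_C_mem_monicFactorsMod {θ : 𝓞 K} {p : ℕ} [Fact p.Prime] (a : ZMod p) :
    X - C a ∈ monicFactorsMod θ p ↔ aeval a (minpoly ℤ θ) = 0 := by
  have h₀ : map (Int.castRingHom (ZMod p)) (minpoly ℤ θ) ≠ 0 :=
      map_monic_ne_zero (minpoly.monic θ.isIntegral)
  rw [Multiset.mem_toFinset, Polynomial.mem_normalizedFactors_iff h₀, dvd_iff_isRoot, IsRoot,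
    eval_map, aeval_def]
  exact ⟨fun h => h.2.2, fun h => ⟨irreducible_X_sub_C a, monic_X_sub_C a, h⟩⟩

theorem rootCountMod_minpoly {θ : 𝓞 K} {p : ℕ} (hp : p.Prime) (hθ : ¬ p ∣ exponent θ) :
    rootCountMod (minpoly ℤ θ) p = IdealMangoldt.primeCount K p := by
  have : Fact p.Prime := ⟨hp⟩
  let e := NumberField.Ideal.primesOverSpanEquivMonicFactorsMod hθ
  have hdeg : ∀ Q : monicFactorsMod θ p, inertiaDeg ((e.symm Q).1) ℤ = natDegree Q.1 := fun Q =>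
    NumberField.Ideal.inertiaDeg_primesOverSpanEquivMonicFactorsMod_symm_apply' hθ Q.2
  refine Nat.card_eq_of_bijective (fun a => ⟨(e.symm ⟨X - C a.1,
    (X_sub_C_mem_monicFactorsMod _).mpr a.2⟩).1, ?_, ?_⟩) ⟨?_, ?_⟩
  · exact (e.symm _).2.1
  · rw [absNorm_eq_prime_iff hp (e.symm _).2, hdeg, natDegree_X_sub_C]
  · intro a b hab
    simp only [Subtype.mk.injEq] at hab
    have := e.symm.injective (Subtype.ext hab)
    simp only [Subtype.mk.injEq, sub_right_inj, C_inj] at this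
    exact Subtype.ext this
  · rintro ⟨P, hP, hN⟩
    have hmem := under_eq_span_of_absNorm_eq hP hp hN
    have h1 : natDegree (e ⟨P, hmem⟩).1 = 1 := by
      rw [← hdeg, e.symm_apply_apply]
      exact (absNorm_eq_prime_iff hp hmem).mp hN
    have h₀ : map (Int.castRingHom (ZMod p)) (minpoly ℤ θ) ≠ 0 :=
      map_monic_ne_zero (minpoly.monic θ.isIntegral)
    have hQ := (e ⟨P, hmem⟩).2
    rw [Multiset.mem_toFinset, Polynomial.mem_normalizedFactors_iff h₀] at hQ
    obtain ⟨a, ha⟩ : ∃ a, (e ⟨P, hmem⟩).1 = X - C a := by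
      refine ⟨-(e ⟨P, hmem⟩).1.coeff 0, ?_⟩
      rw [hQ.2.1.eq_X_add_C h1]
      simp
    have ha' : X - C a ∈ monicFactorsMod θ p := ha ▸ (e ⟨P, hmem⟩).2
    refine ⟨⟨a, (X_sub_C_mem_monicFactorsMod a).mp ha'⟩, ?_⟩
    have : e.symm ⟨X - C a, ha'⟩ = ⟨P, hmem⟩ := by
      rw [Equiv.symm_apply_eq]
      exact Subtype.ext ha.symm
    simp only [Subtype.mk.injEq]
    rw [this]

theorem exponent_ne_zero {θ : 𝓞 K} (B : PowerBasis ℚ K) (hB : B.gen = θ) : exponent θ ≠ 0 := by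
  have hintegrable : IsIntegral ℤ B.gen := hB ▸ θ.isIntegral_coe
  have hbasis : ∀ i, IsIntegral ℤ (B.basis i) := fun i => by
    rw [B.basis_eq_pow]
    exact hintegrable.pow _
  obtain ⟨D, hD⟩ := IsIntegrallyClosed.isIntegral_iff.mp (Algebra.discr_isIntegral ℚ hbasis)
  have hD0 : D ≠ 0 := by
    rintro rfl
    exact Algebra.discr_not_zero_of_basis ℚ B.basis (by rw [← hD, map_zero])
  have hmem : D ∈ under ℤ (conductor ℤ θ) := by
    rw [Ideal.mem_comap, mem_conductor_iff]
    intro z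
    have h := Algebra.discr_mul_isIntegral_mem_adjoin ℚ hintegrable z.isIntegral_coe
    have h2 : Algebra.adjoin ℤ {B.gen} =
        (Algebra.adjoin ℤ {θ}).map (IsScalarTower.toAlgHom ℤ (𝓞 K) K) := by
      rw [AlgHom.map_adjoin, Set.image_singleton, hB]
      rfl
    rw [h2, Subalgebra.mem_map] at h
    obtain ⟨w, hw, hwz⟩ := h
    convert hw
    apply RingOfIntegers.ext
    refine Eq.trans ?_ hwz.symm
    rw [← hD, Algebra.smul_def]
    simp
  rw [exponent, Ne, absNorm_eq_zero_iff]
  intro h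
  rw [h] at hmem
  exact hD0 hmem

end

end RootCount

namespace RootCount

open Module NumberField RingOfIntegers

theorem rootCountMod_comp_C_mul_X {p : ℕ} [Fact p.Prime] (f : ℤ[X]) {m : ℤ}
    (hm : (m : ZMod p) ≠ 0) : rootCountMod (f.comp (C m * X)) p = rootCountMod f p := by
  have h : ∀ a : ZMod p, aeval a (f.comp (C m * X)) = aeval ((m : ZMod p) * a) f := by
    intro a
    rw [aeval_comp]
    simp
  refine Nat.card_congr ⟨fun a => ⟨m * a.1, (h _).symm.trans a.2⟩,
    fun a => ⟨(m : ZMod p)⁻¹ * a.1, (h _).trans ?_⟩, fun a => ?_, fun a => ?_⟩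
  · rw [mul_inv_cancel_left₀ hm]
    exact a.2
  · exact Subtype.ext (inv_mul_cancel_left₀ hm _)
  · exact Subtype.ext (mul_inv_cancel_left₀ hm _)

theorem rootCountMod_eq_of_C_mul_eq {p : ℕ} [Fact p.Prime] {f g : ℤ[X]} {a b : ℤ}
    (ha : (a : ZMod p) ≠ 0) (hb : (b : ZMod p) ≠ 0) (h : C a * f = C b * g) :
    rootCountMod f p = rootCountMod g p := by
  refine Nat.card_congr (Equiv.subtypeEquivRight fun x => ?_)
  have := congrArg (aeval x) h
  rw [map_mul, map_mul, aeval_C, aeval_C, algebraMap_int_eq, eq_intCast, eq_intCast] at this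
  constructor
  · intro hf
    rw [hf, mul_zero] at this
    exact (mul_eq_zero.mp this.symm).resolve_left hb
  · intro hg
    rw [hg, mul_zero] at this
    exact (mul_eq_zero.mp this).resolve_left ha

theorem exists_rootCountMod_eq_primeCount_of_adjoin_eq_top {f : ℤ[X]}
    (hf : Irreducible (f.map (Int.castRingHom ℚ))) {K : Type*} [Field K] [NumberField K] {α : K}
    (hfα : aeval α f = 0) (hadj : Algebra.adjoin ℚ {α} = ⊤) :
    ∃ N : ℕ, N ≠ 0 ∧
      ∀ p : ℕ, p.Prime → ¬ p ∣ N → rootCountMod f p = IdealMangoldt.primeCount K p := by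
  set q := f.map (Int.castRingHom ℚ) with hq
  have hf0 : f ≠ 0 := by
    rintro rfl
    exact hf.ne_zero (by simp [hq])
  obtain ⟨m, hm, hintegrable⟩ := IsAlgebraic.exists_integral_multiple (R := ℤ) ⟨f, hf0, hfα⟩
  obtain ⟨θ, hθα⟩ : ∃ θ : 𝓞 K, (θ : K) = (m : ℚ) • α :=
    ⟨⟨m • α, hintegrable⟩, (Int.cast_smul_eq_zsmul ℚ m α).symm⟩
  have hmQ : (m : ℚ) ≠ 0 := by exact_mod_cast hm
  have htop : Algebra.adjoin ℚ {(θ : K)} = ⊤ := by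
    rw [eq_top_iff, ← hadj, Algebra.adjoin_le_iff, Set.singleton_subset_iff]
    have : α = ((m : ℚ)⁻¹) • (θ : K) := by
      rw [hθα, inv_smul_smul₀ hmQ]
    rw [this]
    exact Subalgebra.smul_mem _ (Algebra.self_mem_adjoin_singleton ℚ (θ : K)) _
  have hθ : IsIntegral ℚ (θ : K) := IsIntegral.of_finite ℚ _
  have hα : IsIntegral ℚ α := IsIntegral.of_finite ℚ _
  let B := PowerBasis.ofAdjoinEqTop hθ htop
  have hB : B.gen = θ := PowerBasis.ofAdjoinEqTop_gen hθ htop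
  let B' := PowerBasis.ofAdjoinEqTop hα hadj
  have hB' : B'.gen = α := PowerBasis.ofAdjoinEqTop_gen hα hadj
  have hexp := exponent_ne_zero B hB
  have hqα : aeval α q = 0 := by
    rw [hq, ← algebraMap_int_eq, aeval_map_algebraMap, hfα]
  have hmin : minpoly ℚ α = q * C q.leadingCoeff⁻¹ := by
    refine (minpoly.eq_of_irreducible hf hqα).symm
  have hqdeg : q.natDegree = finrank ℚ K := by
    rw [B'.finrank, ← B'.natDegree_minpoly, hB', hmin, natDegree_mul_C]
    exact inv_ne_zero (leadingCoeff_ne_zero.mpr hf.ne_zero)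
  set g := minpoly ℤ θ with hg
  have hgQ : g.map (Int.castRingHom ℚ) = minpoly ℚ (θ : K) :=
    (minpoly.isIntegrallyClosed_eq_field_fractions ℚ K θ.isIntegral).symm
  have hgdeg : (g.map (Int.castRingHom ℚ)).natDegree = finrank ℚ K := by
    rw [B.finrank, ← B.natDegree_minpoly, hB, hgQ]
  have hmap : (g.comp (C m * X)).map (Int.castRingHom ℚ) =
      (g.map (Int.castRingHom ℚ)).comp (C (m : ℚ) * X) := by
    rw [map_comp]
    simp
  have hg1 : ((g.comp (C m * X)).map (Int.castRingHom ℚ)).natDegree = q.natDegree := by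
    rw [hmap, natDegree_comp, natDegree_C_mul_X _ hmQ, mul_one, hgdeg, hqdeg]
  have hdvd : q ∣ (g.comp (C m * X)).map (Int.castRingHom ℚ) := by
    have h1 : minpoly ℚ α ∣ (g.comp (C m * X)).map (Int.castRingHom ℚ) := by
      refine minpoly.dvd ℚ α ?_
      rw [hmap, aeval_comp, hgQ]
      have : aeval α (C (m : ℚ) * X) = (θ : K) := by
        rw [hθα, map_mul, aeval_C, aeval_X, Algebra.smul_def]
      rw [this, minpoly.aeval]
    exact (Dvd.intro _ hmin.symm).trans h1
  obtain ⟨h, hh⟩ := hdvd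
  have hg10 : (g.comp (C m * X)).map (Int.castRingHom ℚ) ≠ 0 := by
    intro h0
    rw [h0, natDegree_zero, hqdeg] at hg1
    exact finrank_pos.ne hg1
  have hh0 : h ≠ 0 := by
    rintro rfl
    exact hg10 (by rw [hh, mul_zero])
  obtain ⟨r, rfl⟩ : ∃ r, h = C r := by
    refine ⟨_, eq_C_of_natDegree_eq_zero ?_⟩
    rw [hh, natDegree_mul hf.ne_zero hh0] at hg1
    omega
  have hr0 : r ≠ 0 := by
    rintro rfl
    simp at hh0
  obtain ⟨a, b, ha, hb, hab⟩ : ∃ a b : ℤ, a ≠ 0 ∧ b ≠ 0 ∧ C a * f = C b * g.comp (C m * X) := by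
    refine ⟨r.num, r.den, Rat.num_ne_zero.mpr hr0, by exact_mod_cast r.den_ne_zero, ?_⟩
    apply Polynomial.map_injective (Int.castRingHom ℚ) Int.cast_injective
    have e : (Int.castRingHom ℚ) r.num = (Int.castRingHom ℚ) r.den * r := by simp
    rw [Polynomial.map_mul, Polynomial.map_mul, hh, ← hq, map_C, map_C, e, C_mul]
    ring
  refine ⟨(a * b * m).natAbs * exponent θ, ?_, ?_⟩
  · exact Nat.mul_ne_zero (Int.natAbs_ne_zero.mpr (mul_ne_zero (mul_ne_zero ha hb) hm)) hexp
  · intro p hp hpN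
    have : Fact p.Prime := ⟨hp⟩
    have h1 : ((a * b * m : ℤ) : ZMod p) ≠ 0 := by
      rw [Ne, ZMod.intCast_zmod_eq_zero_iff_dvd, Int.natCast_dvd]
      exact fun h => hpN (h.mul_right _)
    push_cast at h1
    rw [rootCountMod_eq_of_C_mul_eq (left_ne_zero_of_mul (left_ne_zero_of_mul h1))
      (right_ne_zero_of_mul (left_ne_zero_of_mul h1)) hab,
      rootCountMod_comp_C_mul_X _ (right_ne_zero_of_mul h1)]
    exact rootCountMod_minpoly hp fun h => hpN (h.mul_left _)

theorem aeval_eq_zero_of_eval₂_eq_zero {R : Type*} [CommRing R] {φ : ℤ →+* R} {x : R} {f : ℤ[X]}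
    (h : eval₂ φ x f = 0) : aeval x f = 0 := by
  rwa [aeval_def, RingHom.ext_int (algebraMap ℤ R) φ]

theorem exists_rootCountMod_eq_primeCount {f : ℤ[X]}
    (hf : Irreducible (f.map (Int.castRingHom ℚ))) :
    ∃ (K : Type) (_ : Field K) (_ : NumberField K) (N : ℕ), N ≠ 0 ∧
      ∀ p : ℕ, p.Prime → ¬ p ∣ N → rootCountMod f p = IdealMangoldt.primeCount K p := by
  set q := f.map (Int.castRingHom ℚ) with hq
  have : Fact (Irreducible q) := ⟨hf⟩
  let K := AdjoinRoot q
  have hfin : FiniteDimensional ℚ K := (AdjoinRoot.powerBasis hf.ne_zero).finite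
  have hchar : CharZero K := charZero_of_injective_algebraMap (algebraMap ℚ K).injective
  have hsub : (AdjoinRoot.instAlgebra q : Algebra ℚ K) = DivisionRing.toRatAlgebra :=
    Subsingleton.elim _ _
  have hK : NumberField K := @NumberField.mk _ _ hchar (by rw [← hsub]; exact hfin)
  refine ⟨K, inferInstance, hK,
    exists_rootCountMod_eq_primeCount_of_adjoin_eq_top hf (α := AdjoinRoot.root q) ?_ ?_⟩
  · have h := AdjoinRoot.eval₂_root q
    rw [hq, eval₂_map] at h
    exact aeval_eq_zero_of_eval₂_eq_zero h
  · rw [← hsub]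
    exact AdjoinRoot.adjoinRoot_eq_top

end RootCount

namespace RootCount

theorem eventually_intCast_ne_zero {c : ℤ} (hc : c ≠ 0) :
    ∀ᶠ p : ℕ in atTop, (c : ZMod p) ≠ 0 := by
  filter_upwards [eventually_gt_atTop c.natAbs] with p hp
  rw [Ne, ZMod.intCast_zmod_eq_zero_iff_dvd, Int.natCast_dvd]
  exact fun h => absurd (Nat.le_of_dvd (Int.natAbs_pos.mpr hc) h) (by omega)

theorem exists_map_eq_C_mul (h : ℚ[X]) :
    ∃ (c : ℤ) (H : ℤ[X]), c ≠ 0 ∧ H.map (Int.castRingHom ℚ) = C (c : ℚ) * h := by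
  obtain ⟨b, hb0, hb⟩ := IsLocalization.integerNormalization_spec (nonZeroDivisors ℤ) h
  refine ⟨b, _, nonZeroDivisors.ne_zero hb0, hb.trans ?_⟩
  ext n
  rw [coeff_C_mul, coeff_smul, zsmul_eq_mul]

theorem eventually_aeval_eq_zero_of_dvd {A B : ℤ[X]}
    (h : A.map (Int.castRingHom ℚ) ∣ B.map (Int.castRingHom ℚ)) :
    ∀ᶠ p : ℕ in atTop, p.Prime → ∀ a : ZMod p, aeval a A = 0 → aeval a B = 0 := by
  obtain ⟨h, hh⟩ := h
  obtain ⟨c, H, hc, hH⟩ := exists_map_eq_C_mul h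
  have key : C c * B = A * H := by
    apply Polynomial.map_injective (Int.castRingHom ℚ) Int.cast_injective
    rw [Polynomial.map_mul, Polynomial.map_mul, hh, hH, map_C, eq_intCast]
    ring
  filter_upwards [eventually_intCast_ne_zero hc] with p hcp hp a ha
  have : Fact p.Prime := ⟨hp⟩
  have h2 := congrArg (aeval a) key
  rw [map_mul, map_mul, ha, zero_mul, aeval_C, algebraMap_int_eq, eq_intCast] at h2
  exact (mul_eq_zero.mp h2).resolve_left hcp

theorem eventually_aeval_ne_zero_of_isCoprime {A B : ℤ[X]}
    (h : IsCoprime (A.map (Int.castRingHom ℚ)) (B.map (Int.castRingHom ℚ))) :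
    ∀ᶠ p : ℕ in atTop, p.Prime → ∀ a : ZMod p, aeval a A = 0 → aeval a B ≠ 0 := by
  obtain ⟨u, v, huv⟩ := h
  obtain ⟨c, U, hc, hU⟩ := exists_map_eq_C_mul u
  obtain ⟨d, V, hd, hV⟩ := exists_map_eq_C_mul v
  have key : C d * U * A + C c * V * B = C (c * d) := by
    apply Polynomial.map_injective (Int.castRingHom ℚ) Int.cast_injective
    simp only [Polynomial.map_mul, Polynomial.map_add, hU, hV, map_C, Int.coe_castRingHom,
      C_mul]
    linear_combination (C (c : ℚ) * C (d : ℚ)) * huv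
  filter_upwards [eventually_intCast_ne_zero (mul_ne_zero hc hd)] with p hcp hp a ha hb
  have h2 := congrArg (aeval a) key
  rw [map_add, map_mul, map_mul _ _ B, ha, hb, mul_zero, mul_zero, add_zero, aeval_C,
    algebraMap_int_eq, eq_intCast] at h2
  exact hcp h2.symm

theorem rootCountMod_eq_card {p : ℕ} [NeZero p] (P : ℤ[X]) :
    open scoped Classical in
    rootCountMod P p = (Finset.univ.filter fun a : ZMod p => aeval a P = 0).card := by
  rw [rootCountMod, Nat.card_eq_fintype_card, Fintype.card_subtype]

theorem eventually_rootCountMod_eq_sum {P : ℤ[X]} (hP : P ≠ 0) {F : ℚ[X] → ℤ[X]} {c : ℚ[X] → ℤ}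
    (hc : ∀ q, c q ≠ 0) (hF : ∀ q, (F q).map (Int.castRingHom ℚ) = C (c q : ℚ) * q)
    {s : Finset ℚ[X]}
    (hs : ∀ q, q ∈ s ↔ q.Monic ∧ Irreducible q ∧ q ∣ P.map (Int.castRingHom ℚ)) :
    ∀ᶠ p : ℕ in atTop, p.Prime → rootCountMod P p = ∑ q ∈ s, rootCountMod (F q) p := by
  classical
  have hPQ : P.map (Int.castRingHom ℚ) ≠ 0 :=
    (Polynomial.map_ne_zero_iff Int.cast_injective).mpr hP
  have hassoc : ∀ q, Associated ((F q).map (Int.castRingHom ℚ)) q := by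
    intro q
    have hu : IsUnit (C (c q : ℚ)) := isUnit_C.mpr (IsUnit.mk0 _ (by exact_mod_cast hc q))
    rw [hF, mul_comm]
    exact associated_mul_unit_left _ _ hu
  have h1 : ∀ᶠ p : ℕ in atTop, ∀ q ∈ s, p.Prime →
      ∀ a : ZMod p, aeval a (F q) = 0 → aeval a P = 0 := by
    rw [Filter.eventually_all_finset]
    intro q hq
    exact eventually_aeval_eq_zero_of_dvd ((hassoc q).dvd.trans ((hs q).mp hq).2.2)
  obtain ⟨n, hn⟩ : ∃ n : ℕ, P.map (Int.castRingHom ℚ) ∣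
      ((∏ q ∈ s, F q) ^ n).map (Int.castRingHom ℚ) := by
    have hmul : ∀ m : Multiset ℚ[X], (∀ q ∈ m, q ∈ s) →
        m.prod ∣ (∏ q ∈ s, (F q).map (Int.castRingHom ℚ)) ^ m.card := by
      intro m
      induction m using Multiset.induction with
      | empty => simp
      | cons q m ih =>
        intro h
        rw [Multiset.prod_cons, Multiset.card_cons, pow_succ']
        refine mul_dvd_mul ((hassoc q).symm.dvd.trans (Finset.dvd_prod_of_mem _ ?_))
          (ih fun q' hq' => h q' (Multiset.mem_cons_of_mem hq'))
        exact h q (Multiset.mem_cons_self q m)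
    refine ⟨(UniqueFactorizationMonoid.normalizedFactors (P.map (Int.castRingHom ℚ))).card, ?_⟩
    rw [Polynomial.map_pow, Polynomial.map_prod]
    refine (UniqueFactorizationMonoid.prod_normalizedFactors hPQ).symm.dvd.trans (hmul _ ?_)
    intro q hq
    rw [Polynomial.mem_normalizedFactors_iff hPQ] at hq
    exact (hs q).mpr ⟨hq.2.1, hq.1, hq.2.2⟩
  have h2 := eventually_aeval_eq_zero_of_dvd hn
  have h3 : ∀ᶠ p : ℕ in atTop, ∀ q ∈ s, ∀ q' ∈ s, q ≠ q' → p.Prime →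
      ∀ a : ZMod p, aeval a (F q) = 0 → aeval a (F q') ≠ 0 := by
    rw [Filter.eventually_all_finset]
    intro q hq
    rw [Filter.eventually_all_finset]
    intro q' hq'
    rw [Filter.eventually_imp_distrib_left]
    intro hne
    refine eventually_aeval_ne_zero_of_isCoprime ?_
    refine IsCoprime.of_isCoprime_of_dvd_left (IsCoprime.of_isCoprime_of_dvd_right ?_
      (hassoc q').dvd) (hassoc q).dvd
    obtain ⟨hqm, hqi, -⟩ := (hs q).mp hq
    obtain ⟨hqm', hqi', -⟩ := (hs q').mp hq'
    rw [hqi.coprime_iff_not_dvd]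
    exact fun hdvd => hne (eq_of_monic_of_associated hqm hqm' (hqi.associated_of_dvd hqi' hdvd))
  filter_upwards [h1, h2, h3] with p h1 h2 h3 hp
  have : NeZero p := ⟨hp.ne_zero⟩
  have : Fact p.Prime := ⟨hp⟩
  simp_rw [rootCountMod_eq_card]
  rw [← Finset.card_biUnion]
  · congr 1
    ext a
    simp only [Finset.mem_filter, Finset.mem_univ, true_and, Finset.mem_biUnion]
    constructor
    · intro h
      have := h2 hp a h
      rw [map_pow, map_prod] at this
      exact Finset.prod_eq_zero_iff.mp (eq_zero_of_pow_eq_zero this)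
    · rintro ⟨q, hq, h⟩
      exact h1 q hq hp a h
  · intro q hq q' hq' hne
    refine Finset.disjoint_left.mpr fun a ha hb => ?_
    exact h3 q hq q' hq' hne hp a (Finset.mem_filter.mp ha).2 (Finset.mem_filter.mp hb).2

end RootCount

namespace RootCount

open Topology

theorem mem_primesIn {y : ℝ} {p : ℕ} : p ∈ primesIn y ↔ p.Prime ∧ y ≤ p ∧ (p : ℝ) < 2 * y := by
  rw [primesIn, Finset.mem_filter, Finset.mem_range, and_iff_right_iff_imp]
  rintro ⟨-, -, h⟩
  have := h.le.trans (Nat.le_ceil _)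
  have : p ≤ ⌈2 * y⌉₊ := by exact_mod_cast this
  omega

section

variable {g : ℕ → ℝ}

theorem tendsto_sum_lt_div (h : Tendsto (fun x : ℝ => (∑ p ∈ (Finset.Icc 1 ⌊x⌋₊).filter Nat.Prime,
      g p) / x) atTop (𝓝 1)) :
    Tendsto (fun x : ℝ => (∑ p ∈ (Finset.range ⌈x⌉₊).filter Nat.Prime, g p) / x) atTop (𝓝 1) := by
  have h1 : Tendsto (fun x : ℝ => ((⌈x⌉₊ - 1 : ℕ) : ℝ)) atTop atTop :=
    tendsto_natCast_atTop_atTop.comp ((tendsto_sub_atTop_nat 1).comp tendsto_nat_ceil_atTop)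
  have h2 : Tendsto (fun x : ℝ => ((⌈x⌉₊ - 1 : ℕ) : ℝ) / x) atTop (𝓝 1) := by
    have := (tendsto_nat_ceil_div_atTop (R := ℝ)).sub tendsto_inv_atTop_zero
    rw [sub_zero] at this
    refine this.congr' ?_
    filter_upwards [eventually_gt_atTop 0] with x hx
    have : 1 ≤ ⌈x⌉₊ := Nat.one_le_ceil_iff.mpr hx
    push_cast [Nat.cast_sub this]
    rw [sub_div, one_div]
  have h3 := (h.comp h1).mul h2
  rw [mul_one] at h3
  refine h3.congr' ?_
  filter_upwards [eventually_gt_atTop 1] with x hx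
  have hc : 1 < ⌈x⌉₊ := Nat.lt_ceil.mpr (by exact_mod_cast hx)
  have hne : ((⌈x⌉₊ - 1 : ℕ) : ℝ) ≠ 0 := by
    rw [Nat.cast_ne_zero]
    omega
  simp only [Function.comp_apply, Nat.floor_natCast]
  rw [div_mul_div_cancel₀ hne]
  congr 1
  refine Finset.sum_congr ?_ fun _ _ => rfl
  ext p
  simp only [Finset.mem_filter, Finset.mem_Icc, Finset.mem_range]
  constructor
  · rintro ⟨h, hp⟩
    exact ⟨by omega, hp⟩
  · rintro ⟨h, hp⟩
    exact ⟨⟨hp.one_le, by omega⟩, hp⟩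

theorem tendsto_sum_primesIn_div
    (h : Tendsto (fun x : ℝ => (∑ p ∈ (Finset.Icc 1 ⌊x⌋₊).filter Nat.Prime, g p) / x) atTop (𝓝 1)) :
    Tendsto (fun y : ℝ => (∑ p ∈ primesIn y, g p) / y) atTop (𝓝 1) := by
  have h1 := tendsto_sum_lt_div h
  have h2 : Tendsto (fun y : ℝ => 2 * y) atTop atTop :=
    tendsto_id.const_mul_atTop (by norm_num)
  have h3 := ((h1.comp h2).const_mul 2).sub h1
  norm_num at h3
  refine h3.congr' ?_
  filter_upwards [eventually_gt_atTop 0] with y hy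
  have hunion : (Finset.range ⌈2 * y⌉₊).filter Nat.Prime =
      primesIn y ∪ (Finset.range ⌈y⌉₊).filter Nat.Prime := by
    ext p
    simp only [Finset.mem_union, mem_primesIn, Finset.mem_filter, Finset.mem_range, Nat.lt_ceil]
    constructor
    · rintro ⟨h, hp⟩
      rcases le_or_gt y p with h' | h'
      · exact Or.inl ⟨hp, h', h⟩
      · exact Or.inr ⟨h', hp⟩
    · rintro (⟨hp, h', h⟩ | ⟨h, hp⟩)
      · exact ⟨h, hp⟩
      · exact ⟨by linarith, hp⟩
  have hdisj : Disjoint (primesIn y) ((Finset.range ⌈y⌉₊).filter Nat.Prime) := by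
    refine Finset.disjoint_left.mpr fun p hp hp' => ?_
    have h1 := (mem_primesIn.mp hp).2.1
    have h2 := Nat.lt_ceil.mp (Finset.mem_range.mp (Finset.mem_filter.mp hp').1)
    linarith
  rw [hunion, Finset.sum_union hdisj]
  field_simp
  ring

theorem tendsto_sum_primesIn_mul_log_div (hg : ∀ p, 0 ≤ g p)
    (h : Tendsto (fun x : ℝ => (∑ p ∈ (Finset.Icc 1 ⌊x⌋₊).filter Nat.Prime,
      g p * Real.log p) / x) atTop (𝓝 1)) :
    Tendsto (fun y : ℝ => (∑ p ∈ primesIn y, g p) * Real.log y / y) atTop (𝓝 1) := by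
  have h1 := tendsto_sum_primesIn_div h
  have h2 : Tendsto (fun y : ℝ => 1 - Real.log 2 / Real.log (2 * y)) atTop (𝓝 1) := by
    have : Tendsto (fun y : ℝ => 2 * y) atTop atTop :=
      tendsto_id.const_mul_atTop (by norm_num)
    simpa using ((Real.tendsto_log_atTop.comp this).const_div_atTop (Real.log 2)).const_sub 1
  have h3 := h1.mul h2
  rw [mul_one] at h3
  refine tendsto_of_tendsto_of_tendsto_of_le_of_le' h3 h1 ?_ ?_
  · filter_upwards [eventually_gt_atTop 1] with y hy
    have hl2 : 0 < Real.log (2 * y) := Real.log_pos (by linarith)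
    have hly : 0 < Real.log y := Real.log_pos hy
    have e : 1 - Real.log 2 / Real.log (2 * y) = Real.log y / Real.log (2 * y) := by
      rw [eq_div_iff hl2.ne', sub_mul, div_mul_cancel₀ _ hl2.ne',
        Real.log_mul two_ne_zero (by linarith)]
      ring
    have hle : ∑ p ∈ primesIn y, g p * Real.log p ≤
        (∑ p ∈ primesIn y, g p) * Real.log (2 * y) := by
      rw [Finset.sum_mul]
      refine Finset.sum_le_sum fun p hp => mul_le_mul_of_nonneg_left ?_ (hg p)
      obtain ⟨hp, h, h'⟩ := mem_primesIn.mp hp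
      exact Real.log_le_log (by linarith) h'.le
    rw [e, div_mul_div_comm, div_le_div_iff₀ (by positivity) (by positivity)]
    calc (∑ p ∈ primesIn y, g p * Real.log p) * Real.log y * y
        ≤ ((∑ p ∈ primesIn y, g p) * Real.log (2 * y)) * Real.log y * y := by gcongr
      _ = _ := by ring
  · filter_upwards [eventually_gt_atTop 1] with y hy
    gcongr
    rw [Finset.sum_mul]
    refine Finset.sum_le_sum fun p hp => mul_le_mul_of_nonneg_left ?_ (hg p)
    exact Real.log_le_log (by linarith) (mem_primesIn.mp hp).2.1

end

theorem eventually_forall_primesIn {Q : ℕ → Prop} (h : ∀ᶠ p : ℕ in atTop, p.Prime → Q p) :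
    ∀ᶠ y : ℝ in atTop, ∀ p ∈ primesIn y, Q p := by
  obtain ⟨N, hN⟩ := eventually_atTop.mp h
  filter_upwards [eventually_ge_atTop (N : ℝ)] with y hy p hp
  obtain ⟨hp, h, -⟩ := mem_primesIn.mp hp
  exact hN p (by exact_mod_cast hy.trans h) hp

theorem tendsto_sum_rootCountMod_of_irreducible {f : ℤ[X]}
    (hf : Irreducible (f.map (Int.castRingHom ℚ))) :
    Tendsto (fun y : ℝ => (∑ p ∈ primesIn y, (rootCountMod f p : ℝ)) * Real.log y / y)
      atTop (𝓝 1) := by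
  obtain ⟨K, _, _, N, hN, h⟩ := exists_rootCountMod_eq_primeCount hf
  refine (tendsto_sum_primesIn_mul_log_div (fun _ => Nat.cast_nonneg _)
    (IdealMangoldt.tendsto_sum_primeCount_div K)).congr' ?_
  have : ∀ᶠ p : ℕ in atTop, p.Prime → rootCountMod f p = IdealMangoldt.primeCount K p := by
    filter_upwards [eventually_gt_atTop N] with p hp hpp
    exact h p hpp fun hd => absurd (Nat.le_of_dvd (Nat.pos_of_ne_zero hN) hd) (by omega)
  filter_upwards [eventually_forall_primesIn this] with y hy
  rw [Finset.sum_congr rfl fun p hp => congrArg Nat.cast (hy p hp)]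

theorem rootCountMod_X (p : ℕ) : rootCountMod X p = 1 := by
  simp [rootCountMod]

theorem tendsto_card_primesIn_mul_log_div :
    Tendsto (fun y : ℝ => ((primesIn y).card : ℝ) * Real.log y / y) atTop (𝓝 1) := by
  simpa [rootCountMod_X] using tendsto_sum_rootCountMod_of_irreducible (f := X)
    (by simpa using irreducible_X)

end RootCount

theorem stmt7 (P₀ : Polynomial ℤ) (hP₀ : P₀ ≠ 0) :
    Tendsto (avgRootCount P₀) atTop
      (nhds (Nat.card {q : Polynomial ℚ //
        q.Monic ∧ Irreducible q ∧ q ∣ P₀.map (Int.castRingHom ℚ)} : ℝ)) := by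
  classical
  have hPQ : P₀.map (Int.castRingHom ℚ) ≠ 0 :=
    (Polynomial.map_ne_zero_iff Int.cast_injective).mpr hP₀
  choose c F hc hF using RootCount.exists_map_eq_C_mul
  let s := (UniqueFactorizationMonoid.normalizedFactors (P₀.map (Int.castRingHom ℚ))).toFinset
  have hs : ∀ q, q ∈ s ↔ q.Monic ∧ Irreducible q ∧ q ∣ P₀.map (Int.castRingHom ℚ) := by
    intro q
    rw [Multiset.mem_toFinset, Polynomial.mem_normalizedFactors_iff hPQ]
    tauto
  have hcard : Nat.card {q : Polynomial ℚ //
      q.Monic ∧ Irreducible q ∧ q ∣ P₀.map (Int.castRingHom ℚ)} = s.card := by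
    rw [← Fintype.card_coe, ← Nat.card_eq_fintype_card]
    exact Nat.card_congr (Equiv.subtypeEquivRight fun q => (hs q).symm)
  rw [hcard]
  have hirr : ∀ q ∈ s, Irreducible ((F q).map (Int.castRingHom ℚ)) := by
    intro q hq
    rw [hF]
    have hu : IsUnit (C (c q : ℚ)) := isUnit_C.mpr (IsUnit.mk0 _ (by exact_mod_cast hc q))
    exact (irreducible_isUnit_mul hu).mpr ((hs q).mp hq).2.1
  have hnum := tendsto_finsetSum s fun q hq =>
    RootCount.tendsto_sum_rootCountMod_of_irreducible (hirr q hq)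
  have hlim := hnum.div RootCount.tendsto_card_primesIn_mul_log_div one_ne_zero
  rw [Finset.sum_const, nsmul_eq_mul, mul_one, div_one] at hlim
  refine hlim.congr' ?_
  filter_upwards [RootCount.eventually_forall_primesIn
    (RootCount.eventually_rootCountMod_eq_sum hP₀ hc hF hs), eventually_gt_atTop 1] with y hy hy1
  have hly : Real.log y ≠ 0 := (Real.log_pos hy1).ne'
  have hy0 : y ≠ 0 := by positivity
  have hsum : ∑ p ∈ primesIn y, (rootCountMod P₀ p : ℝ) =
      ∑ q ∈ s, ∑ p ∈ primesIn y, (rootCountMod (F q) p : ℝ) := by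
    rw [Finset.sum_comm]
    refine Finset.sum_congr rfl fun p hp => ?_
    rw [hy p hp, Nat.cast_sum]
  simp only [Pi.div_apply]
  rw [avgRootCount, hsum, ← Finset.sum_div, ← Finset.sum_mul,
    div_div_div_cancel_right₀ hy0, mul_div_mul_right _ _ hly]
end

section
/- There is an absolute constant N₀ such that the following holds. Let P ∈ ℤ[x] be an irreducible polynomial of degree n ≥ N₀ with complex roots α_1, …, α_n, and let s ≥ 4·log n be a real number. Then there exists a prime q with s < q ≤ 2s such that for all i ≠ j the ratio α_i/α_j is not a q-th root of unity. -/
open Polynomial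

open Finset in
theorem centralBinom_le_mul_prod_primes {m : ℕ} (hm : 2 < m) :
    m.centralBinom ≤ (2 * m) ^ Nat.sqrt (2 * m) * 4 ^ (2 * m / 3) *
      ∏ q ∈ Ioc m (2 * m) with q.Prime, q := by
  set R := range (2 * m + 1)
  have hbound : ∀ p ∈ R, p ^ m.centralBinom.factorization p ≤
      (if p ∈ Icc 1 (Nat.sqrt (2 * m)) then 2 * m else 1) *
      (if p ∈ {p ∈ range (2 * m / 3 + 1) | p.Prime} then p else 1) *
      (if p ∈ {p ∈ Ioc m (2 * m) | p.Prime} then p else 1) := by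
    intro p hpR
    have hp2 : p ≤ 2 * m := by simpa [R, Nat.lt_succ_iff] using hpR
    have hone : ∀ c : Prop, [Decidable c] → ∀ k : ℕ, 0 < k → 1 ≤ if c then k else 1 := by
      intro c _ k hk; split_ifs <;> omega
    by_cases hp : p.Prime
    swap
    · rw [Nat.factorization_eq_zero_of_not_prime _ hp, pow_zero]
      simp only [mem_filter, hp, and_false, if_false, mul_one]
      exact hone _ _ (by omega)
    by_cases h1 : p ≤ Nat.sqrt (2 * m)
    · rw [if_pos (mem_Icc.2 ⟨hp.one_lt.le, h1⟩), mul_assoc]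
      exact (Nat.pow_factorization_choose_le (by omega)).trans
        (Nat.le_mul_of_pos_right _ (Nat.mul_pos (hone _ _ hp.pos) (hone _ _ hp.pos)))
    have hv : p ^ m.centralBinom.factorization p ≤ p :=
      (Nat.pow_le_pow_right hp.pos (Nat.factorization_choose_le_one
        (Nat.sqrt_lt'.mp (not_le.1 h1)))).trans (pow_one p).le
    rw [if_neg (by simp [h1]), one_mul]
    by_cases h2 : p ≤ 2 * m / 3
    · rw [if_pos (by simp [hp]; omega)]
      exact hv.trans (Nat.le_mul_of_pos_right _ (hone _ _ hp.pos))
    by_cases h3 : p ≤ m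
    · rw [Nat.factorization_centralBinom_of_two_mul_self_lt_three_mul hm h3 (by omega), pow_zero]
      exact Nat.mul_pos (hone _ _ hp.pos) (hone _ _ hp.pos)
    · rw [if_neg (by simp; omega), if_pos (by simp [hp]; omega), one_mul]
      exact hv
  have hsub : ∀ T ⊆ R, ∀ g : ℕ → ℕ, ∏ p ∈ R, (if p ∈ T then g p else 1) = ∏ p ∈ T, g p := by
    intro T hT g
    rw [prod_ite_mem, inter_eq_right.2 hT]
  have hsqrt : Nat.sqrt (2 * m) ≤ 2 * m := Nat.sqrt_le_self _
  rw [← Nat.prod_pow_factorization_centralBinom]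
  refine (prod_le_prod' hbound).trans ?_
  rw [prod_mul_distrib, prod_mul_distrib,
    hsub _ (fun x hx ↦ by simp [R] at hx ⊢; omega) fun _ ↦ 2 * m,
    hsub _ (fun x hx ↦ by simp [R] at hx ⊢; omega) fun p ↦ p,
    hsub _ (fun x hx ↦ by simp [R] at hx ⊢; omega) fun p ↦ p]
  gcongr
  · simp
  · exact primorial_le_four_pow _

open Finset Filter Asymptotics in
theorem eventually_exp_lt_prod_primes_sub_one :
    ∀ᶠ m : ℕ in atTop, Real.exp ((m + 1) / 4) <
      ((∏ q ∈ Ioc m (2 * m) with q.Prime, (q - 1) : ℕ) : ℝ) := by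
  have hreal : ∀ᶠ x : ℝ in atTop,
      3 * (x + 1) / 8 + Real.log x + √(2 * x) * Real.log (2 * x) < x / 3 * Real.log 4 := by
    have hlog : (fun x : ℝ ↦ Real.log x) =o[atTop] fun x : ℝ ↦ x := Real.isLittleO_log_id_atTop
    have hsqrt : (fun x : ℝ ↦ √(2 * x) * Real.log (2 * x)) =o[atTop] fun x : ℝ ↦ x := by
      have h2 : Tendsto (fun x : ℝ ↦ 2 * x) atTop atTop := tendsto_id.const_mul_atTop two_pos
      have h := ((isLittleO_log_rpow_atTop (r := 1 / 2) (by norm_num)).comp_tendsto h2)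
      have h' := (isBigO_refl (fun x : ℝ ↦ √(2 * x)) atTop).mul_isLittleO h
      refine h'.trans_isBigO (IsBigO.of_bound 2 ?_)
      filter_upwards [eventually_ge_atTop 0] with x hx
      simp only [Function.comp, ← Real.sqrt_eq_rpow]
      rw [Real.mul_self_sqrt (by positivity), norm_mul]
      simp
    filter_upwards [hlog.bound (c := 1 / 100) (by norm_num),
      hsqrt.bound (c := 1 / 100) (by norm_num), eventually_ge_atTop 100] with x h1 h2 hx
    have h4 : Real.log 4 = 2 * Real.log 2 := by
      rw [show (4 : ℝ) = 2 ^ 2 by norm_num, Real.log_pow]; norm_num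
    have hx' : ‖x‖ = x := Real.norm_of_nonneg (by linarith)
    rw [hx'] at h1 h2
    have := (Real.le_norm_self _).trans h1
    have := (Real.le_norm_self _).trans h2
    have := Real.log_two_gt_d9
    rw [h4]
    nlinarith
  filter_upwards [tendsto_natCast_atTop_atTop.eventually hreal, eventually_ge_atTop 4]
    with m hm hm4
  set S := {q ∈ Ioc m (2 * m) | q.Prime}
  have hSm : ∀ q ∈ S, m < q := fun q hq ↦ (mem_Ioc.1 (mem_filter.1 hq).1).1
  have hcube : (∏ q ∈ S, q) ^ 2 ≤ (∏ q ∈ S, (q - 1)) ^ 3 := by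
    rw [← prod_pow, ← prod_pow]
    refine prod_le_prod' fun q hq ↦ ?_
    obtain ⟨k, rfl⟩ : ∃ k, q = k + 1 := ⟨q - 1, by have := hSm q hq; omega⟩
    have := hSm _ hq
    have hk : 4 ≤ k := by omega
    rw [Nat.add_sub_cancel]
    nlinarith [mul_le_mul hk hk (by norm_num) (by omega), Nat.mul_le_mul_right (k * k) hk]
  have hQ : 0 < ∏ q ∈ S, q := prod_pos fun q hq ↦ by have := hSm q hq; omega
  have hQ1 : 0 < ∏ q ∈ S, (q - 1) := prod_pos fun q hq ↦ by have := hSm q hq; omega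
  set Q := ∏ q ∈ S, q
  set Q₁ := ∏ q ∈ S, (q - 1)
  have hm0 : (0 : ℝ) < m := by positivity
  have hmain : (4 : ℝ) ^ m ≤
      m * ((2 * m) ^ Nat.sqrt (2 * m) * 4 ^ (2 * m / 3) * Q) := by
    exact_mod_cast (Nat.four_pow_lt_mul_centralBinom m hm4).le.trans
      (Nat.mul_le_mul_left m (centralBinom_le_mul_prod_primes (by omega)))
  have hQ' : (0 : ℝ) < Q := by exact_mod_cast hQ
  have hQ1' : (0 : ℝ) < Q₁ := by exact_mod_cast hQ1
  have hlogmain := Real.log_le_log (by positivity) hmain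
  rw [Real.log_mul (by positivity) (by positivity), Real.log_mul (by positivity) (by positivity),
    Real.log_mul (by positivity) (by positivity), Real.log_pow, Real.log_pow, Real.log_pow]
    at hlogmain
  have hlogcube : 2 * Real.log Q ≤ 3 * Real.log Q₁ := by
    have : (Q : ℝ) ^ 2 ≤ (Q₁ : ℝ) ^ 3 := by exact_mod_cast hcube
    simpa [Real.log_pow] using Real.log_le_log (by positivity) this
  have hs : (Nat.sqrt (2 * m) : ℝ) ≤ √(2 * m) := by
    simpa using Real.nat_sqrt_le_real_sqrt (a := 2 * m)
  have hd : ((2 * m / 3 : ℕ) : ℝ) ≤ 2 * m / 3 := by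
    simpa using Nat.cast_div_le (α := ℝ) (m := 2 * m) (n := 3)
  have hl : 0 ≤ Real.log (2 * m) := Real.log_nonneg (by
    have : (4 : ℝ) ≤ m := by exact_mod_cast hm4
    linarith)
  have hl4 : 0 ≤ Real.log 4 := Real.log_nonneg (by norm_num)
  rw [← Real.lt_log_iff_exp_lt hQ1']
  have := mul_le_mul_of_nonneg_right hs hl
  have := mul_le_mul_of_nonneg_right hd hl4
  linarith

open IntermediateField in
theorem notMem_adjoin_pow_of_pow_eq {F E : Type*} [Field F] [Field E] [Algebra F E] {α z w : E}
    (hα : IsIntegral F α) (hz : aeval z (minpoly F α) = 0) (hw : aeval w (minpoly F α) = 0)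
    (hzw : z ≠ w) {q : ℕ} (hq : z ^ q = w ^ q) : α ∉ F⟮α ^ q⟯ := by
  intro hmem
  rw [← mem_toSubalgebra, adjoin_simple_toSubalgebra_of_isAlgebraic (hα.pow q).isAlgebraic,
    Algebra.adjoin_singleton_eq_range_aeval] at hmem
  obtain ⟨f, hf⟩ := hmem
  have hdvd : minpoly F α ∣ X - expand F q f := minpoly.dvd F α (by
    simpa [expand_aeval, sub_eq_zero] using hf.symm)
  have hroot : ∀ x : E, aeval x (minpoly F α) = 0 → x = aeval (x ^ q) f := fun x hx ↦ by
    have := aeval_eq_zero_of_dvd_aeval_eq_zero hdvd hx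
    simpa [expand_aeval, sub_eq_zero] using this
  exact hzw ((hroot z hz).trans (hq ▸ (hroot w hw).symm))

open IntermediateField in
theorem dvd_finrank_or_exists_isPrimitiveRoot {F E : Type*} [Field F] [Field E] [Algebra F E]
    {α z w : E} (hα : IsIntegral F α) (hz : aeval z (minpoly F α) = 0)
    (hw : aeval w (minpoly F α) = 0) (hzw : z ≠ w) {q : ℕ} (hqp : q.Prime)
    (hq : z ^ q = w ^ q) :
    q ∣ Module.finrank F F⟮α⟯ ∨ ∃ ζ : F⟮α⟯, IsPrimitiveRoot ζ q := by
  have hα_notMem := notMem_adjoin_pow_of_pow_eq hα hz hw hzw hq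
  have hle : F⟮α ^ q⟯ ≤ F⟮α⟯ := adjoin_simple_le_iff.2 (pow_mem (mem_adjoin_simple_self F α) q)
  by_cases h : ∃ b : F⟮α ^ q⟯, b ^ q = AdjoinSimple.gen F (α ^ q)
  · right
    obtain ⟨b, hb⟩ := h
    have hb' : (b : E) ^ q = α ^ q := by
      simpa using congrArg (Subtype.val : F⟮α ^ q⟯ → E) hb
    have hα0 : α ≠ 0 := fun h0 ↦ hα_notMem (h0 ▸ zero_mem _)
    have hb0 : (b : E) ≠ 0 := fun h0 ↦ by
      rw [h0, zero_pow hqp.ne_zero] at hb'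
      exact pow_ne_zero q hα0 hb'.symm
    refine ⟨⟨α / b, div_mem (mem_adjoin_simple_self F α) (hle b.2)⟩, ?_⟩
    have := Fact.mk hqp
    rw [IsPrimitiveRoot.iff_orderOf]
    refine orderOf_eq_prime (Subtype.ext ?_) fun h1 ↦ ?_
    · simp [div_pow, hb', hα0]
    · have h1' : α / b = 1 := congrArg Subtype.val h1
      have hmem : ∀ x : E, x = b → x ∈ F⟮α ^ q⟯ := fun x hx ↦ hx ▸ b.2
      exact hα_notMem (hmem α ((div_eq_one_iff_eq hb0).1 h1'))
  · left
    push Not at h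
    have hirr := X_pow_sub_C_irreducible_of_prime hqp h
    have hmin : X ^ q - C (AdjoinSimple.gen F (α ^ q)) = minpoly F⟮α ^ q⟯ α :=
      minpoly.eq_of_irreducible_of_monic hirr (by simp) (monic_X_pow_sub_C _ hqp.ne_zero)
    have hfin : Module.finrank F⟮α ^ q⟯ F⟮α ^ q⟯⟮α⟯ = q := by
      rw [adjoin.finrank hα.tower_top, ← hmin, natDegree_X_pow_sub_C]
    have hfield : restrictScalars F F⟮α ^ q⟯⟮α⟯ = F⟮α⟯ := by
      rw [adjoin_simple_adjoin_simple]
      refine le_antisymm (adjoin_le_iff.2 ?_) (adjoin_simple_le_iff.2 (subset_adjoin _ _ (by simp)))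
      rintro x (rfl | rfl)
      · exact hle (mem_adjoin_simple_self F _)
      · exact mem_adjoin_simple_self F _
    rw [← hfield]
    exact ⟨_, ((Module.finrank_mul_finrank F F⟮α ^ q⟯ F⟮α ^ q⟯⟮α⟯).symm.trans
      (by rw [hfin, mul_comm]))⟩

theorem IsPrimitiveRoot.totient_dvd_finrank {L : Type*} [Field L] [Algebra ℚ L]
    [FiniteDimensional ℚ L] {k : ℕ} (hk : 0 < k) {ζ : L} (hζ : IsPrimitiveRoot ζ k) :
    k.totient ∣ Module.finrank ℚ L := by
  have : CharZero L := algebraRat.charZero L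
  have hroot : aeval ζ (cyclotomic k ℚ) = 0 := by
    rw [aeval_def, eval₂_eq_eval_map, map_cyclotomic]
    exact hζ.isRoot_cyclotomic hk
  rw [← natDegree_cyclotomic k ℚ, minpoly.eq_of_irreducible_of_monic
    (cyclotomic.irreducible_rat hk) hroot (cyclotomic.monic k ℚ)]
  exact minpoly.degree_dvd (IsIntegral.of_finite ℚ ζ)

theorem exists_isPrimitiveRoot_prod_primes {L : Type*} [CommMonoid L] {B : Finset ℕ}
    (hB : ∀ q ∈ B, q.Prime) (hroot : ∀ q ∈ B, ∃ ζ : L, IsPrimitiveRoot ζ q) :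
    ∃ ζ : L, IsPrimitiveRoot ζ (∏ q ∈ B, q) := by
  induction B using Finset.induction_on with
  | empty => exact ⟨1, by simp⟩
  | insert q B hqB ih =>
    simp only [Finset.forall_mem_insert] at hB hroot
    obtain ⟨ζ, hζ⟩ := ih hB.2 hroot.2
    obtain ⟨ξ, hξ⟩ := hroot.1
    refine ⟨ξ * ζ, ?_⟩
    rw [IsPrimitiveRoot.iff_orderOf] at *
    rw [Finset.prod_insert hqB, ← hζ, ← hξ]
    refine (Commute.all ξ ζ).orderOf_mul_eq_mul_orderOf_of_coprime ?_
    rw [hζ, hξ]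
    exact Nat.Coprime.prod_right fun p hp ↦
      (Nat.coprime_primes hB.1 (hB.2 p hp)).2 fun h ↦ hqB (h ▸ hp)

theorem totient_prod_primes {B : Finset ℕ} (hB : ∀ q ∈ B, q.Prime) :
    (∏ q ∈ B, q).totient = ∏ q ∈ B, (q - 1) := by
  induction B using Finset.induction_on with
  | empty => simp
  | insert q B hqB ih =>
    simp only [Finset.forall_mem_insert] at hB
    rw [Finset.prod_insert hqB, Finset.prod_insert hqB, Nat.totient_mul, ih hB.2,
      Nat.totient_prime hB.1]
    exact Nat.Coprime.prod_right fun p hp ↦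
      (Nat.coprime_primes hB.1 (hB.2 p hp)).2 fun h ↦ hqB (h ▸ hp)

theorem Nat.Prime.coprime_sub_one_of_le_two_mul {p q : ℕ} (hp : p.Prime) (hq : q.Prime)
    (hp3 : 2 < p) (hqp : q ≤ 2 * p) : p.Coprime (q - 1) := by
  refine (Nat.Prime.coprime_iff_not_dvd hp).2 ?_
  rintro ⟨c, hc⟩
  have := hq.two_le
  have hc1 : c = 1 := by
    have h0 : c ≠ 0 := by rintro rfl; omega
    have h2 : c < 2 := by
      by_contra! h
      have := Nat.mul_le_mul_left p h
      omega
    omega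
  subst hc1
  have hpo := hp.eq_two_or_odd
  have hqo := hq.eq_two_or_odd
  omega

theorem prod_primes_sub_one_le_finrank {L : Type*} [Field L] [Algebra ℚ L]
    [FiniteDimensional ℚ L] {S : Finset ℕ} {m : ℕ} (hm : 2 ≤ m)
    (hS : ∀ q ∈ S, q.Prime ∧ m < q ∧ q ≤ 2 * m)
    (h : ∀ q ∈ S, q ∣ Module.finrank ℚ L ∨ ∃ ζ : L, IsPrimitiveRoot ζ q) :
    ∏ q ∈ S, (q - 1) ≤ Module.finrank ℚ L := by
  classical
  set n := Module.finrank ℚ L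
  set A := {q ∈ S | q ∣ n}
  set B := {q ∈ S | ¬ q ∣ n}
  have hA : ∀ q ∈ A, q ∈ S ∧ q ∣ n := fun q hq ↦ Finset.mem_filter.1 hq
  have hB : ∀ q ∈ B, q ∈ S ∧ ¬ q ∣ n := fun q hq ↦ Finset.mem_filter.1 hq
  have hBp : ∀ q ∈ B, q.Prime := fun q hq ↦ (hS q (hB q hq).1).1
  have hAn : ∏ q ∈ A, q ∣ n :=
    Finset.prod_primes_dvd n (fun q hq ↦ (hS q (hA q hq).1).1.prime) fun q hq ↦ (hA q hq).2
  obtain ⟨ζ, hζ⟩ := exists_isPrimitiveRoot_prod_primes hBp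
    fun q hq ↦ (h q (hB q hq).1).resolve_left (hB q hq).2
  have hBn := hζ.totient_dvd_finrank (Finset.prod_pos fun q hq ↦ (hBp q hq).pos)
  rw [totient_prod_primes hBp] at hBn
  have hcop : (∏ q ∈ A, q).Coprime (∏ q ∈ B, (q - 1)) :=
    Nat.Coprime.prod_left fun p hp ↦ Nat.Coprime.prod_right fun q hq ↦ by
      obtain ⟨hpp, hp1, -⟩ := hS p (hA p hp).1
      obtain ⟨hqp, -, hq2⟩ := hS q (hB q hq).1
      exact hpp.coprime_sub_one_of_le_two_mul hqp (by omega) (by omega)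
  calc ∏ q ∈ S, (q - 1) = (∏ q ∈ A, (q - 1)) * ∏ q ∈ B, (q - 1) :=
        (Finset.prod_filter_mul_prod_filter_not S _ _).symm
    _ ≤ (∏ q ∈ A, q) * ∏ q ∈ B, (q - 1) := by
        gcongr
        exact Nat.sub_le _ _
    _ ≤ n := Nat.le_of_dvd Module.finrank_pos (hcop.mul_dvd_of_dvd_of_dvd hAn hBn)

theorem stmt15 :
    ∃ N₀ : ℕ, ∀ (n : ℕ), N₀ ≤ n → ∀ P : Polynomial ℤ, Irreducible P → P.natDegree = n →
      ∀ s : ℝ, 4 * Real.log n ≤ s →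
        ∃ q : ℕ, q.Prime ∧ s < (q : ℝ) ∧ (q : ℝ) ≤ 2 * s ∧
          ∀ z ∈ (P.map (Int.castRingHom ℂ)).roots,
            ∀ w ∈ (P.map (Int.castRingHom ℂ)).roots,
              z ≠ w → (z / w) ^ q ≠ 1 := by
  obtain ⟨M, hM⟩ := Filter.eventually_atTop.1 (
    eventually_exp_lt_prod_primes_sub_one.and (Filter.eventually_ge_atTop 2))
  obtain ⟨N, hN⟩ := Filter.eventually_atTop.1
    ((Real.tendsto_log_atTop.comp tendsto_natCast_atTop_atTop).eventually_ge_atTop (M : ℝ))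
  refine ⟨max N 1, fun n hn P hP hPn s hs ↦ ?_⟩
  have hlogn : (M : ℝ) ≤ Real.log n := hN n (le_of_max_le_left hn)
  have hn1 : 1 ≤ n := le_of_max_le_right hn
  have hs0 : 0 ≤ s := by linarith [(Nat.cast_nonneg M : (0 : ℝ) ≤ M)]
  obtain ⟨hexp, hm2⟩ := hM ⌊s⌋₊ (Nat.le_floor (by linarith [(Nat.cast_nonneg M : (0 : ℝ) ≤ M)]))
  by_contra! hcon
  set p := P.map (Int.castRingHom ℚ) with hp
  have hp_irr : Irreducible p :=
    (IsPrimitive.Int.irreducible_iff_irreducible_map_cast (hP.isPrimitive (by omega))).1 hP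
  have hp_deg : p.natDegree = n := by
    rw [hp, natDegree_map_eq_of_injective Int.cast_injective, hPn]
  obtain ⟨α, hα⟩ := IsAlgClosed.exists_aeval_eq_zero ℂ p hp_irr.degree_pos.ne'
  have hmin := minpoly.eq_of_irreducible hp_irr hα
  have hint : IsIntegral ℚ α := isAlgebraic_iff_isIntegral.1 ⟨p, hp_irr.ne_zero, hα⟩
  have hroot : ∀ z ∈ (P.map (Int.castRingHom ℂ)).roots, aeval z (minpoly ℚ α) = 0 := by
    intro z hz
    have hz' := (mem_roots'.1 hz).2
    rw [IsRoot, eval_map, eval₂_eq_eval_map] at hz'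
    have : aeval z p = 0 := by
      rw [hp, aeval_def, eval₂_map, eval₂_eq_eval_map, ← hz']
      congr 2
    rw [← hmin, map_mul, this, zero_mul]
  have hfin : Module.finrank ℚ (IntermediateField.adjoin ℚ {α}) = n := by
    rw [IntermediateField.adjoin.finrank hint, ← hmin,
      natDegree_mul_C (by simp [hp_irr.ne_zero]), hp_deg]
  have := IntermediateField.adjoin.finiteDimensional hint
  have hle := prod_primes_sub_one_le_finrank (L := IntermediateField.adjoin ℚ {α}) hm2
    (S := {q ∈ Finset.Ioc ⌊s⌋₊ (2 * ⌊s⌋₊) | q.Prime})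
    (fun q hq ↦ by
      obtain ⟨hq1, hqp⟩ := Finset.mem_filter.1 hq
      exact ⟨hqp, Finset.mem_Ioc.1 hq1⟩)
    fun q hq ↦ by
      obtain ⟨hq1, hqp⟩ := Finset.mem_filter.1 hq
      obtain ⟨hq1, hq2⟩ := Finset.mem_Ioc.1 hq1
      have hq2' : (q : ℝ) ≤ 2 * ⌊s⌋₊ := by exact_mod_cast hq2
      obtain ⟨z, hz, w, hw, hzw, hpow⟩ := hcon q hqp ((Nat.floor_lt hs0).1 hq1)
        (by linarith [Nat.floor_le hs0])
      have hw0 : w ^ q ≠ 0 := fun h0 ↦ by simp [div_pow, h0] at hpow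
      rw [div_pow, div_eq_one_iff_eq hw0] at hpow
      exact dvd_finrank_or_exists_isPrimitiveRoot hint (hroot z hz) (hroot w hw) hzw hqp hpow
  rw [hfin] at hle
  have hn_exp : (n : ℝ) ≤ Real.exp ((⌊s⌋₊ + 1) / 4) := by
    rw [← Real.log_le_iff_le_exp (by exact_mod_cast hn1)]
    linarith [Nat.lt_floor_add_one s]
  have hle' := (Nat.cast_le (α := ℝ)).2 hle
  linarith
end

section
/- Let Ω be a finite set, let G be a subgroup of the symmetric group on Ω, and let m ≥ 1 be an integer with |Ω| ≥ m. Consider the diagonal action of G on Ω^m. Then the number of orbits of G on Ω^m is at least B_m, and equality holds if and only if the action of G on Ω is m-transitive. -/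
/-- The `m`-th Bell number: the number of equivalence relations on a set with `m` elements. -/
noncomputable def bell (m : ℕ) : ℕ := Nat.card (Setoid (Fin m))

/-- A permutation group `G ≤ Sym(α)` is `m`-transitive if any tuple of `m` pairwise distinct
elements can be mapped to any other such tuple by an element of `G`. -/
def IsMultiplyTransitive {α : Type*} (G : Subgroup (Equiv.Perm α)) (m : ℕ) : Prop :=
  ∀ x y : Fin m → α, Function.Injective x → Function.Injective y →
    ∃ g ∈ G, ∀ i, g (x i) = y i

namespace MulAction

variable {M α ι : Type*} [Group M] [MulAction M α]

/-- The kernel of a tuple only depends on its orbit under the diagonal action. -/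
def orbitKer : orbitRel.Quotient M (ι → α) → Setoid ι :=
  Quotient.lift Setoid.ker <| by
    rintro _ y ⟨g, rfl⟩
    ext i j
    simp [Setoid.ker_def]

theorem orbitKer_surjective [Finite ι] [Finite α] (h : Nat.card ι ≤ Nat.card α) :
    Function.Surjective (orbitKer : orbitRel.Quotient M (ι → α) → Setoid ι) := by
  intro s
  have hs : Nat.card (Quotient s) ≤ Nat.card α :=
    (Nat.card_le_card_of_surjective _ Quotient.mk_surjective).trans h
  have := Fintype.ofFinite α
  have := Fintype.ofFinite (Quotient s)
  rw [Nat.card_eq_fintype_card, Nat.card_eq_fintype_card] at hs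
  obtain ⟨e⟩ := Function.Embedding.nonempty_of_card_le hs
  refine ⟨Quotient.mk _ fun i ↦ e (Quotient.mk s i), ?_⟩
  ext i j
  exact e.injective.eq_iff.trans Quotient.eq

/-- A multiply pretransitive action is transitive on tuples with a given kernel. -/
theorem exists_smul_eq_of_ker_eq [Finite α] {m : ℕ} [IsMultiplyPretransitive M α m]
    (h : m ≤ Nat.card α) {x y : Fin m → α} (hxy : Setoid.ker x = Setoid.ker y) :
    ∃ g : M, g • x = y := by
  let s := Setoid.ker x
  have hs : Nat.card (Quotient s) ≤ m := by
    simpa using Nat.card_le_card_of_surjective (Quotient.mk s) Quotient.mk_surjective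
  have := isMultiplyPretransitive_of_le (G := M) hs h
  let e : Fin (Nat.card (Quotient s)) ≃ Quotient s := (Finite.equivFin _).symm
  have lift_inj {z : Fin m → α} (hz : s = Setoid.ker z) :
      Function.Injective (Quotient.lift z fun i j hij ↦ (Setoid.ext_iff.mp hz i j).mp hij) := by
    rintro ⟨i⟩ ⟨j⟩ hij
    exact Quotient.sound ((Setoid.ext_iff.mp hz i j).mpr hij)
  obtain ⟨g, hg⟩ := exists_smul_eq M
    (e.toEmbedding.trans ⟨_, lift_inj rfl⟩) (e.toEmbedding.trans ⟨_, lift_inj hxy⟩)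
  refine ⟨g, funext fun i ↦ ?_⟩
  simpa [e] using DFunLike.congr_fun hg (e.symm (Quotient.mk s i))

theorem orbitKer_injective_iff [Finite α] {m : ℕ} (h : m ≤ Nat.card α) :
    Function.Injective (orbitKer : orbitRel.Quotient M (Fin m → α) → Setoid (Fin m)) ↔
      IsMultiplyPretransitive M α m := by
  refine ⟨fun hinj ↦ ⟨fun x y ↦ ?_⟩, fun _ ↦ ?_⟩
  · have hker : Setoid.ker (y : Fin m → α) = Setoid.ker x := by
      ext i j
      simp [Setoid.ker_def]
    obtain ⟨g, hg⟩ := Quotient.exact (@hinj (Quotient.mk _ ⇑y) (Quotient.mk _ ⇑x) hker)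
    exact ⟨g, DFunLike.coe_injective hg⟩
  · rintro ⟨x⟩ ⟨y⟩ hxy
    obtain ⟨g, hg⟩ := exists_smul_eq_of_ker_eq (M := M) h (x := y) (y := x) hxy.symm
    exact Quotient.sound ⟨g, hg⟩

end MulAction

theorem isMultiplyTransitive_iff_isMultiplyPretransitive {α : Type*}
    (G : Subgroup (Equiv.Perm α)) (m : ℕ) :
    IsMultiplyTransitive G m ↔ MulAction.IsMultiplyPretransitive G α m := by
  rw [MulAction.isMultiplyPretransitive_iff]
  constructor
  · intro h x y
    obtain ⟨g, hg, hxy⟩ := h x y x.injective y.injective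
    exact ⟨⟨g, hg⟩, DFunLike.ext _ _ hxy⟩
  · intro h x y hx hy
    obtain ⟨g, hg⟩ := h ⟨x, hx⟩ ⟨y, hy⟩
    exact ⟨g, g.2, DFunLike.congr_fun hg⟩

theorem stmt19 (α : Type*) [Fintype α] (G : Subgroup (Equiv.Perm α)) (m : ℕ)
    (hm : 1 ≤ m) (hcard : m ≤ Fintype.card α) :
    bell m ≤ Nat.card (MulAction.orbitRel.Quotient G (Fin m → α)) ∧
    (Nat.card (MulAction.orbitRel.Quotient G (Fin m → α)) = bell m ↔
      IsMultiplyTransitive G m) := by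
  rw [← Nat.card_eq_fintype_card] at hcard
  have hsurj := MulAction.orbitKer_surjective (M := G) (α := α) (ι := Fin m) (by simpa using hcard)
  have : Finite (MulAction.orbitRel.Quotient G (Fin m → α)) := Quotient.finite _
  have : Finite (Setoid (Fin m)) := Finite.of_surjective _ hsurj
  refine ⟨Nat.card_le_card_of_surjective _ hsurj, ?_⟩
  rw [isMultiplyTransitive_iff_isMultiplyPretransitive, ← MulAction.orbitKer_injective_iff hcard]
  exact ⟨fun h ↦ ((Nat.bijective_iff_surjective_and_card _).mpr ⟨hsurj, h⟩).injective,
    fun h ↦ Nat.card_eq_of_bijective _ ⟨h, hsurj⟩⟩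
end
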